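/- arXiv:1808.10637 — 2 statements merged into one kernel-verified Lean document; each statement's English description precedes it below -/
import Mathlib

section
/- Let n ≥ 3 and p = (n+2)/(n−2). Every bounded solution Z of the linearized equation ΔZ + p U(y)^{p−1} Z = 0 on ℝ^n is a linear combination of the n+1 functions Z_1,…,Z_{n+1}, where Z_i(y) = ∂U/∂y_i for i = 1,…,n and Z_{n+1}(y) = ((n−2)/2)U(y) + y·∇U(y). -/
open Set MeasureTheory Filter Topology Metric Bornology

noncomputable section

/-- The Laplacian of a scalar function on Euclidean `ℝⁿ`, as the sum of second
partial derivatives in the coordinate directions. -/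
def lap {n : ℕ} (f : EuclideanSpace ℝ (Fin n) → ℝ) (x : EuclideanSpace ℝ (Fin n)) : ℝ :=
  ∑ i : Fin n, fderiv ℝ (fun y => fderiv ℝ f y (EuclideanSpace.single i 1)) x
    (EuclideanSpace.single i 1)

/-- The standard Aubin–Talenti bubble `U(y) = α_n (1+|y|²)^{-(n-2)/2}` with
`α_n = (n(n-2))^{(n-2)/4}`. -/
def stdBubble (n : ℕ) (y : EuclideanSpace ℝ (Fin n)) : ℝ :=
  ((n : ℝ) * ((n : ℝ) - 2)) ^ (((n : ℝ) - 2) / 4) * (1 + ‖y‖ ^ 2) ^ (-(((n : ℝ) - 2) / 2))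

/-- The kernel elements `Z_i(y) = ∂U/∂y_i`, `i = 1, …, n`. -/
def kerZ (n : ℕ) (i : Fin n) (y : EuclideanSpace ℝ (Fin n)) : ℝ :=
  fderiv ℝ (stdBubble n) y (EuclideanSpace.single i 1)

/-- The kernel element `Z_{n+1}(y) = ((n-2)/2) U(y) + y·∇U(y)`. -/
def kerZlast (n : ℕ) (y : EuclideanSpace ℝ (Fin n)) : ℝ :=
  ((n : ℝ) - 2) / 2 * stdBubble n y + fderiv ℝ (stdBubble n) y y

/-! ### The Laplacian of explicit test functions -/

lemma basis_sum_inner {n : ℕ} (a y : EuclideanSpace ℝ (Fin n)) :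
    ∑ i : Fin n, inner ℝ a (EuclideanSpace.single i (1 : ℝ)) *
      inner ℝ y (EuclideanSpace.single i (1 : ℝ)) = inner ℝ a y := by
  simp [PiLp.inner_apply, mul_comm]

lemma hasFDerivAt_comp_normSq {n : ℕ} {H : ℝ → ℝ} {h : ℝ} (y : EuclideanSpace ℝ (Fin n))
    (hH : HasDerivAt H h (1 + ‖y‖ ^ 2)) :
    HasFDerivAt (fun y : EuclideanSpace ℝ (Fin n) => H (1 + ‖y‖ ^ 2))
      ((2 * h) • innerSL ℝ y) y := by
  have h1 : HasFDerivAt (fun y : EuclideanSpace ℝ (Fin n) => 1 + ‖y‖ ^ 2)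
      (2 • innerSL ℝ y) y := (hasStrictFDerivAt_norm_sq y).hasFDerivAt.const_add 1
  have h2 := hH.comp_hasFDerivAt y h1
  convert! h2 using 1
  ext v
  simp
  ring

lemma hasFDerivAt_affine {n : ℕ} (a : EuclideanSpace ℝ (Fin n)) (b : ℝ) (k : ℕ)
    (y : EuclideanSpace ℝ (Fin n)) :
    HasFDerivAt (fun y : EuclideanSpace ℝ (Fin n) => (inner ℝ a y + b) ^ k)
      ((k * (inner ℝ a y + b) ^ (k - 1)) • innerSL ℝ a) y := by
  have h1 : HasFDerivAt (fun y : EuclideanSpace ℝ (Fin n) => inner ℝ a y + b)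
      (innerSL ℝ a) y := ((innerSL ℝ a).hasFDerivAt).add_const b
  have h2 := (hasDerivAt_pow k (inner ℝ a y + b)).comp_hasFDerivAt y h1
  exact h2

lemma fderiv_test {n : ℕ} {H H1 : ℝ → ℝ} (h1 : ∀ s, 0 < s → HasDerivAt H (H1 s) s)
    (a : EuclideanSpace ℝ (Fin n)) (b : ℝ) (k : ℕ) (y e : EuclideanSpace ℝ (Fin n)) :
    fderiv ℝ (fun y : EuclideanSpace ℝ (Fin n) => (inner ℝ a y + b) ^ k * H (1 + ‖y‖ ^ 2)) y e
      = (k * inner ℝ a e) * ((inner ℝ a y + b) ^ (k - 1) * H (1 + ‖y‖ ^ 2))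
        + 2 * (inner ℝ y e * ((inner ℝ a y + b) ^ k * H1 (1 + ‖y‖ ^ 2))) := by
  have hs : 0 < 1 + ‖y‖ ^ 2 := by positivity
  rw [((hasFDerivAt_affine a b k y).fun_mul (hasFDerivAt_comp_normSq y (h1 _ hs))).fderiv]
  simp
  ring

lemma differentiableAt_test {n : ℕ} {H H1 : ℝ → ℝ} (h1 : ∀ s, 0 < s → HasDerivAt H (H1 s) s)
    (a : EuclideanSpace ℝ (Fin n)) (b : ℝ) (k : ℕ) (y : EuclideanSpace ℝ (Fin n)) :
    DifferentiableAt ℝ (fun y : EuclideanSpace ℝ (Fin n) =>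
      (inner ℝ a y + b) ^ k * H (1 + ‖y‖ ^ 2)) y :=
  ((hasFDerivAt_affine a b k y).fun_mul (hasFDerivAt_comp_normSq y (h1 _ (by positivity)))).differentiableAt

lemma lap_test {n : ℕ} {H H1 H2 : ℝ → ℝ} (h1 : ∀ s, 0 < s → HasDerivAt H (H1 s) s)
    (h2 : ∀ s, 0 < s → HasDerivAt H1 (H2 s) s)
    (a : EuclideanSpace ℝ (Fin n)) (b : ℝ) (k : ℕ) (y : EuclideanSpace ℝ (Fin n)) :
    lap (fun y : EuclideanSpace ℝ (Fin n) => (inner ℝ a y + b) ^ k * H (1 + ‖y‖ ^ 2)) y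
      = k * ((k - 1 : ℕ) : ℝ) * ‖a‖ ^ 2 * ((inner ℝ a y + b) ^ (k - 1 - 1) * H (1 + ‖y‖ ^ 2))
        + 4 * k * inner ℝ a y * ((inner ℝ a y + b) ^ (k - 1) * H1 (1 + ‖y‖ ^ 2))
        + (inner ℝ a y + b) ^ k * (4 * ‖y‖ ^ 2 * H2 (1 + ‖y‖ ^ 2) + 2 * n * H1 (1 + ‖y‖ ^ 2)) := by
  have key : ∀ e : EuclideanSpace ℝ (Fin n),
      fderiv ℝ (fun z => fderiv ℝ (fun y : EuclideanSpace ℝ (Fin n) =>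
        (inner ℝ a y + b) ^ k * H (1 + ‖y‖ ^ 2)) z e) y e
      = k * ((k - 1 : ℕ) : ℝ) * ((inner ℝ a y + b) ^ (k - 1 - 1) * H (1 + ‖y‖ ^ 2))
          * (inner ℝ a e * inner ℝ a e)
        + 4 * k * ((inner ℝ a y + b) ^ (k - 1) * H1 (1 + ‖y‖ ^ 2)) * (inner ℝ a e * inner ℝ y e)
        + (inner ℝ a y + b) ^ k * (4 * H2 (1 + ‖y‖ ^ 2) * (inner ℝ y e * inner ℝ y e)
          + 2 * H1 (1 + ‖y‖ ^ 2) * ‖e‖ ^ 2) := by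
    intro e
    simp_rw [fderiv_test h1 a b k _ e]
    have d1 := (differentiableAt_test h1 a b (k - 1) y).hasFDerivAt.const_mul (k * inner ℝ a e)
    have d2 := (differentiableAt_test h2 a b k y).hasFDerivAt
    have d3 : HasFDerivAt (fun z : EuclideanSpace ℝ (Fin n) => inner ℝ z e) (innerSL ℝ e) y := by
      have := (innerSL ℝ e).hasFDerivAt (x := y)
      convert! this using 1
      ext z
      simp [real_inner_comm]
    rw [(d1.fun_add ((d3.fun_mul d2).const_mul 2)).fderiv]
    simp only [add_apply, smul_apply, smul_eq_mul,
      fderiv_test h1 a b _ y e, fderiv_test h2 a b _ y e, innerSL_apply_apply,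
      real_inner_self_eq_norm_sq]
    ring
  unfold lap
  simp_rw [key]
  simp only [Finset.sum_add_distrib, ← Finset.mul_sum, basis_sum_inner, real_inner_self_eq_norm_sq]
  simp
  ring

/-! ### Green's identity -/

lemma green_aux {n : ℕ} {f g : EuclideanSpace ℝ (Fin n) → ℝ} (hf : ContDiff ℝ 1 f)
    (hg : ContDiff ℝ 1 g) (hc : HasCompactSupport f ∨ HasCompactSupport g)
    (v : EuclideanSpace ℝ (Fin n)) :
    ∫ x, f x * fderiv ℝ g x v = - ∫ x, fderiv ℝ f x v * g x := by
  have cf' : Continuous fun x => fderiv ℝ f x v :=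
    (hf.continuous_fderiv (by norm_num)).clm_apply continuous_const
  have cg' : Continuous fun x => fderiv ℝ g x v :=
    (hg.continuous_fderiv (by norm_num)).clm_apply continuous_const
  have cf := hf.continuous
  have cg := hg.continuous
  apply integral_mul_fderiv_eq_neg_fderiv_mul_of_integrable
  · apply (cf'.mul cg).integrable_of_hasCompactSupport
    rcases hc with h | h
    · exact (h.fderiv_apply (𝕜 := ℝ) v).mul_right
    · exact h.mul_left
  · apply (cf.mul cg').integrable_of_hasCompactSupport
    rcases hc with h | h
    · exact h.mul_right
    · exact (h.fderiv_apply (𝕜 := ℝ) v).mul_left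
  · apply (cf.mul cg).integrable_of_hasCompactSupport
    rcases hc with h | h
    · exact h.mul_right
    · exact h.mul_left
  · exact fun x _ => (hf.differentiable (by norm_num)).differentiableAt
  · exact fun x _ => (hg.differentiable (by norm_num)).differentiableAt

lemma contDiff_fderiv_apply {n : ℕ} {f : EuclideanSpace ℝ (Fin n) → ℝ} (hf : ContDiff ℝ 2 f)
    (v : EuclideanSpace ℝ (Fin n)) : ContDiff ℝ 1 (fun x => fderiv ℝ f x v) :=
  (hf.fderiv_right (m := 1) (by norm_num)).clm_apply contDiff_const

lemma continuous_fderiv_fderiv {n : ℕ} {f : EuclideanSpace ℝ (Fin n) → ℝ} (hf : ContDiff ℝ 2 f)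
    (v : EuclideanSpace ℝ (Fin n)) :
    Continuous (fun x => fderiv ℝ (fun y => fderiv ℝ f y v) x v) :=
  ((contDiff_fderiv_apply hf v).continuous_fderiv (by norm_num)).clm_apply continuous_const

lemma continuous_lap {n : ℕ} {f : EuclideanSpace ℝ (Fin n) → ℝ} (hf : ContDiff ℝ 2 f) :
    Continuous (lap f) := by
  unfold lap
  exact continuous_finsetSum _ fun i _ => continuous_fderiv_fderiv hf _

lemma green {n : ℕ} {f g : EuclideanSpace ℝ (Fin n) → ℝ} (hf : ContDiff ℝ 2 f)
    (hg : ContDiff ℝ 2 g) (hc : HasCompactSupport g) :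
    ∫ x, f x * lap g x = ∫ x, lap f x * g x := by
  unfold lap
  simp_rw [Finset.mul_sum, Finset.sum_mul]
  rw [integral_finsetSum, integral_finsetSum]
  · refine Finset.sum_congr rfl fun i _ => ?_
    set v : EuclideanSpace ℝ (Fin n) := EuclideanSpace.single i 1
    rw [green_aux (hf.of_le (by norm_num)) (contDiff_fderiv_apply hg v)
        (Or.inr (hc.fderiv_apply (𝕜 := ℝ) v)),
      green_aux (contDiff_fderiv_apply hf v) (hg.of_le (by norm_num)) (Or.inr hc), neg_neg]
  · intro i _
    exact ((continuous_fderiv_fderiv hf _).mul hg.continuous).integrable_of_hasCompactSupport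
      hc.mul_left
  · intro i _
    exact (hf.continuous.mul (continuous_fderiv_fderiv hg _)).integrable_of_hasCompactSupport
      (((hc.fderiv_apply (𝕜 := ℝ) _).fderiv_apply (𝕜 := ℝ) _).mul_left)

/-! ### Cut-off functions -/

def cutoff (x : ℝ) : ℝ := Real.smoothTransition (2 - x)

lemma cutoff_contDiff {m : ℕ∞} : ContDiff ℝ m cutoff :=
  Real.smoothTransition.contDiff.comp (contDiff_const.sub contDiff_id)

lemma cutoff_one {x : ℝ} (hx : x ≤ 1) : cutoff x = 1 :=
  Real.smoothTransition.one_of_one_le (by linarith)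

lemma cutoff_zero {x : ℝ} (hx : 2 ≤ x) : cutoff x = 0 :=
  Real.smoothTransition.zero_of_nonpos (by linarith)

lemma cutoff_hasDerivAt (x : ℝ) : HasDerivAt cutoff (deriv cutoff x) x :=
  ((cutoff_contDiff (m := 1)).differentiable (by norm_num)).differentiableAt.hasDerivAt

lemma cutoff_deriv_contDiff : ContDiff ℝ 1 (deriv cutoff) := by
  have h := cutoff_contDiff (m := 2)
  exact (contDiff_succ_iff_deriv (n := 1).1 (by exact_mod_cast h)).2.2

lemma cutoff_hasDerivAt2 (x : ℝ) : HasDerivAt (deriv cutoff) (deriv (deriv cutoff) x) x :=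
  (cutoff_deriv_contDiff.differentiable (by norm_num)).differentiableAt.hasDerivAt

lemma cutoff_deriv_zero {x : ℝ} (hx : x < 1 ∨ 2 < x) : deriv cutoff x = 0 := by
  rcases hx with h | h
  · have : cutoff =ᶠ[𝓝 x] fun _ => (1 : ℝ) := by
      filter_upwards [Iio_mem_nhds h] with z hz using cutoff_one (le_of_lt hz)
    rw [this.deriv_eq]; simp
  · have : cutoff =ᶠ[𝓝 x] fun _ => (0 : ℝ) := by
      filter_upwards [Ioi_mem_nhds h] with z hz using cutoff_zero (le_of_lt hz)
    rw [this.deriv_eq]; simp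

lemma cutoff_deriv2_zero {x : ℝ} (hx : x < 1 ∨ 2 < x) : deriv (deriv cutoff) x = 0 := by
  have : deriv cutoff =ᶠ[𝓝 x] fun _ => (0 : ℝ) := by
    rcases hx with h | h
    · filter_upwards [Iio_mem_nhds h] with z hz using cutoff_deriv_zero (Or.inl hz)
    · filter_upwards [Ioi_mem_nhds h] with z hz using cutoff_deriv_zero (Or.inr hz)
  rw [this.deriv_eq]; simp

lemma cutoff_abs_le (x : ℝ) : |cutoff x| ≤ 1 := by
  unfold cutoff
  rw [abs_of_nonneg (Real.smoothTransition.nonneg _)]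
  exact Real.smoothTransition.le_one _

lemma bounded_of_zero_outside {f : ℝ → ℝ} (hf : Continuous f)
    (h0 : ∀ x, (x < 1 ∨ 2 < x) → f x = 0) : ∃ C, ∀ x, |f x| ≤ C := by
  have hc : HasCompactSupport f := by
    apply HasCompactSupport.intro (isCompact_Icc (a := (1 : ℝ)) (b := 2))
    intro x hx
    apply h0
    rw [mem_Icc, not_and_or, not_le, not_le] at hx
    exact hx
  exact hc.exists_bound_of_continuous hf

/-- The values of the scaled derivatives of `s ^ β * cutoff (s / R)`. -/
def cut1 (β x : ℝ) : ℝ := β * cutoff x + x * deriv cutoff x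

def cut2 (β x : ℝ) : ℝ :=
  β * (β - 1) * cutoff x + 2 * β * (x * deriv cutoff x) + x ^ 2 * deriv (deriv cutoff) x

lemma cut_bound (β : ℝ) : ∃ M, 0 ≤ M ∧ ∀ x, |cutoff x| ≤ M ∧ |cut1 β x| ≤ M ∧ |cut2 β x| ≤ M := by
  obtain ⟨C1, h1⟩ := bounded_of_zero_outside (f := fun x => x * deriv cutoff x)
    (continuous_id.mul cutoff_deriv_contDiff.continuous)
    (fun x hx => by simp [cutoff_deriv_zero hx])
  obtain ⟨C2, h2⟩ := bounded_of_zero_outside (f := fun x => x ^ 2 * deriv (deriv cutoff) x)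
    ((continuous_pow 2).mul (cutoff_deriv_contDiff.continuous_deriv (by norm_num)))
    (fun x hx => by simp [cutoff_deriv2_zero hx])
  have hC1 : 0 ≤ C1 := (abs_nonneg _).trans (h1 0)
  have hC2 : 0 ≤ C2 := (abs_nonneg _).trans (h2 0)
  have e1 : ∀ x, |cut1 β x| ≤ |β| + C1 := fun x => by
    unfold cut1
    refine (abs_add_le _ _).trans (add_le_add ?_ (h1 x))
    rw [abs_mul]
    exact mul_le_of_le_one_right (abs_nonneg _) (cutoff_abs_le x)
  have e2 : ∀ x, |cut2 β x| ≤ |β * (β - 1)| + |2 * β| * C1 + C2 := fun x => by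
    unfold cut2
    refine (abs_add_le _ _).trans (add_le_add ((abs_add_le _ _).trans (add_le_add ?_ ?_)) (h2 x))
    · rw [abs_mul]
      exact mul_le_of_le_one_right (abs_nonneg _) (cutoff_abs_le x)
    · rw [abs_mul]
      exact mul_le_mul_of_nonneg_left (h1 x) (abs_nonneg _)
  refine ⟨1 + (|β| + C1) + (|β * (β - 1)| + |2 * β| * C1 + C2), by positivity, fun x => ⟨?_, ?_, ?_⟩⟩
  · have := cutoff_abs_le x
    have h : 0 ≤ (|β| + C1) + (|β * (β - 1)| + |2 * β| * C1 + C2) := by positivity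
    linarith
  · have := e1 x
    have h : 0 ≤ 1 + (|β * (β - 1)| + |2 * β| * C1 + C2) := by positivity
    linarith
  · have := e2 x
    have h : 0 ≤ 1 + (|β| + C1) := by positivity
    linarith

lemma cut_hasDerivAt (β R s : ℝ) (hR : 0 < R) (hs : 0 < s) :
    HasDerivAt (fun s => s ^ β * cutoff (s / R)) (s ^ (β - 1) * cut1 β (s / R)) s := by
  have h1 : HasDerivAt (fun s : ℝ => s ^ β) (β * s ^ (β - 1)) s :=
    Real.hasDerivAt_rpow_const (Or.inl hs.ne')
  have h2 : HasDerivAt (fun s : ℝ => cutoff (s / R)) (deriv cutoff (s / R) * (1 / R)) s :=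
    HasDerivAt.comp (h₂ := cutoff) (h := fun s => s / R) s (cutoff_hasDerivAt (s / R))
      ((hasDerivAt_id s).div_const R)
  convert! h1.fun_mul h2 using 1
  have e : s ^ β = s ^ (β - 1) * s := by
    rw [Real.rpow_sub_one hs.ne']; field_simp
  rw [e, cut1]
  field_simp

lemma cut_hasDerivAt2 (β R s : ℝ) (hR : 0 < R) (hs : 0 < s) :
    HasDerivAt (fun s => s ^ (β - 1) * cut1 β (s / R)) (s ^ (β - 2) * cut2 β (s / R)) s := by
  have h1 : HasDerivAt (fun s : ℝ => s ^ (β - 1)) ((β - 1) * s ^ (β - 1 - 1)) s :=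
    Real.hasDerivAt_rpow_const (Or.inl hs.ne')
  have h0 : HasDerivAt (fun s : ℝ => s / R) (1 / R) s := (hasDerivAt_id s).div_const R
  have h2 : HasDerivAt (fun s : ℝ => cutoff (s / R)) (deriv cutoff (s / R) * (1 / R)) s :=
    HasDerivAt.comp (h₂ := cutoff) (h := fun s => s / R) s (cutoff_hasDerivAt (s / R)) h0
  have h3 : HasDerivAt (fun s : ℝ => deriv cutoff (s / R))
      (deriv (deriv cutoff) (s / R) * (1 / R)) s :=
    HasDerivAt.comp (h₂ := deriv cutoff) (h := fun s => s / R) s (cutoff_hasDerivAt2 (s / R)) h0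
  have h4 : HasDerivAt (fun s : ℝ => cut1 β (s / R)) _ s := (h2.const_mul β).fun_add (h0.fun_mul h3)
  convert! h1.fun_mul h4 using 1
  have e : s ^ (β - 1) = s ^ (β - 1 - 1) * s := by
    rw [Real.rpow_sub_one hs.ne' (β - 1)]; field_simp
  rw [e, show β - 2 = β - 1 - 1 by ring, cut2, cut1]
  field_simp
  ring

/-! ### The moment recursion -/

lemma weight_integrable {n : ℕ} :
    Integrable (fun y : EuclideanSpace ℝ (Fin n) => (1 + ‖y‖ ^ 2) ^ (-((n : ℝ) + 1) / 2)) := by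
  apply integrable_rpow_neg_one_add_norm_sq
  simp

lemma continuous_weight {n : ℕ} (γ : ℝ) :
    Continuous (fun y : EuclideanSpace ℝ (Fin n) => (1 + ‖y‖ ^ 2) ^ γ) := by
  apply Continuous.rpow_const (by fun_prop)
  intro y
  left
  positivity

lemma affine_weight_bound {n : ℕ} (a : EuclideanSpace ℝ (Fin n)) (b : ℝ) (j : ℕ) (γ : ℝ)
    (h : (j : ℝ) / 2 + γ ≤ -((n : ℝ) + 1) / 2) (y : EuclideanSpace ℝ (Fin n)) :
    |(inner ℝ a y + b) ^ j * (1 + ‖y‖ ^ 2) ^ γ|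
      ≤ (‖a‖ + |b|) ^ j * (1 + ‖y‖ ^ 2) ^ (-((n : ℝ) + 1) / 2) := by
  have hs1 : 1 ≤ 1 + ‖y‖ ^ 2 := by nlinarith [sq_nonneg ‖y‖]
  have hs : 0 < 1 + ‖y‖ ^ 2 := by positivity
  set s := 1 + ‖y‖ ^ 2 with hsdef
  have hy : ‖y‖ ≤ s ^ (1 / 2 : ℝ) := by
    rw [← Real.sqrt_eq_rpow]
    apply Real.le_sqrt_of_sq_le
    linarith
  have h1 : 1 ≤ s ^ (1 / 2 : ℝ) := Real.one_le_rpow hs1 (by norm_num)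
  have hp : |inner ℝ a y + b| ≤ (‖a‖ + |b|) * s ^ (1 / 2 : ℝ) := by
    refine (abs_add_le _ _).trans ?_
    rw [add_mul]
    apply add_le_add
    · exact (abs_real_inner_le_norm a y).trans (mul_le_mul_of_nonneg_left hy (norm_nonneg _))
    · exact le_mul_of_one_le_right (abs_nonneg _) h1
  rw [abs_mul, abs_pow, abs_of_nonneg (Real.rpow_nonneg hs.le γ)]
  calc |inner ℝ a y + b| ^ j * s ^ γ
      ≤ ((‖a‖ + |b|) * s ^ (1 / 2 : ℝ)) ^ j * s ^ γ := by gcongr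
    _ = (‖a‖ + |b|) ^ j * s ^ ((j : ℝ) / 2 + γ) := by
        rw [mul_pow, ← Real.rpow_natCast (s ^ (1 / 2 : ℝ)) j, ← Real.rpow_mul hs.le, mul_assoc,
          ← Real.rpow_add hs]
        congr 3
        ring
    _ ≤ _ := by
        apply mul_le_mul_of_nonneg_left _ (by positivity)
        exact Real.rpow_le_rpow_of_exponent_le hs1 h

lemma affine_weight_integrable {n : ℕ} (a : EuclideanSpace ℝ (Fin n)) (b : ℝ) (j : ℕ) (γ : ℝ)
    (h : (j : ℝ) / 2 + γ ≤ -((n : ℝ) + 1) / 2) {Z : EuclideanSpace ℝ (Fin n) → ℝ}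
    (hZ : Continuous Z) (hbdd : ∃ C : ℝ, ∀ y, |Z y| ≤ C) :
    Integrable (fun y => Z y * ((inner ℝ a y + b) ^ j * (1 + ‖y‖ ^ 2) ^ γ)) := by
  obtain ⟨C, hC⟩ := hbdd
  apply Integrable.bdd_mul (c := C) _ hZ.aestronglyMeasurable (Eventually.of_forall hC)
  refine (weight_integrable.const_mul ((‖a‖ + |b|) ^ j)).mono' ?_
    (Eventually.of_forall (affine_weight_bound a b j γ h))
  apply Continuous.aestronglyMeasurable
  exact (by fun_prop : Continuous fun y : EuclideanSpace ℝ (Fin n) => (inner ℝ a y + b) ^ j).mul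
    (continuous_weight γ)

/-- The algebraic shape of `L` applied to a cut-off test function. -/
def testShape (N k a2 b A B C E u0 u1 u2 : ℝ) : ℝ :=
  a2 * A * u0 + 4 * k * (B - b * C) * u1 + (4 * B - 4 * E) * u2 + 2 * N * B * u1
    + N * (N + 2) * E * u0

lemma testShape_bound (N k a2 b : ℝ) : ∃ Q, 0 ≤ Q ∧ ∀ A B C E u0 u1 u2 M D : ℝ, 0 ≤ M → 0 ≤ D →
    |A| ≤ D → |B| ≤ D → |C| ≤ D → |E| ≤ D → |u0| ≤ M → |u1| ≤ M → |u2| ≤ M →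
    |testShape N k a2 b A B C E u0 u1 u2| ≤ Q * M * D := by
  refine ⟨|a2| + |4 * k| + |4 * k * b| + 4 + 4 + |2 * N| + |N * (N + 2)|, by positivity, ?_⟩
  intro A B C E u0 u1 u2 M D hM hD hA hB hC hE h0 h1 h2
  have key : ∀ c X u : ℝ, |X| ≤ D → |u| ≤ M → |c * (X * u)| ≤ |c| * M * D := by
    intro c X u hX hu
    rw [abs_mul, abs_mul, mul_assoc]
    apply mul_le_mul_of_nonneg_left _ (abs_nonneg _)
    calc |X| * |u| ≤ D * M := by gcongr
      _ = M * D := by ring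
  have e : testShape N k a2 b A B C E u0 u1 u2 = a2 * (A * u0) + (4 * k) * (B * u1)
      - (4 * k * b) * (C * u1) + 4 * (B * u2) - 4 * (E * u2) + (2 * N) * (B * u1)
      + (N * (N + 2)) * (E * u0) := by unfold testShape; ring
  rw [e]
  have k1 := key a2 A u0 hA h0
  have k2 := key (4 * k) B u1 hB h1
  have k3 := key (4 * k * b) C u1 hC h1
  have k4 := key 4 B u2 hB h2
  have k5 := key 4 E u2 hE h2
  have k6 := key (2 * N) B u1 hB h1
  have k7 := key (N * (N + 2)) E u0 hE h0
  rw [abs_of_pos (by norm_num : (0 : ℝ) < 4)] at k4 k5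
  rw [abs_le] at k1 k2 k3 k4 k5 k6 k7 ⊢
  constructor <;> linarith

lemma testShape_limit (N k a2 b A B C E β : ℝ) (hβ : β = -k - (N - 2) / 2) :
    testShape N k a2 b A B C E 1 β (β * (β - 1))
      = a2 * A - 4 * k * β * b * C - 4 * (k - 1) * (k + N) * E := by
  subst hβ
  unfold testShape
  ring

lemma L_test {n : ℕ} (a : EuclideanSpace ℝ (Fin n)) (b : ℝ) (k : ℕ) (hk : 1 ≤ k) (β R : ℝ)
    (hR : 0 < R) (y : EuclideanSpace ℝ (Fin n)) :
    lap (fun y : EuclideanSpace ℝ (Fin n) =>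
        (inner ℝ a y + b) ^ k * ((1 + ‖y‖ ^ 2) ^ β * cutoff ((1 + ‖y‖ ^ 2) / R))) y
      + n * (n + 2) * (1 + ‖y‖ ^ 2) ^ (-2 : ℝ) *
        ((inner ℝ a y + b) ^ k * ((1 + ‖y‖ ^ 2) ^ β * cutoff ((1 + ‖y‖ ^ 2) / R)))
      = testShape n k (‖a‖ ^ 2) b
        (k * ((k - 1 : ℕ) : ℝ) * ((inner ℝ a y + b) ^ (k - 1 - 1) * (1 + ‖y‖ ^ 2) ^ β))
        ((inner ℝ a y + b) ^ k * (1 + ‖y‖ ^ 2) ^ (β - 1))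
        ((inner ℝ a y + b) ^ (k - 1) * (1 + ‖y‖ ^ 2) ^ (β - 1))
        ((inner ℝ a y + b) ^ k * (1 + ‖y‖ ^ 2) ^ (β - 2))
        (cutoff ((1 + ‖y‖ ^ 2) / R)) (cut1 β ((1 + ‖y‖ ^ 2) / R)) (cut2 β ((1 + ‖y‖ ^ 2) / R)) := by
  have hs : 0 < 1 + ‖y‖ ^ 2 := by positivity
  have h := lap_test (H := fun s => s ^ β * cutoff (s / R)) (H1 := fun s => s ^ (β - 1) * cut1 β (s / R))
    (H2 := fun s => s ^ (β - 2) * cut2 β (s / R)) (fun s hs => cut_hasDerivAt β R s hR hs)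
    (fun s hs => cut_hasDerivAt2 β R s hR hs) a b k y
  rw [h]
  obtain ⟨m, rfl⟩ : ∃ m, k = m + 1 := ⟨k - 1, by omega⟩
  simp only [Nat.add_sub_cancel]
  have e0 : (1 + ‖y‖ ^ 2) ^ (-2 : ℝ) * (1 + ‖y‖ ^ 2) ^ β = (1 + ‖y‖ ^ 2) ^ (β - 2) := by
    rw [← Real.rpow_add hs]; ring_nf
  have e1 : (1 + ‖y‖ ^ 2) ^ (β - 1) = (1 + ‖y‖ ^ 2) ^ (β - 2) * (1 + ‖y‖ ^ 2) := by
    rw [show β - 1 = (β - 2) + 1 by ring, Real.rpow_add_one hs.ne']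
  rw [← e0] at *
  rw [e1]
  set w := (1 + ‖y‖ ^ 2) ^ β
  set v := (1 + ‖y‖ ^ 2) ^ (-2 : ℝ)
  set p := inner ℝ a y + b with hp
  have ha : inner ℝ a y = p - b := by rw [hp]; ring
  rw [ha]
  unfold testShape
  push_cast
  ring

lemma test_contDiff {n : ℕ} (a : EuclideanSpace ℝ (Fin n)) (b : ℝ) (k : ℕ) (β R : ℝ) :
    ContDiff ℝ 2 (fun y : EuclideanSpace ℝ (Fin n) =>
        (inner ℝ a y + b) ^ k * ((1 + ‖y‖ ^ 2) ^ β * cutoff ((1 + ‖y‖ ^ 2) / R))) := by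
  have hs : ContDiff ℝ 2 (fun y : EuclideanSpace ℝ (Fin n) => 1 + ‖y‖ ^ 2) :=
    contDiff_const.add (contDiff_norm_sq ℝ)
  have h1 : ContDiff ℝ 2 (fun y : EuclideanSpace ℝ (Fin n) => inner ℝ a y + b) :=
    (contDiff_const.inner ℝ contDiff_id).add contDiff_const
  refine (h1.pow k).mul (ContDiff.mul ?_ ?_)
  · exact hs.rpow_const_of_ne (fun y => by positivity)
  · exact (cutoff_contDiff (m := 2)).comp (hs.div_const R)

lemma test_compact {n : ℕ} (a : EuclideanSpace ℝ (Fin n)) (b : ℝ) (k : ℕ) (β R : ℝ) (hR : 1 ≤ R) :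
    HasCompactSupport (fun y : EuclideanSpace ℝ (Fin n) =>
        (inner ℝ a y + b) ^ k * ((1 + ‖y‖ ^ 2) ^ β * cutoff ((1 + ‖y‖ ^ 2) / R))) := by
  apply HasCompactSupport.intro (isCompact_closedBall (0 : EuclideanSpace ℝ (Fin n)) (2 * R))
  intro y hy
  rw [mem_closedBall, dist_zero_right, not_le] at hy
  rw [cutoff_zero]
  · simp
  · rw [le_div_iff₀ (by linarith)]
    nlinarith

set_option maxHeartbeats 1000000 in
lemma moment_identity {n : ℕ} {Z : EuclideanSpace ℝ (Fin n) → ℝ}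
    (hreg : ContDiff ℝ 2 Z) (hbdd : ∃ C : ℝ, ∀ y, |Z y| ≤ C)
    (heq : ∀ y, lap Z y + n * (n + 2) * (1 + ‖y‖ ^ 2) ^ (-2 : ℝ) * Z y = 0)
    (a : EuclideanSpace ℝ (Fin n)) (b : ℝ) (k : ℕ) (hk : 1 ≤ k) (β : ℝ)
    (hβ : β = -k - ((n : ℝ) - 2) / 2) :
    ∫ y, Z y * (‖a‖ ^ 2 *
          (k * ((k - 1 : ℕ) : ℝ) * ((inner ℝ a y + b) ^ (k - 1 - 1) * (1 + ‖y‖ ^ 2) ^ β))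
        - 4 * k * β * b * ((inner ℝ a y + b) ^ (k - 1) * (1 + ‖y‖ ^ 2) ^ (β - 1))
        - 4 * (k - 1) * (k + n) * ((inner ℝ a y + b) ^ k * (1 + ‖y‖ ^ 2) ^ (β - 2))) = 0 := by
  obtain ⟨CZ, hCZ⟩ := hbdd
  have hCZ0 : 0 ≤ CZ := (abs_nonneg _).trans (hCZ 0)
  let ψ : ℕ → EuclideanSpace ℝ (Fin n) → ℝ := fun N y =>
    (inner ℝ a y + b) ^ k * ((1 + ‖y‖ ^ 2) ^ β * cutoff ((1 + ‖y‖ ^ 2) / ((N : ℝ) + 1)))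
  have hψ : ∀ N, ContDiff ℝ 2 (ψ N) := fun N => test_contDiff a b k β _
  have hψc : ∀ N, HasCompactSupport (ψ N) := fun N => test_compact a b k β _ (by simp)
  let F : ℕ → EuclideanSpace ℝ (Fin n) → ℝ := fun N y =>
    Z y * (lap (ψ N) y + n * (n + 2) * (1 + ‖y‖ ^ 2) ^ (-2 : ℝ) * ψ N y)
  have hFc : ∀ N, Continuous (F N) := fun N =>
    hreg.continuous.mul ((continuous_lap (hψ N)).add
      ((continuous_const.mul (continuous_weight (-2))).mul (hψ N).continuous))
  have hlapc : ∀ N, HasCompactSupport (lap (ψ N)) := fun N => by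
    apply HasCompactSupport.intro (hψc N)
    intro x hx
    unfold lap
    apply Finset.sum_eq_zero
    intro i _
    refine image_eq_zero_of_notMem_tsupport (f := fun x => fderiv ℝ (fun y => fderiv ℝ (ψ N) y
      (EuclideanSpace.single i 1)) x (EuclideanSpace.single i 1)) ?_
    intro hx'
    exact hx ((tsupport_fderiv_apply_subset ℝ _).trans (tsupport_fderiv_apply_subset ℝ _) hx')
  have hF0 : ∀ N, ∫ y, F N y = 0 := fun N => by
    have g := green hreg (hψ N) (hψc N)
    have e : ∀ y, F N y = Z y * lap (ψ N) y - lap Z y * ψ N y := fun y => by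
      have := heq y
      have h2 : lap Z y = - (n * (n + 2) * (1 + ‖y‖ ^ 2) ^ (-2 : ℝ) * Z y) := by linarith
      rw [h2]
      simp only [F]
      ring
    simp_rw [e]
    rw [integral_sub, g, sub_self]
    · exact (hreg.continuous.mul (continuous_lap (hψ N))).integrable_of_hasCompactSupport
        (hlapc N).mul_left
    · exact ((continuous_lap hreg).mul (hψ N).continuous).integrable_of_hasCompactSupport
        (hψc N).mul_left
  obtain ⟨M, hM0, hM⟩ := cut_bound β
  obtain ⟨Q, hQ0, hQ⟩ := testShape_bound n k (‖a‖ ^ 2) b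
  have hk' : (1 : ℝ) ≤ k := by exact_mod_cast hk
  set P := ‖a‖ + |b|
  have hP : 0 ≤ P := by positivity
  let K : ℝ := k * ((k - 1 : ℕ) : ℝ) * P ^ (k - 1 - 1) + P ^ k + P ^ (k - 1)
  have hK : 0 ≤ K := by positivity
  have hlim : Tendsto (fun N => ∫ y, F N y) atTop (𝓝 (∫ y, Z y * (‖a‖ ^ 2 *
          (k * ((k - 1 : ℕ) : ℝ) * ((inner ℝ a y + b) ^ (k - 1 - 1) * (1 + ‖y‖ ^ 2) ^ β))
        - 4 * k * β * b * ((inner ℝ a y + b) ^ (k - 1) * (1 + ‖y‖ ^ 2) ^ (β - 1))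
        - 4 * (k - 1) * (k + n) * ((inner ℝ a y + b) ^ k * (1 + ‖y‖ ^ 2) ^ (β - 2))))) := by
    apply tendsto_integral_of_dominated_convergence
      (fun y => (CZ * Q * M * K) * (1 + ‖y‖ ^ 2) ^ (-((n : ℝ) + 1) / 2))
    · exact fun N => (hFc N).aestronglyMeasurable
    · exact weight_integrable.const_mul _
    · intro N
      refine Eventually.of_forall fun y => ?_
      have hD : 0 ≤ (1 + ‖y‖ ^ 2) ^ (-((n : ℝ) + 1) / 2) := by positivity
      have hx := hM ((1 + ‖y‖ ^ 2) / ((N : ℝ) + 1))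
      rw [Real.norm_eq_abs]
      simp only [F, ψ]
      rw [L_test a b k hk β _ (by positivity) y, abs_mul]
      have c1 : P ^ k ≤ K := by
        have : 0 ≤ k * ((k - 1 : ℕ) : ℝ) * P ^ (k - 1 - 1) + P ^ (k - 1) := by positivity
        simp only [K]; linarith
      have c2 : P ^ (k - 1) ≤ K := by
        have : 0 ≤ k * ((k - 1 : ℕ) : ℝ) * P ^ (k - 1 - 1) + P ^ k := by positivity
        simp only [K]; linarith
      have c3 : k * ((k - 1 : ℕ) : ℝ) * P ^ (k - 1 - 1) ≤ K := by
        have : 0 ≤ P ^ (k - 1) + P ^ k := by positivity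
        simp only [K]; linarith
      have := hQ _ _ _ M (K * (1 + ‖y‖ ^ 2) ^ (-((n : ℝ) + 1) / 2)) hM0 (by positivity)
        (A := k * ((k - 1 : ℕ) : ℝ) * ((inner ℝ a y + b) ^ (k - 1 - 1) * (1 + ‖y‖ ^ 2) ^ β))
        (B := (inner ℝ a y + b) ^ k * (1 + ‖y‖ ^ 2) ^ (β - 1))
        (C := (inner ℝ a y + b) ^ (k - 1) * (1 + ‖y‖ ^ 2) ^ (β - 1))
        (E := (inner ℝ a y + b) ^ k * (1 + ‖y‖ ^ 2) ^ (β - 2)) ?_ ?_ ?_ ?_ hx.1 hx.2.1 hx.2.2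
      · calc _ ≤ CZ * (Q * M * (K * (1 + ‖y‖ ^ 2) ^ (-((n : ℝ) + 1) / 2))) := by
              apply mul_le_mul (hCZ y) this (abs_nonneg _) hCZ0
          _ = _ := by ring
      · by_cases h2 : k = 1
        · subst h2
          simp
          positivity
        · obtain ⟨m, rfl⟩ : ∃ m, k = m + 2 := ⟨k - 2, by omega⟩
          rw [abs_mul]
          calc _ ≤ |((m + 2 : ℕ) : ℝ) * ((m + 2 - 1 : ℕ) : ℝ)| *
                (P ^ (m + 2 - 1 - 1) * (1 + ‖y‖ ^ 2) ^ (-((n : ℝ) + 1) / 2)) := by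
                apply mul_le_mul_of_nonneg_left _ (abs_nonneg _)
                apply affine_weight_bound
                rw [hβ]
                simp
                have : (0 : ℝ) ≤ m := by positivity
                linarith
            _ ≤ _ := by
                rw [abs_of_nonneg (by positivity), ← mul_assoc]
                exact mul_le_mul_of_nonneg_right c3 hD
      · refine (affine_weight_bound a b k _ ?_ y).trans (mul_le_mul_of_nonneg_right c1 hD)
        rw [hβ]; linarith
      · refine (affine_weight_bound a b (k - 1) _ ?_ y).trans (mul_le_mul_of_nonneg_right c2 hD)
        rw [hβ, Nat.cast_sub hk]; push_cast; linarith
      · refine (affine_weight_bound a b k _ ?_ y).trans (mul_le_mul_of_nonneg_right c1 hD)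
        rw [hβ]; linarith
    · refine Eventually.of_forall fun y => ?_
      apply tendsto_const_nhds.congr'
      filter_upwards [eventually_gt_atTop (⌈1 + ‖y‖ ^ 2⌉₊)] with N hN
      have hN' : 1 + ‖y‖ ^ 2 < (N : ℝ) + 1 := by
        have := Nat.lt_of_ceil_lt hN
        linarith
      have hx : (1 + ‖y‖ ^ 2) / ((N : ℝ) + 1) < 1 := by
        rw [div_lt_one (by positivity)]; exact hN'
      simp only [F, ψ]
      rw [L_test a b k hk β _ (by positivity) y]
      simp only [cut1, cut2]
      rw [cutoff_one hx.le, cutoff_deriv_zero (Or.inl hx), cutoff_deriv2_zero (Or.inl hx)]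
      simp only [mul_zero, add_zero, mul_one]
      rw [testShape_limit _ _ _ _ _ _ _ _ β hβ]
  simp_rw [hF0] at hlim
  exact (tendsto_nhds_unique hlim tendsto_const_nhds)

/-- Weighted moments of a function with respect to powers of affine functions. -/
def mom {n : ℕ} (Z : EuclideanSpace ℝ (Fin n) → ℝ) (a : EuclideanSpace ℝ (Fin n)) (b : ℝ)
    (j : ℕ) : ℝ :=
  ∫ y, Z y * ((inner ℝ a y + b) ^ j * (1 + ‖y‖ ^ 2) ^ (-(j : ℝ) - ((n : ℝ) + 2) / 2))

lemma mom_integrable {n : ℕ} {Z : EuclideanSpace ℝ (Fin n) → ℝ} (hZ : Continuous Z)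
    (hbdd : ∃ C : ℝ, ∀ y, |Z y| ≤ C) (a : EuclideanSpace ℝ (Fin n)) (b : ℝ) (j : ℕ) :
    Integrable (fun y => Z y *
      ((inner ℝ a y + b) ^ j * (1 + ‖y‖ ^ 2) ^ (-(j : ℝ) - ((n : ℝ) + 2) / 2))) := by
  apply affine_weight_integrable a b j _ _ hZ hbdd
  have : (0 : ℝ) ≤ j := by positivity
  linarith

lemma mom_zero {n : ℕ} (hn : 1 ≤ n) {Z : EuclideanSpace ℝ (Fin n) → ℝ}
    (hreg : ContDiff ℝ 2 Z) (hbdd : ∃ C : ℝ, ∀ y, |Z y| ≤ C)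
    (heq : ∀ y, lap Z y + n * (n + 2) * (1 + ‖y‖ ^ 2) ^ (-2 : ℝ) * Z y = 0) :
    mom Z 0 1 0 = 0 := by
  have h := moment_identity hreg hbdd heq 0 1 1 le_rfl _ rfl
  have hn' : (1 : ℝ) ≤ n := by exact_mod_cast hn
  have e : ∀ y : EuclideanSpace ℝ (Fin n), Z y * (‖(0 : EuclideanSpace ℝ (Fin n))‖ ^ 2 *
          ((1 : ℕ) * ((1 - 1 : ℕ) : ℝ) * ((inner ℝ (0 : EuclideanSpace ℝ (Fin n)) y + 1) ^ (1 - 1 - 1)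
            * (1 + ‖y‖ ^ 2) ^ (-((1 : ℕ) : ℝ) - ((n : ℝ) - 2) / 2)))
        - 4 * (1 : ℕ) * (-((1 : ℕ) : ℝ) - ((n : ℝ) - 2) / 2) * 1 *
          ((inner ℝ (0 : EuclideanSpace ℝ (Fin n)) y + 1) ^ (1 - 1)
            * (1 + ‖y‖ ^ 2) ^ (-((1 : ℕ) : ℝ) - ((n : ℝ) - 2) / 2 - 1))
        - 4 * ((1 : ℕ) - 1) * ((1 : ℕ) + n) * ((inner ℝ (0 : EuclideanSpace ℝ (Fin n)) y + 1) ^ 1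
            * (1 + ‖y‖ ^ 2) ^ (-((1 : ℕ) : ℝ) - ((n : ℝ) - 2) / 2 - 2)))
      = (2 * n) * (Z y * ((inner ℝ (0 : EuclideanSpace ℝ (Fin n)) y + 1) ^ 0
        * (1 + ‖y‖ ^ 2) ^ (-((0 : ℕ) : ℝ) - ((n : ℝ) + 2) / 2))) := by
    intro y
    have : -((1 : ℕ) : ℝ) - ((n : ℝ) - 2) / 2 - 1 = -((0 : ℕ) : ℝ) - ((n : ℝ) + 2) / 2 := by
      push_cast; ring
    rw [this]
    simp
    ring
  simp_rw [e] at h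
  rw [integral_const_mul] at h
  rcases mul_eq_zero.1 h with h | h
  · exfalso; linarith
  · exact h

lemma mom_rec {n : ℕ} {Z : EuclideanSpace ℝ (Fin n) → ℝ}
    (hreg : ContDiff ℝ 2 Z) (hbdd : ∃ C : ℝ, ∀ y, |Z y| ≤ C)
    (heq : ∀ y, lap Z y + n * (n + 2) * (1 + ‖y‖ ^ 2) ^ (-2 : ℝ) * Z y = 0)
    (a : EuclideanSpace ℝ (Fin n)) (b : ℝ) (m : ℕ) (h0 : mom Z a b m = 0)
    (h1 : mom Z a b (m + 1) = 0) : mom Z a b (m + 2) = 0 := by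
  have h := moment_identity hreg hbdd heq a b (m + 2) (by omega) _ rfl
  set β : ℝ := -((m + 2 : ℕ) : ℝ) - ((n : ℝ) - 2) / 2 with hβ
  have e0 : β = -(m : ℝ) - ((n : ℝ) + 2) / 2 := by rw [hβ]; push_cast; ring
  have e1 : β - 1 = -((m + 1 : ℕ) : ℝ) - ((n : ℝ) + 2) / 2 := by rw [hβ]; push_cast; ring
  have e2 : β - 2 = -((m + 2 : ℕ) : ℝ) - ((n : ℝ) + 2) / 2 := by rw [hβ]; push_cast; ring
  have i0 := mom_integrable hreg.continuous hbdd a b m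
  have i1 := mom_integrable hreg.continuous hbdd a b (m + 1)
  have i2 := mom_integrable hreg.continuous hbdd a b (m + 2)
  rw [← e0] at i0
  rw [← e1] at i1
  rw [← e2] at i2
  unfold mom at h0 h1 ⊢
  rw [← e0] at h0
  rw [← e1] at h1
  rw [← e2]
  have hq : ∀ y : EuclideanSpace ℝ (Fin n), Z y * (‖a‖ ^ 2 *
          (((m + 2 : ℕ) : ℝ) * ((m + 2 - 1 : ℕ) : ℝ) *
            ((inner ℝ a y + b) ^ (m + 2 - 1 - 1) * (1 + ‖y‖ ^ 2) ^ β))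
        - 4 * ((m + 2 : ℕ) : ℝ) * β * b *
          ((inner ℝ a y + b) ^ (m + 2 - 1) * (1 + ‖y‖ ^ 2) ^ (β - 1))
        - 4 * (((m + 2 : ℕ) : ℝ) - 1) * (((m + 2 : ℕ) : ℝ) + n) *
          ((inner ℝ a y + b) ^ (m + 2) * (1 + ‖y‖ ^ 2) ^ (β - 2)))
      = (‖a‖ ^ 2 * (m + 2) * (m + 1)) * (Z y * ((inner ℝ a y + b) ^ m * (1 + ‖y‖ ^ 2) ^ β))
        - (4 * (m + 2) * β * b) *
          (Z y * ((inner ℝ a y + b) ^ (m + 1) * (1 + ‖y‖ ^ 2) ^ (β - 1)))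
        - (4 * (m + 1) * (m + 2 + n)) *
          (Z y * ((inner ℝ a y + b) ^ (m + 2) * (1 + ‖y‖ ^ 2) ^ (β - 2))) := by
    intro y
    simp only [show m + 2 - 1 = m + 1 by omega, show m + 1 - 1 = m by omega]
    push_cast
    ring
  simp_rw [hq] at h
  rw [integral_sub (by exact (i0.const_mul _).sub (i1.const_mul _)) (i2.const_mul _),
    integral_sub (i0.const_mul _) (i1.const_mul _), integral_const_mul, integral_const_mul,
    integral_const_mul, h0, h1] at h
  have hpos : (0 : ℝ) < 4 * (m + 1) * (m + 2 + n) := by positivity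
  simp only [mul_zero, sub_zero, zero_sub, neg_eq_zero] at h
  exact (mul_eq_zero.1 h).resolve_left hpos.ne'

lemma mom_all {n : ℕ} (hn : 1 ≤ n) {Z : EuclideanSpace ℝ (Fin n) → ℝ}
    (hreg : ContDiff ℝ 2 Z) (hbdd : ∃ C : ℝ, ∀ y, |Z y| ≤ C)
    (heq : ∀ y, lap Z y + n * (n + 2) * (1 + ‖y‖ ^ 2) ^ (-2 : ℝ) * Z y = 0)
    (h1 : ∀ a b, mom Z a b 1 = 0) (j : ℕ) (a : EuclideanSpace ℝ (Fin n)) (b : ℝ) :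
    mom Z a b j = 0 := by
  have key : mom Z a b j = 0 ∧ mom Z a b (j + 1) = 0 := by
    induction j with
    | zero =>
      refine ⟨?_, h1 a b⟩
      have := mom_zero hn hreg hbdd heq
      unfold mom at this ⊢
      simpa using this
    | succ m ih => exact ⟨ih.2, mom_rec hreg hbdd heq a b m ih.1 ih.2⟩
  exact key.1

/-! ### Density of exponentials -/

lemma continuous_persp {n : ℕ} {Z : EuclideanSpace ℝ (Fin n) → ℝ} (hZ : Continuous Z)
    (hbdd : ∃ C : ℝ, ∀ y, |Z y| ≤ C) :
    Continuous (fun x : EuclideanSpace ℝ (Fin n) × ℝ => x.2 * Z (x.2⁻¹ • x.1)) := by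
  obtain ⟨C, hC⟩ := hbdd
  rw [continuous_iff_continuousAt]
  intro x
  by_cases hx : x.2 = 0
  · unfold ContinuousAt
    beta_reduce
    rw [hx, zero_mul]
    have h0 : Tendsto (fun x : EuclideanSpace ℝ (Fin n) × ℝ => |x.2| * C) (𝓝 x) (𝓝 0) := by
      have : Continuous (fun x : EuclideanSpace ℝ (Fin n) × ℝ => |x.2| * C) := by fun_prop
      have h := this.tendsto x
      simpa [hx] using h
    apply squeeze_zero_norm _ h0
    intro z
    rw [Real.norm_eq_abs, abs_mul]
    exact mul_le_mul_of_nonneg_left (hC _) (abs_nonneg _)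
  · apply ContinuousAt.mul continuousAt_snd
    apply hZ.continuousAt.comp
    exact (continuousAt_snd.inv₀ hx).smul continuousAt_fst

lemma exp_span_dense {X : Type*} [TopologicalSpace X] [CompactSpace X] (S : Submodule ℝ C(X, ℝ))
    (hsep : ∀ x y : X, x ≠ y → ∃ f ∈ S, f x ≠ f y) (Λ : C(X, ℝ) →L[ℝ] ℝ)
    (hΛ : ∀ f ∈ S, ∀ k : ℕ, Λ (f ^ k) = 0) : Λ = 0 := by
  have hexp : ∀ f ∈ S, Λ (NormedSpace.exp f) = 0 := by
    intro f hf
    have h := (NormedSpace.exp_series_hasSum_exp' (𝕂 := ℝ) f).mapL Λ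
    simp only [map_smul, hΛ f hf, smul_zero] at h
    exact h.unique hasSum_zero
  let : NormedAlgebra ℚ C(X, ℝ) := NormedAlgebra.restrictScalars ℚ ℝ C(X, ℝ)
  let T : Submonoid C(X, ℝ) :=
    { carrier := {g | ∃ f ∈ S, NormedSpace.exp f = g}
      mul_mem' := by
        rintro _ _ ⟨f, hf, rfl⟩ ⟨g, hg, rfl⟩
        exact ⟨f + g, S.add_mem hf hg, NormedSpace.exp_add⟩
      one_mem' := ⟨0, S.zero_mem, NormedSpace.exp_zero⟩ }
  have heval : ∀ (f : C(X, ℝ)) (x : X), NormedSpace.exp f x = Real.exp (f x) := by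
    intro f x
    have h := NormedSpace.map_exp (ContinuousMap.evalAlgHom ℝ ℝ x)
      (continuous_eval_const x) f
    rw [Real.exp_eq_exp_ℝ]
    exact h
  have hA : (Algebra.adjoin ℝ (T : Set C(X, ℝ))).SeparatesPoints := by
    intro x y hxy
    obtain ⟨f, hf, hne⟩ := hsep x y hxy
    refine ⟨_, ⟨NormedSpace.exp f, Algebra.subset_adjoin ⟨f, hf, rfl⟩, rfl⟩, ?_⟩
    beta_reduce
    rw [heval, heval]
    exact fun h => hne (Real.exp_injective h)
  have htop := ContinuousMap.subalgebra_topologicalClosure_eq_top_of_separatesPoints _ hA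
  have hker : ∀ g ∈ Algebra.adjoin ℝ (T : Set C(X, ℝ)), Λ g = 0 := by
    intro g hg
    have hg' : g ∈ Submodule.span ℝ (T : Set C(X, ℝ)) := by
      have := Algebra.adjoin_eq_span ℝ (T : Set C(X, ℝ))
      rw [Submonoid.closure_eq] at this
      rw [← this]
      exact hg
    have hle : Submodule.span ℝ (T : Set C(X, ℝ)) ≤ Λ.ker := by
      rw [Submodule.span_le]
      rintro _ ⟨f, hf, rfl⟩
      exact hexp f hf
    exact hle hg'
  ext g
  have hg : g ∈ (Algebra.adjoin ℝ (T : Set C(X, ℝ))).topologicalClosure := by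
    rw [htop]; trivial
  have hcl : IsClosed {g : C(X, ℝ) | Λ g = 0} := isClosed_eq Λ.continuous continuous_const
  exact closure_minimal hker hcl hg

lemma eq_zero_of_mom {n : ℕ} {Z : EuclideanSpace ℝ (Fin n) → ℝ} (hZ : Continuous Z)
    (hbdd : ∃ C : ℝ, ∀ y, |Z y| ≤ C) (hm : ∀ a b j, mom Z a b j = 0) : ∀ y, Z y = 0 := by
  let K : Set (EuclideanSpace ℝ (Fin n) × ℝ) := closedBall 0 1
  have : CompactSpace K := isCompact_iff_compactSpace.1 (isCompact_closedBall _ _)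
  have hX : ∀ y : EuclideanSpace ℝ (Fin n),
      ((1 + ‖y‖ ^ 2)⁻¹ • y, (1 + ‖y‖ ^ 2)⁻¹) ∈ K := by
    intro y
    have h1 : (1 + ‖y‖ ^ 2)⁻¹ ≤ 1 := inv_le_one_of_one_le₀ (by nlinarith [sq_nonneg ‖y‖])
    have h0 : 0 ≤ (1 + ‖y‖ ^ 2)⁻¹ := by positivity
    rw [mem_closedBall, dist_zero_right, Prod.norm_def]
    apply max_le
    · simp only [norm_smul, Real.norm_eq_abs, abs_of_nonneg h0]
      rw [inv_mul_le_one₀ (by positivity)]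
      nlinarith [sq_nonneg (‖y‖ - 1)]
    · simp only [Real.norm_eq_abs, abs_of_nonneg h0]
      exact h1
  let X : EuclideanSpace ℝ (Fin n) → K := fun y => ⟨_, hX y⟩
  have hXc : Continuous X := by
    apply Continuous.subtype_mk
    have : Continuous fun y : EuclideanSpace ℝ (Fin n) => (1 + ‖y‖ ^ 2)⁻¹ :=
      Continuous.inv₀ (by fun_prop) (fun y => by positivity)
    exact (this.smul continuous_id).prodMk this
  let g : EuclideanSpace ℝ (Fin n) → ℝ := fun y => Z y * (1 + ‖y‖ ^ 2) ^ (-((n : ℝ) + 2) / 2)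
  have hg : Integrable g := by
    have := mom_integrable hZ hbdd 0 0 0
    simp only [pow_zero, one_mul, Nat.cast_zero, neg_zero, zero_sub, ← neg_div] at this
    exact this
  have hgF : ∀ F : C(K, ℝ), Integrable (fun y => g y * F (X y)) := by
    intro F
    refine hg.mul_bdd (c := ‖F‖) ((F.continuous.comp hXc).aestronglyMeasurable) ?_
    exact Eventually.of_forall fun y => F.norm_coe_le_norm _
  let Λ0 : C(K, ℝ) →ₗ[ℝ] ℝ :=
    { toFun := fun F => ∫ y, g y * F (X y)
      map_add' := by
        intro F G
        rw [← integral_add (hgF F) (hgF G)]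
        congr 1
        ext y
        simp [mul_add]
      map_smul' := by
        intro c F
        rw [RingHom.id_apply, smul_eq_mul, ← integral_const_mul]
        congr 1
        ext y
        simp
        ring }
  let Λ : C(K, ℝ) →L[ℝ] ℝ := Λ0.mkContinuous (∫ y, ‖g y‖) (by
    intro F
    refine (norm_integral_le_integral_norm _).trans ?_
    rw [← integral_mul_const]
    apply integral_mono (hgF F).norm (hg.norm.mul_const _)
    intro y
    simp only [norm_mul]
    exact mul_le_mul_of_nonneg_left (F.norm_coe_le_norm _) (norm_nonneg _))
  have hΛ : ∀ F : C(K, ℝ), Λ F = ∫ y, g y * F (X y) := fun F => rfl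
  let ℓ : (EuclideanSpace ℝ (Fin n) × ℝ) →ₗ[ℝ] C(K, ℝ) :=
    { toFun := fun q => ⟨fun x => inner ℝ q.1 x.1.1 + q.2 * x.1.2, by fun_prop⟩
      map_add' := by
        intro q r
        ext x
        simp [inner_add_left]
        ring
      map_smul' := by
        intro c q
        ext x
        simp [inner_smul_left]
        ring }
  have hΛ0 : Λ = 0 := by
    apply exp_span_dense (LinearMap.range ℓ)
    · rintro ⟨x, hx⟩ ⟨x', hx'⟩ hne
      by_contra! hcon
      apply hne
      have h : ∀ q : EuclideanSpace ℝ (Fin n) × ℝ, inner ℝ q.1 x.1 + q.2 * x.2 = inner ℝ q.1 x'.1 + q.2 * x'.2 := fun q =>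
        hcon (ℓ q) ⟨q, rfl⟩
      apply Subtype.ext
      apply Prod.ext
      · apply ext_inner_left ℝ
        intro v
        simpa using h (v, 0)
      · simpa using h (0, 1)
    · rintro _ ⟨q, rfl⟩ k
      rw [hΛ, ← hm q.1 q.2 k]
      unfold mom
      congr 1
      ext y
      have hs : 0 < 1 + ‖y‖ ^ 2 := by positivity
      have e : (ℓ q ^ k) (X y) = ((1 + ‖y‖ ^ 2)⁻¹ * (inner ℝ q.1 y + q.2)) ^ k := by
        change (inner ℝ q.1 ((1 + ‖y‖ ^ 2)⁻¹ • y) + q.2 * (1 + ‖y‖ ^ 2)⁻¹) ^ k = _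
        rw [inner_smul_right]
        ring
      have e2 : (1 + ‖y‖ ^ 2) ^ (-(k : ℝ) - ((n : ℝ) + 2) / 2)
          = ((1 + ‖y‖ ^ 2)⁻¹) ^ k * (1 + ‖y‖ ^ 2) ^ (-((n : ℝ) + 2) / 2) := by
        rw [sub_eq_add_neg, Real.rpow_add hs, Real.rpow_neg hs.le, Real.rpow_natCast, inv_pow,
          neg_div]
      rw [e, e2, mul_pow]
      simp only [g]
      ring
  have hG := hΛ ⟨fun x : K => x.1.2 * Z (x.1.2⁻¹ • x.1.1),
    (continuous_persp hZ hbdd).comp continuous_subtype_val⟩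
  have hInt2 := hgF ⟨fun x : K => x.1.2 * Z (x.1.2⁻¹ • x.1.1),
    (continuous_persp hZ hbdd).comp continuous_subtype_val⟩
  have e : ∀ y, g y * (⟨fun x : K => x.1.2 * Z (x.1.2⁻¹ • x.1.1),
    (continuous_persp hZ hbdd).comp continuous_subtype_val⟩ : C(K, ℝ)) (X y)
      = Z y ^ 2 * ((1 + ‖y‖ ^ 2) ^ (-((n : ℝ) + 2) / 2) * (1 + ‖y‖ ^ 2)⁻¹) := by
    intro y
    have hs : (1 + ‖y‖ ^ 2) ≠ 0 := by positivity
    change g y * ((1 + ‖y‖ ^ 2)⁻¹ * Z (((1 + ‖y‖ ^ 2)⁻¹)⁻¹ • (1 + ‖y‖ ^ 2)⁻¹ • y)) = _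
    rw [smul_smul, inv_inv, mul_inv_cancel₀ hs, one_smul]
    simp only [g]
    ring
  simp_rw [e] at hG hInt2
  rw [hΛ0] at hG
  have hnn : 0 ≤ fun y => Z y ^ 2 * ((1 + ‖y‖ ^ 2) ^ (-((n : ℝ) + 2) / 2) * (1 + ‖y‖ ^ 2)⁻¹) := by
    intro y
    simp only [Pi.zero_apply]
    positivity
  have hae := (integral_eq_zero_iff_of_nonneg hnn hInt2).1 hG.symm
  have hZae : Z =ᵐ[volume] fun _ => 0 := by
    filter_upwards [hae] with y hy
    have hp : 0 < (1 + ‖y‖ ^ 2) ^ (-((n : ℝ) + 2) / 2) * (1 + ‖y‖ ^ 2)⁻¹ := by positivity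
    simp only [Pi.zero_apply] at hy
    exact pow_eq_zero_iff (two_ne_zero) |>.1 ((mul_eq_zero.1 hy).resolve_right hp.ne')
  have := (Continuous.ae_eq_iff_eq volume hZ continuous_const).1 hZae
  exact fun y => congrFun this y

/-! ### The space of bounded solutions and the explicit kernel -/

lemma lap_add {n : ℕ} {f g : EuclideanSpace ℝ (Fin n) → ℝ} (hf : ContDiff ℝ 2 f)
    (hg : ContDiff ℝ 2 g) (y : EuclideanSpace ℝ (Fin n)) :
    lap (f + g) y = lap f y + lap g y := by
  unfold lap
  rw [← Finset.sum_add_distrib]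
  refine Finset.sum_congr rfl fun i _ => ?_
  have e : (fun z => fderiv ℝ (f + g) z (EuclideanSpace.single i 1))
      = fun z => fderiv ℝ f z (EuclideanSpace.single i 1)
        + fderiv ℝ g z (EuclideanSpace.single i 1) := by
    ext z
    rw [fderiv_add (hf.differentiable (by norm_num)).differentiableAt
      (hg.differentiable (by norm_num)).differentiableAt]
    rfl
  rw [e, fderiv_fun_add ((contDiff_fderiv_apply hf _).differentiable (by norm_num)).differentiableAt
      ((contDiff_fderiv_apply hg _).differentiable (by norm_num)).differentiableAt]
  rfl

lemma lap_smul {n : ℕ} {f : EuclideanSpace ℝ (Fin n) → ℝ} (hf : ContDiff ℝ 2 f) (c : ℝ)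
    (y : EuclideanSpace ℝ (Fin n)) :
    lap (c • f) y = c * lap f y := by
  unfold lap
  rw [Finset.mul_sum]
  refine Finset.sum_congr rfl fun i _ => ?_
  have e : (fun z => fderiv ℝ (c • f) z (EuclideanSpace.single i 1))
      = fun z => c * fderiv ℝ f z (EuclideanSpace.single i 1) := by
    ext z
    rw [fderiv_const_smul (hf.differentiable (by norm_num)).differentiableAt]
    rfl
  rw [e, fderiv_const_mul
    ((contDiff_fderiv_apply hf _).differentiable (by norm_num)).differentiableAt]
  rfl

/-- The space of bounded `C²` solutions of the linearized equation. -/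
def solSpace (n : ℕ) : Submodule ℝ (EuclideanSpace ℝ (Fin n) → ℝ) where
  carrier := {f | ContDiff ℝ 2 f ∧ (∃ C : ℝ, ∀ y, |f y| ≤ C) ∧
    ∀ y, lap f y + n * (n + 2) * (1 + ‖y‖ ^ 2) ^ (-2 : ℝ) * f y = 0}
  add_mem' := by
    rintro f g ⟨hf, ⟨C, hC⟩, hfe⟩ ⟨hg, ⟨D, hD⟩, hge⟩
    refine ⟨hf.add hg, ⟨C + D, fun y => (abs_add_le _ _).trans (add_le_add (hC y) (hD y))⟩, ?_⟩
    intro y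
    rw [lap_add hf hg]
    have h1 := hfe y
    have h2 := hge y
    simp only [Pi.add_apply]
    linear_combination h1 + h2
  zero_mem' := by
    refine ⟨contDiff_const, ⟨0, by simp⟩, ?_⟩
    intro y
    have := lap_smul (n := n) (f := fun _ => 0) contDiff_const 0 y
    rw [zero_smul, zero_mul] at this
    rw [this]
    simp
  smul_mem' := by
    rintro c f ⟨hf, ⟨C, hC⟩, hfe⟩
    refine ⟨hf.const_smul c, ⟨|c| * C, fun y => ?_⟩, ?_⟩
    · simp only [Pi.smul_apply, smul_eq_mul, abs_mul]
      exact mul_le_mul_of_nonneg_left (hC y) (abs_nonneg _)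
    · intro y
      rw [lap_smul hf]
      have h1 := hfe y
      simp only [Pi.smul_apply, smul_eq_mul]
      linear_combination c * h1

lemma eq_zero_of_sol {n : ℕ} (hn : 1 ≤ n) {f : EuclideanSpace ℝ (Fin n) → ℝ} (hf : f ∈ solSpace n)
    (h1 : ∀ a b, mom f a b 1 = 0) : f = 0 := by
  obtain ⟨hr, hb, he⟩ := hf
  ext y
  exact eq_zero_of_mom hr.continuous hb (fun a b j => mom_all hn hr hb he h1 j a b) y

lemma mom_add {n : ℕ} {f g : EuclideanSpace ℝ (Fin n) → ℝ} (hf : f ∈ solSpace n)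
    (hg : g ∈ solSpace n) (a : EuclideanSpace ℝ (Fin n)) (b : ℝ) (j : ℕ) :
    mom (f + g) a b j = mom f a b j + mom g a b j := by
  unfold mom
  rw [← integral_add (mom_integrable hf.1.continuous hf.2.1 a b j)
    (mom_integrable hg.1.continuous hg.2.1 a b j)]
  congr 1
  ext y
  simp only [Pi.add_apply]
  ring

lemma mom_smul {n : ℕ} (f : EuclideanSpace ℝ (Fin n) → ℝ) (c : ℝ)
    (a : EuclideanSpace ℝ (Fin n)) (b : ℝ) (j : ℕ) :
    mom (c • f) a b j = c * mom f a b j := by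
  unfold mom
  rw [← integral_const_mul]
  congr 1
  ext y
  simp only [Pi.smul_apply, smul_eq_mul]
  ring

lemma mom_one_expand {n : ℕ} {f : EuclideanSpace ℝ (Fin n) → ℝ} (hf : f ∈ solSpace n)
    (a : EuclideanSpace ℝ (Fin n)) (b : ℝ) :
    mom f a b 1 = (∑ i, a i * mom f (EuclideanSpace.single i 1) 0 1) + b * mom f 0 1 1 := by
  unfold mom
  have i1 : ∀ i ∈ Finset.univ, Integrable (fun y => a i * (f y *
      ((inner ℝ (EuclideanSpace.single i (1 : ℝ)) y + 0) ^ 1 *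
        (1 + ‖y‖ ^ 2) ^ (-((1 : ℕ) : ℝ) - ((n : ℝ) + 2) / 2)))) := fun i _ =>
    (mom_integrable hf.1.continuous hf.2.1 (EuclideanSpace.single i 1) 0 1).const_mul _
  have i2 := (mom_integrable hf.1.continuous hf.2.1 0 1 1).const_mul b
  simp_rw [← integral_const_mul]
  rw [← integral_finsetSum _ i1, ← integral_add (integrable_finsetSum _ i1) i2]
  congr 1
  ext y
  have e : inner ℝ a y = ∑ i, a i * y i := by
    simp [PiLp.inner_apply, mul_comm]
  rw [e]
  simp only [EuclideanSpace.inner_single_left, inner_zero_left, pow_one, map_one, one_mul, add_zero,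
    zero_add]
  rw [add_mul, mul_add, Finset.sum_mul, Finset.mul_sum]
  congr 1
  · refine Finset.sum_congr rfl fun i _ => ?_
    ring
  · ring

/-- The constant in front of the bubble. -/
def bubC (n : ℕ) : ℝ := ((n : ℝ) * ((n : ℝ) - 2)) ^ (((n : ℝ) - 2) / 4)

lemma fderiv_stdBubble (n : ℕ) (y e : EuclideanSpace ℝ (Fin n)) :
    fderiv ℝ (stdBubble n) y e
      = bubC n * (2 - n) * (1 + ‖y‖ ^ 2) ^ (-((n : ℝ) / 2)) * inner ℝ y e := by
  have hs : 0 < 1 + ‖y‖ ^ 2 := by positivity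
  have h : HasDerivAt (fun s : ℝ => bubC n * s ^ (-(((n : ℝ) - 2) / 2)))
      (bubC n * (-(((n : ℝ) - 2) / 2) * (1 + ‖y‖ ^ 2) ^ (-(((n : ℝ) - 2) / 2) - 1)))
      (1 + ‖y‖ ^ 2) := (Real.hasDerivAt_rpow_const (Or.inl hs.ne')).const_mul _
  have h2 : HasFDerivAt (stdBubble n) _ y := hasFDerivAt_comp_normSq y h
  rw [h2.fderiv]
  have e1 : -(((n : ℝ) - 2) / 2) - 1 = -((n : ℝ) / 2) := by ring
  rw [e1]
  simp
  ring

lemma kerZ_eq (n : ℕ) (i : Fin n) : kerZ n i = (bubC n * (2 - n)) •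
    fun y : EuclideanSpace ℝ (Fin n) =>
      (inner ℝ (EuclideanSpace.single i (1 : ℝ)) y + 0) ^ 1 * (1 + ‖y‖ ^ 2) ^ (-((n : ℝ) / 2)) := by
  ext y
  rw [kerZ, fderiv_stdBubble, real_inner_comm]
  simp only [Pi.smul_apply, smul_eq_mul]
  ring

lemma kerZlast_eq (n : ℕ) : kerZlast n = (bubC n * ((2 - n) / 2)) •
    fun y : EuclideanSpace ℝ (Fin n) => (inner ℝ (0 : EuclideanSpace ℝ (Fin n)) y + 0) ^ 0 *
      ((1 + ‖y‖ ^ 2) ^ (-((n : ℝ) / 2) + 1) - 2 * (1 + ‖y‖ ^ 2) ^ (-((n : ℝ) / 2))) := by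
  ext y
  have hs : 0 < 1 + ‖y‖ ^ 2 := by positivity
  rw [kerZlast, fderiv_stdBubble, real_inner_self_eq_norm_sq, stdBubble]
  change ((n : ℝ) - 2) / 2 * (bubC n * _) + _ = _
  rw [show -(((n : ℝ) - 2) / 2) = -((n : ℝ) / 2) + 1 by ring, Real.rpow_add_one hs.ne']
  simp only [Pi.smul_apply, smul_eq_mul, pow_zero]
  rw [Real.rpow_add_one hs.ne']
  ring

lemma contDiff_test {n : ℕ} (a : EuclideanSpace ℝ (Fin n)) (b : ℝ) (k : ℕ) (γ : ℝ) :
    ContDiff ℝ 2 (fun y : EuclideanSpace ℝ (Fin n) =>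
      (inner ℝ a y + b) ^ k * (1 + ‖y‖ ^ 2) ^ γ) := by
  have hs : ContDiff ℝ 2 (fun y : EuclideanSpace ℝ (Fin n) => 1 + ‖y‖ ^ 2) :=
    contDiff_const.add (contDiff_norm_sq ℝ)
  have h1 : ContDiff ℝ 2 (fun y : EuclideanSpace ℝ (Fin n) => inner ℝ a y + b) :=
    (contDiff_const.inner ℝ contDiff_id).add contDiff_const
  exact (h1.pow k).mul (hs.rpow_const_of_ne (fun y => by positivity))

lemma kerZ_mem {n : ℕ} (hn : 3 ≤ n) (i : Fin n) : kerZ n i ∈ solSpace n := by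
  rw [kerZ_eq]
  apply Submodule.smul_mem
  have hn' : (3 : ℝ) ≤ n := by exact_mod_cast hn
  refine ⟨contDiff_test _ _ _ _, ⟨1, fun y => ?_⟩, fun y => ?_⟩
  · have hs1 : 1 ≤ 1 + ‖y‖ ^ 2 := by nlinarith [sq_nonneg ‖y‖]
    have hs : 0 < 1 + ‖y‖ ^ 2 := by positivity
    have h1 : |inner ℝ (EuclideanSpace.single i (1 : ℝ)) y| ≤ 1 + ‖y‖ ^ 2 := by
      refine (abs_real_inner_le_norm _ _).trans ?_
      simp
      nlinarith [sq_nonneg (‖y‖ - 1)]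
    have h2 : (1 + ‖y‖ ^ 2) ^ (-((n : ℝ) / 2)) ≤ (1 + ‖y‖ ^ 2) ^ (-1 : ℝ) :=
      Real.rpow_le_rpow_of_exponent_le hs1 (by linarith)
    rw [Real.rpow_neg_one] at h2
    beta_reduce
    rw [add_zero, pow_one, abs_mul, abs_of_nonneg (Real.rpow_nonneg hs.le _)]
    calc _ ≤ (1 + ‖y‖ ^ 2) * (1 + ‖y‖ ^ 2)⁻¹ :=
          mul_le_mul h1 h2 (Real.rpow_nonneg hs.le _) hs.le
      _ = 1 := mul_inv_cancel₀ hs.ne'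
  · have hs : 0 < 1 + ‖y‖ ^ 2 := by positivity
    rw [lap_test (H := fun s => s ^ (-((n : ℝ) / 2)))
      (H1 := fun s => (-((n : ℝ) / 2)) * s ^ (-((n : ℝ) / 2) - 1))
      (H2 := fun s => (-((n : ℝ) / 2)) * ((-((n : ℝ) / 2) - 1) * s ^ (-((n : ℝ) / 2) - 1 - 1)))
      (fun s hs => Real.hasDerivAt_rpow_const (Or.inl hs.ne'))
      (fun s hs => (Real.hasDerivAt_rpow_const (Or.inl hs.ne')).const_mul _)]
    have e1 : (1 + ‖y‖ ^ 2) ^ (-2 : ℝ) = ((1 + ‖y‖ ^ 2) ^ 2)⁻¹ := by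
      rw [Real.rpow_neg hs.le]; norm_cast
    beta_reduce
    rw [Real.rpow_sub_one hs.ne' (-((n : ℝ) / 2) - 1), Real.rpow_sub_one hs.ne' (-((n : ℝ) / 2)), e1]
    simp only [Nat.sub_self, Nat.cast_zero, Nat.cast_one, pow_zero, pow_one, add_zero]
    field_simp
    ring

lemma kerZlast_mem {n : ℕ} (hn : 3 ≤ n) : kerZlast n ∈ solSpace n := by
  rw [kerZlast_eq]
  apply Submodule.smul_mem
  have hn' : (3 : ℝ) ≤ n := by exact_mod_cast hn
  refine ⟨?_, ⟨3, fun y => ?_⟩, fun y => ?_⟩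
  · have h1 := contDiff_test (0 : EuclideanSpace ℝ (Fin n)) 0 0 (-((n : ℝ) / 2) + 1)
    have h2 := contDiff_test (0 : EuclideanSpace ℝ (Fin n)) 0 0 (-((n : ℝ) / 2))
    simp only [pow_zero, one_mul] at h1 h2 ⊢
    exact h1.sub (contDiff_const.mul h2)
  · have hs1 : 1 ≤ 1 + ‖y‖ ^ 2 := by nlinarith [sq_nonneg ‖y‖]
    have hs : 0 < 1 + ‖y‖ ^ 2 := by positivity
    have h1 : (1 + ‖y‖ ^ 2) ^ (-((n : ℝ) / 2)) ≤ 1 :=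
      Real.rpow_le_one_of_one_le_of_nonpos hs1 (by linarith)
    have h2 : (1 + ‖y‖ ^ 2) ^ (-((n : ℝ) / 2) + 1) ≤ 1 :=
      Real.rpow_le_one_of_one_le_of_nonpos hs1 (by linarith)
    have h3 := Real.rpow_nonneg hs.le (-((n : ℝ) / 2))
    have h4 := Real.rpow_nonneg hs.le (-((n : ℝ) / 2) + 1)
    beta_reduce
    rw [pow_zero, one_mul, abs_le]
    constructor <;> linarith
  · have hs : 0 < 1 + ‖y‖ ^ 2 := by positivity
    rw [lap_test (H := fun s => s ^ (-((n : ℝ) / 2) + 1) - 2 * s ^ (-((n : ℝ) / 2)))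
      (H1 := fun s => (-((n : ℝ) / 2) + 1) * s ^ (-((n : ℝ) / 2) + 1 - 1)
        - 2 * ((-((n : ℝ) / 2)) * s ^ (-((n : ℝ) / 2) - 1)))
      (H2 := fun s => (-((n : ℝ) / 2) + 1) * ((-((n : ℝ) / 2) + 1 - 1)
          * s ^ (-((n : ℝ) / 2) + 1 - 1 - 1))
        - 2 * ((-((n : ℝ) / 2)) * ((-((n : ℝ) / 2) - 1) * s ^ (-((n : ℝ) / 2) - 1 - 1))))
      (fun s hs => (Real.hasDerivAt_rpow_const (Or.inl hs.ne')).fun_sub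
        ((Real.hasDerivAt_rpow_const (Or.inl hs.ne')).const_mul 2))
      (fun s hs => ((Real.hasDerivAt_rpow_const (Or.inl hs.ne')).const_mul _).fun_sub
        (((Real.hasDerivAt_rpow_const (Or.inl hs.ne')).const_mul _).const_mul 2))]
    have e1 : (1 + ‖y‖ ^ 2) ^ (-2 : ℝ) = ((1 + ‖y‖ ^ 2) ^ 2)⁻¹ := by
      rw [Real.rpow_neg hs.le]; norm_cast
    have e2 : -((n : ℝ) / 2) + 1 - 1 = -((n : ℝ) / 2) := by ring
    beta_reduce
    rw [e2, Real.rpow_sub_one hs.ne' (-((n : ℝ) / 2) - 1), Real.rpow_sub_one hs.ne' (-((n : ℝ) / 2)),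
      e1, Real.rpow_add_one hs.ne' (-((n : ℝ) / 2))]
    simp only [Nat.cast_zero, pow_zero]
    field_simp
    ring

/-- The parametrization of the explicit kernel. -/
def kerComb (n : ℕ) (c : (Fin n → ℝ) × ℝ) : EuclideanSpace ℝ (Fin n) → ℝ :=
  (∑ i : Fin n, c.1 i • kerZ n i) + c.2 • kerZlast n

lemma kerComb_mem {n : ℕ} (hn : 3 ≤ n) (c : (Fin n → ℝ) × ℝ) : kerComb n c ∈ solSpace n :=
  Submodule.add_mem _ (Submodule.sum_mem _ fun i _ => Submodule.smul_mem _ _ (kerZ_mem hn i))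
    (Submodule.smul_mem _ _ (kerZlast_mem hn))

lemma kerComb_inj {n : ℕ} (hn : 3 ≤ n) (c : (Fin n → ℝ) × ℝ) (h : kerComb n c = 0) : c = 0 := by
  have hn' : (3 : ℝ) ≤ n := by exact_mod_cast hn
  have hα : 0 < bubC n := by
    unfold bubC
    apply Real.rpow_pos_of_pos
    nlinarith
  have hf : ∀ y, (∑ i : Fin n, c.1 i * kerZ n i y) + c.2 * kerZlast n y = 0 := by
    intro y
    have := congrFun h y
    simpa [kerComb] using this
  have h2 : c.2 = 0 := by
    have := hf 0
    simp only [kerZ_eq, kerZlast_eq] at this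
    simp at this
    rcases this with h | h | h
    · exact h
    · rcases h with h | h
      · exact absurd h hα.ne'
      · exfalso; linarith
    · norm_num at h
  have h1 : ∀ i, c.1 i = 0 := by
    intro i
    have := hf (EuclideanSpace.single i 1)
    simp only [kerZ_eq, h2, zero_mul, add_zero] at this
    rw [Finset.sum_eq_single i] at this
    · have hp : (0 : ℝ) < (1 + 1) ^ (-((n : ℝ) / 2)) := by positivity
      simp [EuclideanSpace.inner_single_left] at this
      rcases this with h | h
      · exact h
      · exfalso
        rcases h with (h | h) | h
        · exact hα.ne' h
        · linarith
        · exact hp.ne' h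
    · intro j _ hj
      simp [EuclideanSpace.inner_single_left, hj]
    · simp
  ext i
  · exact h1 i
  · exact h2

lemma potential_eq {n : ℕ} (hn : 3 ≤ n) (y : EuclideanSpace ℝ (Fin n)) :
    (((n : ℝ) + 2) / ((n : ℝ) - 2)) *
          stdBubble n y ^ ((((n : ℝ) + 2) / ((n : ℝ) - 2)) - 1)
      = n * (n + 2) * (1 + ‖y‖ ^ 2) ^ (-2 : ℝ) := by
  have hn' : (3 : ℝ) ≤ n := by exact_mod_cast hn
  have h2 : (n : ℝ) - 2 ≠ 0 := by linarith
  have hs : 0 < 1 + ‖y‖ ^ 2 := by positivity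
  have hA : 0 ≤ (n : ℝ) * ((n : ℝ) - 2) := by nlinarith
  rw [stdBubble, Real.mul_rpow (Real.rpow_nonneg hA _) (Real.rpow_nonneg hs.le _),
    ← Real.rpow_mul hA, ← Real.rpow_mul hs.le]
  have e1 : ((n : ℝ) - 2) / 4 * (((n : ℝ) + 2) / ((n : ℝ) - 2) - 1) = 1 := by
    field_simp; ring
  have e2 : -(((n : ℝ) - 2) / 2) * (((n : ℝ) + 2) / ((n : ℝ) - 2) - 1) = -2 := by
    field_simp; ring
  rw [e1, e2, Real.rpow_one]
  field_simp

lemma main_sol {n : ℕ} (hn : 3 ≤ n) {Z : EuclideanSpace ℝ (Fin n) → ℝ} (hZ : Z ∈ solSpace n) :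
    ∃ c, Z = kerComb n c := by
  have hn1 : 1 ≤ n := by omega
  let T : ((Fin n → ℝ) × ℝ) →ₗ[ℝ] ((Fin n → ℝ) × ℝ) :=
    { toFun := fun c => (fun i => mom (kerComb n c) (EuclideanSpace.single i 1) 0 1,
        mom (kerComb n c) 0 1 1)
      map_add' := by
        intro c d
        have e : kerComb n (c + d) = kerComb n c + kerComb n d := by
          ext y
          simp [kerComb, add_mul, Finset.sum_add_distrib]
          ring
        rw [e]
        simp only [mom_add (kerComb_mem hn c) (kerComb_mem hn d)]
        rfl
      map_smul' := by
        intro r c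
        have e : kerComb n (r • c) = r • kerComb n c := by
          ext y
          simp [kerComb, mul_add, Finset.mul_sum, mul_assoc]
        rw [e]
        simp only [mom_smul]
        rfl }
  have hzero : ∀ f ∈ solSpace n, (∀ i, mom f (EuclideanSpace.single i 1) 0 1 = 0) →
      mom f 0 1 1 = 0 → f = 0 := by
    intro f hf h1 h2
    apply eq_zero_of_sol hn1 hf
    intro a b
    rw [mom_one_expand hf]
    simp [h1, h2]
  have hinj : Function.Injective T := by
    rw [← LinearMap.ker_eq_bot, LinearMap.ker_eq_bot']
    intro c hc
    apply kerComb_inj hn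
    apply hzero _ (kerComb_mem hn c)
    · exact fun i => congrFun (congrArg Prod.fst hc) i
    · exact congrArg Prod.snd hc
  obtain ⟨c, hc⟩ := LinearMap.surjective_of_injective hinj
    (fun i => mom Z (EuclideanSpace.single i 1) 0 1, mom Z 0 1 1)
  refine ⟨c, ?_⟩
  have hm := Submodule.smul_mem (solSpace n) (-1 : ℝ) (kerComb_mem hn c)
  have hz : Z + (-1 : ℝ) • kerComb n c = 0 := by
    apply hzero _ (Submodule.add_mem _ hZ hm)
    · intro i
      have h : mom (kerComb n c) (EuclideanSpace.single i 1) 0 1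
          = mom Z (EuclideanSpace.single i 1) 0 1 := congrFun (congrArg Prod.fst hc) i
      rw [mom_add hZ hm, mom_smul, h]
      ring
    · have h : mom (kerComb n c) 0 1 1 = mom Z 0 1 1 := congrArg Prod.snd hc
      rw [mom_add hZ hm, mom_smul, h]
      ring
  ext y
  have := congrFun hz y
  simp only [Pi.add_apply, Pi.smul_apply, smul_eq_mul, Pi.zero_apply] at this
  linarith

/-- nondegeneracy of the Aubin–Talenti bubble: for `n ≥ 3`,
`p = (n+2)/(n-2)`, every bounded solution `Z` of `ΔZ + p U^{p-1} Z = 0` on `ℝⁿ`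
is a linear combination of `Z_1, …, Z_n` and `Z_{n+1}`. -/
theorem statement4 (n : ℕ) (hn : 3 ≤ n) (Z : EuclideanSpace ℝ (Fin n) → ℝ)
    (hreg : ContDiff ℝ 2 Z) (hbdd : ∃ C : ℝ, ∀ y, |Z y| ≤ C)
    (heq : ∀ y : EuclideanSpace ℝ (Fin n),
      lap Z y +
        (((n : ℝ) + 2) / ((n : ℝ) - 2)) *
          stdBubble n y ^ ((((n : ℝ) + 2) / ((n : ℝ) - 2)) - 1) * Z y = 0) :
    ∃ (c : Fin n → ℝ) (d : ℝ), ∀ y : EuclideanSpace ℝ (Fin n),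
      Z y = (∑ i : Fin n, c i * kerZ n i y) + d * kerZlast n y := by
  have hZ : Z ∈ solSpace n := by
    refine ⟨hreg, hbdd, fun y => ?_⟩
    rw [← potential_eq hn y]
    exact heq y
  obtain ⟨c, hc⟩ := main_sol hn hZ
  refine ⟨c.1, c.2, fun y => ?_⟩
  rw [hc]
  simp [kerComb]
end
end

section
/- Let n ≥ 3 and p = (n+2)/(n−2). There exist a number λ₀ > 0 and a bounded, positive, radially symmetric function Z₀ on ℝ^n such that ΔZ₀ + p U(y)^{p−1} Z₀ = λ₀ Z₀ on ℝ^n, and there are constants c₁, c₂ > 0 such that c₁ |y|^{−(n−1)/2} e^{−√λ₀ |y|} ≤ Z₀(y) ≤ c₂ |y|^{−(n−1)/2} e^{−√λ₀ |y|} for all |y| ≥ 1. Moreover λ₀ is the only positive eigenvalue of the operator L₀[φ] = Δφ + pU^{p−1}φ in L^∞(ℝ^n), and it is simple. -/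
open Set MeasureTheory Filter Topology Metric Bornology

noncomputable section

/-- clamp -/
def clp (N l : ℝ) : ℝ := max 0 (min l N)

def qf (N : ℝ) (r l : ℝ) : ℝ := clp N l - N / (1 + r ^ 2) ^ 2

lemma qf_cont (N : ℝ) : Continuous (fun x : ℝ × ℝ => qf N x.1 x.2) := by
  unfold qf clp
  refine Continuous.sub (by fun_prop) (Continuous.div (by fun_prop) (by fun_prop) ?_)
  intro x; positivity

lemma qf_bd {N : ℝ} (hN : 0 ≤ N) (r l : ℝ) : |qf N r l| ≤ N := by
  unfold qf clp
  have h1 : 0 ≤ N / (1 + r ^ 2) ^ 2 := by positivity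
  have h2 : N / (1 + r ^ 2) ^ 2 ≤ N := by
    apply div_le_self hN
    nlinarith [sq_nonneg r]
  have h3 : max 0 (min l N) ≤ N := max_le hN (min_le_right _ _)
  have h4 : 0 ≤ max 0 (min l N) := le_max_left _ _
  rw [abs_le]; constructor <;> linarith

lemma clp_eq {N l : ℝ} (h0 : 0 ≤ l) (h1 : l ≤ N) : clp N l = l := by
  unfold clp; rw [min_eq_left h1, max_eq_right h0]

/-- inner average -/
def avg (n : ℕ) (F : ℝ → ℝ → ℝ) (s l : ℝ) : ℝ := ∫ σ in (0:ℝ)..1, σ ^ (n - 1) * F (s * σ) l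

lemma avg_cont (n : ℕ) {F : ℝ → ℝ → ℝ} (hF : Continuous (fun x : ℝ × ℝ => F x.1 x.2)) :
    Continuous (fun x : ℝ × ℝ => avg n F x.1 x.2) := by
  unfold avg
  apply intervalIntegral.continuous_parametric_intervalIntegral_of_continuous'
  have : Continuous (fun z : (ℝ × ℝ) × ℝ => F (z.1.1 * z.2) z.1.2) :=
    hF.comp (f := fun z : (ℝ × ℝ) × ℝ => (z.1.1 * z.2, z.1.2)) (by fun_prop)
  simp only [Function.uncurry_def]
  fun_prop

lemma avg_cont1 (n : ℕ) {F : ℝ → ℝ → ℝ} (hF : Continuous (fun x : ℝ × ℝ => F x.1 x.2)) (s l : ℝ) :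
    Continuous (fun σ : ℝ => σ ^ (n - 1) * F (s * σ) l) := by
  have : Continuous (fun z : ℝ => F (s * z) l) :=
    hF.comp (f := fun z : ℝ => (s * z, l)) (by fun_prop)
  fun_prop

lemma avg_sub (n : ℕ) {F G : ℝ → ℝ → ℝ} (hF : Continuous (fun x : ℝ × ℝ => F x.1 x.2))
    (hG : Continuous (fun x : ℝ × ℝ => G x.1 x.2)) (s l : ℝ) :
    avg n F s l - avg n G s l = avg n (fun a b => F a b - G a b) s l := by
  unfold avg
  rw [← intervalIntegral.integral_sub]
  · simp only [mul_sub]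
  · exact (avg_cont1 n hF s l).intervalIntegrable _ _
  · exact (avg_cont1 n hG s l).intervalIntegrable _ _

lemma avg_bd (n : ℕ) {F : ℝ → ℝ → ℝ} (s l B : ℝ) (hB : ∀ σ ∈ Icc (0:ℝ) 1, |F (s * σ) l| ≤ B) :
    |avg n F s l| ≤ B := by
  have := intervalIntegral.norm_integral_le_of_norm_le_const (a := (0:ℝ)) (b := 1) (C := B)
    (f := fun σ => σ ^ (n - 1) * F (s * σ) l) ?_
  · simpa [avg] using this
  · intro σ hσ
    rw [uIoc_of_le zero_le_one] at hσ
    have h1 : |σ ^ (n - 1)| ≤ 1 := by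
      rw [abs_of_nonneg (pow_nonneg hσ.1.le _)]
      exact pow_le_one₀ hσ.1.le hσ.2
    rw [Real.norm_eq_abs, abs_mul]
    have h2 := hB σ ⟨hσ.1.le, hσ.2⟩
    calc _ ≤ 1 * B := mul_le_mul h1 h2 (abs_nonneg _) zero_le_one
      _ = B := one_mul B

/-- outer -/
def outer (g : ℝ → ℝ → ℝ) (r l : ℝ) : ℝ := r ^ 2 * ∫ θ in (0:ℝ)..1, θ * g (r * θ) l

lemma outer_cont {F : ℝ → ℝ → ℝ} (hF : Continuous (fun x : ℝ × ℝ => F x.1 x.2)) :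
    Continuous (fun x : ℝ × ℝ => outer F x.1 x.2) := by
  unfold outer
  refine Continuous.mul (by fun_prop) ?_
  apply intervalIntegral.continuous_parametric_intervalIntegral_of_continuous'
  have : Continuous (fun z : (ℝ × ℝ) × ℝ => F (z.1.1 * z.2) z.1.2) :=
    hF.comp (f := fun z : (ℝ × ℝ) × ℝ => (z.1.1 * z.2, z.1.2)) (by fun_prop)
  simp only [Function.uncurry_def]
  fun_prop

lemma outer_cont1 {F : ℝ → ℝ → ℝ} (hF : Continuous (fun x : ℝ × ℝ => F x.1 x.2)) (s l : ℝ) :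
    Continuous (fun σ : ℝ => σ * F (s * σ) l) := by
  have : Continuous (fun z : ℝ => F (s * z) l) :=
    hF.comp (f := fun z : ℝ => (s * z, l)) (by fun_prop)
  fun_prop

lemma outer_eq {g : ℝ → ℝ → ℝ} (r l : ℝ) : outer g r l = ∫ s in (0:ℝ)..r, s * g s l := by
  have := intervalIntegral.mul_integral_comp_mul_left (a := 0) (b := 1)
    (f := fun s => s * g s l) r
  simp only [mul_zero, mul_one] at this
  rw [← this, outer, sq, mul_assoc, ← intervalIntegral.integral_const_mul]
  simp only [mul_assoc]

lemma outer_sub {F G : ℝ → ℝ → ℝ} (hF : Continuous (fun x : ℝ × ℝ => F x.1 x.2))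
    (hG : Continuous (fun x : ℝ × ℝ => G x.1 x.2)) (s l : ℝ) :
    outer F s l - outer G s l = outer (fun a b => F a b - G a b) s l := by
  unfold outer
  rw [← mul_sub, ← intervalIntegral.integral_sub]
  · simp only [mul_sub]
  · exact (outer_cont1 hF s l).intervalIntegrable _ _
  · exact (outer_cont1 hG s l).intervalIntegrable _ _

lemma outer_bd {g : ℝ → ℝ → ℝ} {C D : ℝ} (hC : 0 < C) (r l : ℝ)
    (hB : ∀ θ ∈ Icc (0:ℝ) 1, |g (r * θ) l| ≤ D * Real.exp (C * (r * θ) ^ 2)) :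
    |outer g r l| ≤ D * (Real.exp (C * r ^ 2) - 1) / (2 * C) := by
  have hd : ∀ θ ∈ uIcc (0:ℝ) 1, HasDerivAt (fun θ : ℝ => D * Real.exp (C * (r * θ) ^ 2) / (2 * C))
      (r ^ 2 * (θ * (D * Real.exp (C * (r * θ) ^ 2)))) θ := by
    intro θ _
    have h1 : HasDerivAt (fun θ : ℝ => C * (r * θ) ^ 2) (C * (2 * (r * θ) * r)) θ := by
      have := (((hasDerivAt_id θ).const_mul r).pow 2).const_mul C
      simpa using this
    have := ((h1.exp).const_mul D).div_const (2 * C)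
    refine this.congr_deriv ?_
    rw [div_eq_iff (by positivity)]
    ring
  have hcont : Continuous (fun θ : ℝ => r ^ 2 * (θ * (D * Real.exp (C * (r * θ) ^ 2)))) := by
    fun_prop
  have hI := intervalIntegral.integral_eq_sub_of_hasDerivAt hd (hcont.intervalIntegrable _ _)
  have hb := intervalIntegral.norm_integral_le_of_norm_le (μ := volume) (a := (0:ℝ)) (b := 1)
    (f := fun θ => r ^ 2 * (θ * g (r * θ) l))
    (g := fun θ => r ^ 2 * (θ * (D * Real.exp (C * (r * θ) ^ 2)))) zero_le_one
    (by
      refine Eventually.of_forall fun θ hθ => ?_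
      rw [Real.norm_eq_abs, abs_mul, abs_mul, abs_of_nonneg (sq_nonneg r), abs_of_nonneg hθ.1.le]
      have := hB θ ⟨hθ.1.le, hθ.2⟩
      have := hθ.1.le
      gcongr) (hcont.intervalIntegrable _ _)
  rw [hI, intervalIntegral.integral_const_mul] at hb
  unfold outer
  rw [← Real.norm_eq_abs]
  refine hb.trans (le_of_eq ?_)
  simp only [mul_one, mul_zero, ne_eq, OfNat.ofNat_ne_zero, not_false_eq_true, zero_pow,
    Real.exp_zero]
  ring

/-- The Picard map on unweighted functions. -/
def pic (n : ℕ) (N : ℝ) (u : ℝ → ℝ → ℝ) (r l : ℝ) : ℝ :=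
  1 + outer (avg n (fun a b => qf N a b * u a b)) r l

lemma pic_cont (n : ℕ) (N : ℝ) {u : ℝ → ℝ → ℝ} (hu : Continuous (fun x : ℝ × ℝ => u x.1 x.2)) :
    Continuous (fun x : ℝ × ℝ => pic n N u x.1 x.2) := by
  unfold pic
  exact continuous_const.add (outer_cont (avg_cont n ((qf_cont N).mul hu)))

lemma pic_sub_bd (n : ℕ) {N : ℝ} (hN : 0 < N) {u v : ℝ → ℝ → ℝ}
    (hu : Continuous (fun x : ℝ × ℝ => u x.1 x.2)) (hv : Continuous (fun x : ℝ × ℝ => v x.1 x.2))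
    {D : ℝ} (hD : 0 ≤ D) (h : ∀ r l, |u r l - v r l| ≤ D * Real.exp (N * r ^ 2)) (r l : ℝ) :
    |pic n N u r l - pic n N v r l| ≤ D / 2 * Real.exp (N * r ^ 2) := by
  have e : pic n N u r l - pic n N v r l
      = outer (avg n (fun a b => qf N a b * (u a b - v a b))) r l := by
    unfold pic
    rw [add_sub_add_left_eq_sub, outer_sub (avg_cont n ((qf_cont N).mul hu))
      (avg_cont n ((qf_cont N).mul hv))]
    congr 1
    funext a b
    rw [avg_sub n ((qf_cont N).mul hu) ((qf_cont N).mul hv)]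
    simp only [mul_sub]
  rw [e]
  have := outer_bd (D := N * D) (C := N) (g := avg n (fun a b => qf N a b * (u a b - v a b))) hN r l ?_
  · refine this.trans ?_
    have h2 : N * D * (Real.exp (N * r ^ 2) - 1) / (2 * N) = D / 2 * (Real.exp (N * r ^ 2) - 1) := by
      field_simp
    rw [h2]
    nlinarith
  · intro θ hθ
    apply avg_bd
    intro σ hσ
    rw [abs_mul]
    have h1 := qf_bd hN.le (r * θ * σ) l
    have h2 := h (r * θ * σ) l
    have h3 : Real.exp (N * (r * θ * σ) ^ 2) ≤ Real.exp (N * (r * θ) ^ 2) := by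
      apply Real.exp_le_exp.2
      apply mul_le_mul_of_nonneg_left _ hN.le
      rw [mul_pow]
      exact mul_le_of_le_one_right (sq_nonneg _) (pow_le_one₀ hσ.1 hσ.2)
    calc _ ≤ N * (D * Real.exp (N * (r * θ) ^ 2)) := by
            apply mul_le_mul h1 (h2.trans _) (abs_nonneg _) hN.le
            gcongr
      _ = _ := by ring

lemma ode_fix (n : ℕ) {N : ℝ} (hN : 0 < N) : ∃ u : ℝ → ℝ → ℝ,
    Continuous (fun x : ℝ × ℝ => u x.1 x.2) ∧ ∀ r l, u r l = pic n N u r l := by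
  let X := BoundedContinuousFunction (ℝ × ℝ) ℝ
  let W : X → ℝ → ℝ → ℝ := fun h r l => Real.exp (N * r ^ 2) * h (r, l)
  have hW : ∀ h : X, Continuous (fun x : ℝ × ℝ => W h x.1 x.2) := by
    intro h
    have := h.continuous
    change Continuous (fun x : ℝ × ℝ => Real.exp (N * x.1 ^ 2) * h (x.1, x.2))
    fun_prop
  have h0c : Continuous (fun x : ℝ × ℝ => (0 : ℝ → ℝ → ℝ) x.1 x.2) := continuous_const
  have pic0 : ∀ r l, pic n N 0 r l = 1 := by
    intro r l; simp [pic, outer, avg]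
  have hT1 : ∀ h : X, ∀ x : ℝ × ℝ, ‖Real.exp (-(N * x.1 ^ 2)) * pic n N (W h) x.1 x.2‖
      ≤ 1 + ‖h‖ := by
    intro h x
    have h1 := pic_sub_bd n hN (hW h) h0c (D := ‖h‖) (norm_nonneg _) (by
      intro r l
      have := h.norm_coe_le_norm (r, l)
      rw [Real.norm_eq_abs] at this
      simp only [W, Pi.zero_apply, sub_zero, abs_mul, Real.abs_exp]
      rw [mul_comm]; gcongr) x.1 x.2
    rw [pic0] at h1
    have h2 : |pic n N (W h) x.1 x.2| ≤ 1 + ‖h‖ / 2 * Real.exp (N * x.1 ^ 2) := by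
      have := abs_add_le (pic n N (W h) x.1 x.2 - 1) 1
      simp at this
      linarith
    rw [Real.norm_eq_abs, abs_mul, Real.abs_exp]
    have h3 : Real.exp (-(N * x.1 ^ 2)) * Real.exp (N * x.1 ^ 2) = 1 := by
      rw [← Real.exp_add]; simp
    have h4 : Real.exp (-(N * x.1 ^ 2)) ≤ 1 := by
      apply Real.exp_le_one_iff.2
      have : 0 ≤ N * x.1 ^ 2 := by positivity
      linarith
    calc _ ≤ Real.exp (-(N * x.1 ^ 2)) * (1 + ‖h‖ / 2 * Real.exp (N * x.1 ^ 2)) := by gcongr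
      _ = Real.exp (-(N * x.1 ^ 2)) + ‖h‖ / 2 * (Real.exp (-(N * x.1 ^ 2)) * Real.exp (N * x.1 ^ 2)) := by ring
      _ ≤ 1 + ‖h‖ := by rw [h3]; have := norm_nonneg h; linarith
  let T : X → X := fun h => BoundedContinuousFunction.ofNormedAddCommGroup
    (fun x : ℝ × ℝ => Real.exp (-(N * x.1 ^ 2)) * pic n N (W h) x.1 x.2)
    (by have := pic_cont n N (hW h); fun_prop) (1 + ‖h‖) (hT1 h)
  have hT : ContractingWith (1/2) T := by
    refine ⟨by norm_num, LipschitzWith.of_dist_le_mul fun h k => ?_⟩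
    rw [BoundedContinuousFunction.dist_le (by positivity)]
    intro x
    change dist (Real.exp (-(N * x.1 ^ 2)) * pic n N (W h) x.1 x.2)
      (Real.exp (-(N * x.1 ^ 2)) * pic n N (W k) x.1 x.2) ≤ _
    rw [Real.dist_eq, ← mul_sub, abs_mul, Real.abs_exp]
    have h1 := pic_sub_bd n hN (hW h) (hW k) (D := dist h k) dist_nonneg (by
      intro r l
      have := BoundedContinuousFunction.dist_coe_le_dist (f := h) (g := k) (r, l)
      rw [Real.dist_eq] at this
      simp only [W, ← mul_sub, abs_mul, Real.abs_exp]
      rw [mul_comm]; gcongr) x.1 x.2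
    have h3 : Real.exp (-(N * x.1 ^ 2)) * Real.exp (N * x.1 ^ 2) = 1 := by
      rw [← Real.exp_add]; simp
    calc _ ≤ Real.exp (-(N * x.1 ^ 2)) * (dist h k / 2 * Real.exp (N * x.1 ^ 2)) := by gcongr
      _ = dist h k / 2 * (Real.exp (-(N * x.1 ^ 2)) * Real.exp (N * x.1 ^ 2)) := by ring
      _ = _ := by rw [h3]; push_cast; ring
  have hfix : T (hT.fixedPoint T) = hT.fixedPoint T := hT.fixedPoint_isFixedPt
  refine ⟨W (hT.fixedPoint T), hW _, fun r l => ?_⟩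
  have := congrArg (fun f : X => f (r, l)) hfix
  change Real.exp (-(N * r ^ 2)) * pic n N (W (hT.fixedPoint T)) r l = (hT.fixedPoint T) (r, l) at this
  change Real.exp (N * r ^ 2) * (hT.fixedPoint T) (r, l) = _
  rw [← this, ← mul_assoc, ← Real.exp_add]; simp

lemma avg_eq (n : ℕ) (hn : 1 ≤ n) {F : ℝ → ℝ → ℝ} (s l : ℝ) :
    s ^ n * avg n F s l = ∫ t in (0:ℝ)..s, t ^ (n - 1) * F t l := by
  have := intervalIntegral.mul_integral_comp_mul_left (a := 0) (b := 1)
    (f := fun t => t ^ (n - 1) * F t l) s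
  simp only [mul_zero, mul_one] at this
  rw [← this, avg]
  obtain ⟨m, rfl⟩ : ∃ m, n = m + 1 := ⟨n - 1, by omega⟩
  simp only [Nat.add_sub_cancel, mul_pow, mul_assoc, intervalIntegral.integral_const_mul]
  ring

/-- ODE package. -/
theorem ode_package (n : ℕ) (hn : 1 ≤ n) {N : ℝ} (hN : 0 < N) : ∃ u g : ℝ → ℝ → ℝ,
    Continuous (fun x : ℝ × ℝ => u x.1 x.2) ∧ Continuous (fun x : ℝ × ℝ => g x.1 x.2) ∧
    (∀ l, u 0 l = 1) ∧ (∀ r l, HasDerivAt (fun r => u r l) (r * g r l) r) ∧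
    (∀ r l, 0 ≤ l → l ≤ N → 0 < r → HasDerivAt (fun r => g r l)
      (((l - N / (1 + r ^ 2) ^ 2) * u r l - n * g r l) / r) r) ∧
    (∀ l, 0 ≤ l → l ≤ N → n * g 0 l = l - N) := by
  obtain ⟨u, hu, hfix⟩ := ode_fix n hN
  set F : ℝ → ℝ → ℝ := fun a b => qf N a b * u a b with hF
  have hFc : Continuous (fun x : ℝ × ℝ => F x.1 x.2) := (qf_cont N).mul hu
  have hgc := avg_cont n hFc
  have hu0 : ∀ l, u 0 l = 1 := by intro l; rw [hfix]; simp [pic, outer]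
  refine ⟨u, avg n F, hu, hgc, hu0, ?_, ?_, ?_⟩
  · intro r l
    have e : (fun r => u r l) = fun r => 1 + ∫ s in (0:ℝ)..r, s * avg n F s l := by
      funext r
      rw [hfix, pic, outer_eq]
    rw [e]
    have hc : Continuous (fun s => s * avg n F s l) :=
      continuous_id.mul (hgc.comp (f := fun s : ℝ => (s, l)) (by fun_prop))
    exact (intervalIntegral.integral_hasDerivAt_right (hc.intervalIntegrable _ _)
      (hc.stronglyMeasurableAtFilter volume _) hc.continuousAt).const_add 1
  · intro r l h0 h1 hr
    have hc : Continuous (fun t => t ^ (n - 1) * F t l) :=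
      (continuous_pow _).mul (hFc.comp (f := fun s : ℝ => (s, l)) (by fun_prop))
    have hI := intervalIntegral.integral_hasDerivAt_right (hc.intervalIntegrable 0 r)
      (hc.stronglyMeasurableAtFilter volume _) hc.continuousAt
    have hq := hI.div (hasDerivAt_pow n r) (pow_pos hr n).ne'
    have hE : (fun r => avg n F r l) =ᶠ[𝓝 r] (fun r => (∫ t in (0:ℝ)..r, t ^ (n - 1) * F t l) / r ^ n) := by
      filter_upwards [eventually_gt_nhds hr] with s hs
      rw [← avg_eq n hn, mul_div_cancel_left₀ _ (pow_pos hs n).ne']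
    refine (hq.congr_of_eventuallyEq hE).congr_deriv ?_
    rw [← avg_eq n hn]
    have : F r l = (l - N / (1 + r ^ 2) ^ 2) * u r l := by
      simp only [hF, qf, clp_eq h0 h1]
    rw [this]
    obtain ⟨m, rfl⟩ : ∃ m, n = m + 1 := ⟨n - 1, by omega⟩
    simp only [Nat.add_sub_cancel]
    field_simp
    ring
  · intro l h0 h1
    simp only [avg, zero_mul, intervalIntegral.integral_mul_const, integral_pow]
    have : F 0 l = l - N := by
      simp [hF, qf, clp_eq h0 h1, hu0]
    rw [this]
    obtain ⟨m, rfl⟩ : ∃ m, n = m + 1 := ⟨n - 1, by omega⟩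
    simp
    field_simp

/-- Radial solution data. -/
structure RadSol (n : ℕ) (N l : ℝ) (u g : ℝ → ℝ) : Prop where
  gc : Continuous g
  u0 : u 0 = 1
  du : ∀ r, HasDerivAt u (r * g r) r
  dg : ∀ r, 0 < r → HasDerivAt g (((l - N / (1 + r ^ 2) ^ 2) * u r - n * g r) / r) r
  g0 : n * g 0 = l - N

lemma RadSol.uc {n : ℕ} {N l : ℝ} {u g : ℝ → ℝ} (h : RadSol n N l u g) : Continuous u :=
  continuous_iff_continuousAt.2 fun r => (h.du r).continuousAt

lemma RadSol.dP {n : ℕ} (hn : 1 ≤ n) {N l : ℝ} {u g : ℝ → ℝ} (h : RadSol n N l u g) {r : ℝ}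
    (hr : 0 < r) : HasDerivAt (fun r => r ^ n * g r)
      (r ^ (n - 1) * ((l - N / (1 + r ^ 2) ^ 2) * u r)) r := by
  refine ((hasDerivAt_pow n r).mul (h.dg r hr)).congr_deriv ?_
  obtain ⟨m, rfl⟩ : ∃ m, n = m + 1 := ⟨n - 1, by omega⟩
  simp only [Nat.add_sub_cancel]
  generalize (l - N / (1 + r ^ 2) ^ 2) * u r = X
  field_simp
  ring

lemma RadSol.pos {n : ℕ} (hn : 1 ≤ n) {N l : ℝ} {u g : ℝ → ℝ} (h : RadSol n N l u g) {r₁ : ℝ}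
    (hr : 0 ≤ r₁) (hu : 0 < u r₁) (hg : 0 ≤ r₁ ^ n * g r₁)
    (hq : ∀ r, r₁ ≤ r → 0 ≤ l - N / (1 + r ^ 2) ^ 2) : ∀ r, r₁ ≤ r → 0 < u r := by
  by_contra! hcon
  obtain ⟨r₂, h12, h2⟩ := hcon
  set A := {r : ℝ | r₁ ≤ r ∧ u r ≤ 0} with hA
  have hAc : IsClosed A := (isClosed_le continuous_const continuous_id).inter
    (isClosed_le h.uc continuous_const)
  have hAb : BddBelow A := ⟨r₁, fun r hr => hr.1⟩
  have hmem : sInf A ∈ A := hAc.csInf_mem ⟨r₂, h12, h2⟩ hAb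
  set s := sInf A with hs
  have hpos : ∀ r, r₁ ≤ r → r < s → 0 < u r := by
    intro r hr1 hr2
    by_contra! hc
    exact absurd (csInf_le hAb (show r ∈ A from ⟨hr1, hc⟩)) (not_le.2 hr2)
  have hP : MonotoneOn (fun r => r ^ n * g r) (Icc r₁ s) := by
    refine monotoneOn_of_hasDerivWithinAt_nonneg (f' := fun r => r ^ (n - 1) * ((l - N / (1 + r ^ 2) ^ 2) * u r))
      (convex_Icc _ _) ((continuous_pow n).mul h.gc).continuousOn ?_ ?_
    · intro x hx
      rw [interior_Icc] at hx
      exact (h.dP hn (hr.trans_lt hx.1)).hasDerivWithinAt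
    · intro x hx
      rw [interior_Icc] at hx
      exact mul_nonneg (pow_nonneg (hr.trans hx.1.le) _) (mul_nonneg (hq x hx.1.le) (hpos x hx.1.le hx.2).le)
  have hmu : MonotoneOn u (Icc r₁ s) := by
    refine monotoneOn_of_hasDerivWithinAt_nonneg (f' := fun r => r * g r)
      (convex_Icc _ _) h.uc.continuousOn (fun x _ => (h.du x).hasDerivWithinAt) ?_
    intro x hx
    rw [interior_Icc] at hx
    have hx0 : 0 < x := hr.trans_lt hx.1
    have := hP (left_mem_Icc.2 hmem.1) ⟨hx.1.le, hx.2.le⟩ hx.1.le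
    have h3 : 0 ≤ x ^ n * g x := hg.trans this
    have h4 : 0 ≤ g x := nonneg_of_mul_nonneg_right h3 (pow_pos hx0 n)
    positivity
  have := hmu (left_mem_Icc.2 hmem.1) (right_mem_Icc.2 hmem.1) hmem.1
  linarith [hmem.2]

lemma RadSol.strict {n : ℕ} {N l : ℝ} (hN : 0 ≤ N) (hl : 0 ≤ l) {u g : ℝ → ℝ}
    (h : RadSol n N l u g)
    (hu : ∀ r, 0 ≤ r → 0 ≤ u r) : ∀ r, 0 ≤ r → 0 < u r := by
  intro r₁ hr₁
  rcases hr₁.eq_or_lt with rfl | hr₁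
  · rw [h.u0]; exact one_pos
  refine lt_of_le_of_ne (hu r₁ hr₁.le) fun h0 => ?_
  have hmin : IsLocalMin u r₁ := by
    filter_upwards [eventually_gt_nhds hr₁] with r hr
    rw [← h0]; exact hu r hr.le
  have hg0 : g r₁ = 0 := by
    have := hmin.hasDerivAt_eq_zero (h.du r₁)
    rcases mul_eq_zero.1 this with h1 | h1
    · exact absurd h1 hr₁.ne'
    · exact h1
  have key : ∀ ρ, 0 < ρ → ρ < r₁ → u ρ = 0 := by
    intro ρ hρ hρ1
    set K := r₁ + (l + N) / ρ + 2 * n / ρ with hK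
    have hm : MonotoneOn (fun r => (u r ^ 2 + g r ^ 2) * Real.exp (K * r)) (Icc ρ r₁) := by
      have hd : ∀ x, 0 < x → HasDerivAt (fun r => (u r ^ 2 + g r ^ 2) * Real.exp (K * r))
          ((2 * u x * (x * g x) + 2 * g x * (((l - N / (1 + x ^ 2) ^ 2) * u x - n * g x) / x) +
            K * (u x ^ 2 + g x ^ 2)) * Real.exp (K * x)) x := by
        intro x hx
        have h1 := (((h.du x).pow 2).add ((h.dg x hx).pow 2)).mul
          (((hasDerivAt_id x).const_mul K).exp)
        refine h1.congr_deriv ?_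
        simp
        ring
      refine monotoneOn_of_hasDerivWithinAt_nonneg (f' := fun x => ((2 * u x * (x * g x) + 2 * g x * (((l - N / (1 + x ^ 2) ^ 2) * u x - n * g x) / x) +
            K * (u x ^ 2 + g x ^ 2)) * Real.exp (K * x)))
        (convex_Icc _ _) ?_ ?_ ?_
      · have := h.uc; have := h.gc; fun_prop
      · intro x hx
        rw [interior_Icc] at hx
        exact (hd x (hρ.trans hx.1)).hasDerivWithinAt
      · intro x hx
        rw [interior_Icc] at hx
        have hx0 := hρ.trans hx.1
        refine mul_nonneg ?_ (Real.exp_pos _).le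
        set q := l - N / (1 + x ^ 2) ^ 2 with hq
        have hqb : |q| ≤ l + N := by
          have h1 : 0 ≤ N / (1 + x ^ 2) ^ 2 := by positivity
          have h2 : N / (1 + x ^ 2) ^ 2 ≤ N := by
            apply div_le_self hN
            nlinarith [sq_nonneg x]
          rw [abs_le]; constructor <;> linarith
        set a := u x
        set b := g x
        have e : 2 * a * (x * b) + 2 * b * ((q * a - n * b) / x) + K * (a ^ 2 + b ^ 2)
          = (x * (2 * a * b) + r₁ * (a ^ 2 + b ^ 2))
            + (q / x * (2 * a * b) + (l + N) / ρ * (a ^ 2 + b ^ 2))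
            + (2 * n / ρ * a ^ 2 + (2 * n / ρ - 2 * n / x) * b ^ 2) := by
          rw [hK]; field_simp; ring
        rw [e]
        have hab : |2 * a * b| ≤ a ^ 2 + b ^ 2 := by
          rw [abs_le]; constructor <;> nlinarith [sq_nonneg (a + b), sq_nonneg (a - b)]
        have gen : ∀ c d : ℝ, |c| ≤ d → 0 ≤ c * (2 * a * b) + d * (a ^ 2 + b ^ 2) := by
          intro c d hcd
          have h1 : |c * (2 * a * b)| ≤ d * (a ^ 2 + b ^ 2) := by
            rw [abs_mul]
            exact mul_le_mul hcd hab (abs_nonneg _) ((abs_nonneg _).trans hcd)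
          linarith [(abs_le.1 h1).1]
        have t1 := gen x r₁ (by rw [abs_of_pos hx0]; exact hx.2.le)
        have t2 := gen (q / x) ((l + N) / ρ) (by
          rw [abs_div, abs_of_pos hx0]
          exact div_le_div₀ (by linarith) hqb hρ hx.1.le)
        have t3 : 2 * (n:ℝ) / x ≤ 2 * n / ρ :=
          div_le_div_of_nonneg_left (by positivity) hρ hx.1.le
        have t4 : 0 ≤ 2 * n / ρ * a ^ 2 := by positivity
        have t5 : 0 ≤ (2 * n / ρ - 2 * n / x) * b ^ 2 := mul_nonneg (by linarith) (sq_nonneg _)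
        linarith
    have h2 := hm (left_mem_Icc.2 hρ1.le) (right_mem_Icc.2 hρ1.le) hρ1.le
    simp only [← h0, hg0] at h2
    have h3 : (u ρ ^ 2 + g ρ ^ 2) ≤ 0 := by
      by_contra! hc
      have : 0 < (u ρ ^ 2 + g ρ ^ 2) * Real.exp (K * ρ) := mul_pos hc (Real.exp_pos _)
      simp at h2
      linarith
    have : u ρ ^ 2 = 0 := le_antisymm (by nlinarith [sq_nonneg (g ρ)]) (sq_nonneg _)
    exact pow_eq_zero_iff (two_ne_zero) |>.1 this
  have ht : Tendsto u (𝓝[>] 0) (𝓝 (u 0)) := (h.uc.tendsto 0).mono_left nhdsWithin_le_nhds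
  have ht2 : Tendsto u (𝓝[>] 0) (𝓝 0) := by
    refine tendsto_const_nhds.congr' ?_
    filter_upwards [Ioo_mem_nhdsGT hr₁] with r hr
    exact (key r hr.1 hr.2).symm
  have := tendsto_nhds_unique ht ht2
  rw [h.u0] at this
  exact one_ne_zero this

/-- At `l = 0` the solution takes a negative value. -/
lemma RadSol.neg {n : ℕ} (hn : 1 ≤ n) {u g : ℝ → ℝ} (h : RadSol n ((n:ℝ) * (n + 2)) 0 u g) :
    ∃ r, 0 ≤ r ∧ u r < 0 := by
  by_contra! hcon
  have hpos := h.strict (by positivity) le_rfl hcon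
  -- explicit solution
  set Z : ℝ → ℝ := fun r => (1 - r ^ 2) * (1 + r ^ 2) ^ (-(n:ℝ) / 2) with hZ
  set Z1 : ℝ → ℝ := fun r => (-(n + 2) + (n - 2) * r ^ 2) * (1 + r ^ 2) ^ (-(n:ℝ) / 2 - 1) with hZ1
  have hb : ∀ r : ℝ, 0 < 1 + r ^ 2 := fun r => by positivity
  have hbd : ∀ r : ℝ, HasDerivAt (fun r : ℝ => 1 + r ^ 2) (2 * r) r := fun r => by
    simpa using (hasDerivAt_pow 2 r).const_add 1
  have hpw : ∀ r : ℝ, (1 + r ^ 2) ^ (-(n:ℝ) / 2) = (1 + r ^ 2) ^ (-(n:ℝ) / 2 - 2) * (1 + r ^ 2) ^ 2 := by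
    intro r
    rw [← Real.rpow_natCast (1 + r ^ 2) 2, ← Real.rpow_add (hb r)]; norm_num
  have hpw1 : ∀ r : ℝ, (1 + r ^ 2) ^ (-(n:ℝ) / 2 - 1) = (1 + r ^ 2) ^ (-(n:ℝ) / 2 - 2) * (1 + r ^ 2) := by
    intro r
    nth_rewrite 3 [← Real.rpow_one (1 + r ^ 2)]
    rw [← Real.rpow_add (hb r)]; congr 1; ring
  have dZ : ∀ r, HasDerivAt Z (r * Z1 r) r := by
    intro r
    have h1 := (((hasDerivAt_pow 2 r).const_sub 1)).mul ((hbd r).rpow_const (p := -(n:ℝ)/2) (Or.inl (hb r).ne'))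
    refine h1.congr_deriv ?_
    simp only [hZ1]
    rw [hpw1, hpw]
    push_cast
    ring
  have dZ1 : ∀ r, HasDerivAt Z1 (r * ((2 * (n - 2)) * (1 + r ^ 2) + (-(n:ℝ) - 2) * (-(n + 2) + (n - 2) * r ^ 2)) * (1 + r ^ 2) ^ (-(n:ℝ) / 2 - 2)) r := by
    intro r
    have h1 := (((hasDerivAt_pow 2 r).const_mul ((n:ℝ) - 2)).const_add (-((n:ℝ) + 2))).mul ((hbd r).rpow_const (p := -(n:ℝ)/2 - 1) (Or.inl (hb r).ne'))
    refine h1.congr_deriv ?_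
    rw [hpw1, show -(n:ℝ) / 2 - 1 - 1 = -(n:ℝ) / 2 - 2 by ring]
    push_cast
    ring
  -- Wronskian
  set W : ℝ → ℝ := fun r => r ^ n * (u r * Z1 r - g r * Z r) with hW
  have dW : ∀ r, 0 < r → HasDerivAt W 0 r := by
    intro r hr
    have h1 := (hasDerivAt_pow n r).mul (((h.du r).mul (dZ1 r)).sub ((h.dg r hr).mul (dZ r)))
    refine h1.congr_deriv ?_
    simp only [hZ, hZ1, Pi.mul_apply, Pi.sub_apply]
    rw [hpw1, hpw]
    generalize (1 + r ^ 2) ^ (-(n:ℝ) / 2 - 2) = X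
    obtain ⟨m, rfl⟩ : ∃ m, n = m + 1 := ⟨n - 1, by omega⟩
    have := (hb r).ne'
    simp only [Nat.add_sub_cancel]
    push_cast
    field_simp
    ring
  have hZc : Continuous Z := continuous_iff_continuousAt.2 fun r => (dZ r).continuousAt
  have hZ1c : Continuous Z1 := continuous_iff_continuousAt.2 fun r => (dZ1 r).continuousAt
  have hWc : Continuous W := by
    have := h.uc; have := h.gc
    simp only [hW]; fun_prop
  have W0 : ∀ r, 0 ≤ r → W r = 0 := by
    intro r hr
    rcases hr.eq_or_lt with rfl | hr
    · simp [hW, show n ≠ 0 by omega]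
    · have hm1 : MonotoneOn W (Icc 0 r) := monotoneOn_of_hasDerivWithinAt_nonneg (f' := fun _ => 0)
        (convex_Icc _ _) hWc.continuousOn (fun x hx => by
          rw [interior_Icc] at hx; exact (dW x hx.1).hasDerivWithinAt) (fun _ _ => le_rfl)
      have hm2 : AntitoneOn W (Icc 0 r) := antitoneOn_of_hasDerivWithinAt_nonpos (f' := fun _ => 0)
        (convex_Icc _ _) hWc.continuousOn (fun x hx => by
          rw [interior_Icc] at hx; exact (dW x hx.1).hasDerivWithinAt) (fun _ _ => le_rfl)
      have e1 := hm1 (left_mem_Icc.2 hr.le) (right_mem_Icc.2 hr.le) hr.le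
      have e2 := hm2 (left_mem_Icc.2 hr.le) (right_mem_Icc.2 hr.le) hr.le
      have : W 0 = 0 := by simp [hW, show n ≠ 0 by omega]
      linarith
  have hcst : MonotoneOn (fun r => Z r / u r) (Icc 0 2) := by
    refine monotoneOn_of_hasDerivWithinAt_nonneg (f' := fun _ => 0) (convex_Icc _ _)
      (hZc.continuousOn.div h.uc.continuousOn fun x hx => (hpos x hx.1).ne') ?_ (fun _ _ => le_rfl)
    intro x hx
    rw [interior_Icc] at hx
    refine (((dZ x).div (h.du x) (hpos x hx.1.le).ne').congr_deriv ?_).hasDerivWithinAt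
    have h1 := W0 x hx.1.le
    simp only [hW] at h1
    have h2 : u x * Z1 x - g x * Z x = 0 := by
      rcases mul_eq_zero.1 h1 with h3 | h3
      · exact absurd h3 (pow_pos hx.1 n).ne'
      · exact h3
    rw [div_eq_zero_iff]; left
    linear_combination x * h2
  have h2 := hcst (left_mem_Icc.2 zero_le_two) (right_mem_Icc.2 zero_le_two) zero_le_two
  have e0 : Z 0 = 1 := by simp [hZ]
  simp only [e0, h.u0] at h2
  have h3 : Z 2 < 0 := by
    simp only [hZ]
    apply mul_neg_of_neg_of_pos (by norm_num) (Real.rpow_pos_of_pos (hb 2) _)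
  have h4 : Z 2 / u 2 < 0 := div_neg_of_neg_of_pos h3 (hpos 2 zero_le_two)
  linarith

theorem shoot (n : ℕ) (hn : 1 ≤ n) : ∃ lam0 : ℝ, 0 < lam0 ∧ ∃ u g : ℝ → ℝ,
    RadSol n ((n:ℝ) * (n + 2)) lam0 u g ∧ (∀ r, 0 ≤ r → 0 < u r) ∧ ∃ C, ∀ r, 0 ≤ r → u r ≤ C := by
  set N : ℝ := (n:ℝ) * (n + 2) with hNdef
  have hn' : (0:ℝ) < n := by exact_mod_cast hn
  have hN : 0 < N := by positivity
  obtain ⟨u, g, huc, hgc, hu0, hdu, hdg, hg0⟩ := ode_package n hn hN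
  have sol : ∀ l, 0 ≤ l → l ≤ N → RadSol n N l (fun r => u r l) (fun r => g r l) := fun l h0 h1 =>
    ⟨hgc.comp (f := fun r : ℝ => (r, l)) (by fun_prop), hu0 l, fun r => hdu r l,
      fun r hr => hdg r l h0 h1 hr, hg0 l h0 h1⟩
  have hul : ∀ r, Continuous (fun l => u r l) := fun r =>
    huc.comp (f := fun l : ℝ => (r, l)) (by fun_prop)
  have hgl : ∀ r, Continuous (fun l => g r l) := fun r =>
    hgc.comp (f := fun l : ℝ => (r, l)) (by fun_prop)
  set S := {l : ℝ | 0 ≤ l ∧ l ≤ N ∧ ∃ r, 0 ≤ r ∧ u r l < 0} with hS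
  have h0S : (0:ℝ) ∈ S := ⟨le_rfl, hN.le, (sol 0 le_rfl hN.le).neg hn⟩
  have hNS : N ∉ S := by
    rintro ⟨_, _, r, hr, hur⟩
    have := (sol N hN.le le_rfl).pos hn (r₁ := 0) le_rfl (by simp [hu0])
      (by simp [show n ≠ 0 by omega]) (by
        intro x _
        have : N / (1 + x ^ 2) ^ 2 ≤ N := by
          apply div_le_self hN.le
          nlinarith [sq_nonneg x]
        linarith) r hr
    linarith
  have hop : ∀ l ∈ S, ∃ l' ∈ S, l < l' := by
    intro l hl
    have hlN : l < N := lt_of_le_of_ne hl.2.1 fun e => hNS (e ▸ hl)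
    obtain ⟨r, hr, hur⟩ := hl.2.2
    have : ∀ᶠ x in 𝓝[>] l, u r x < 0 :=
      ((hul r).tendsto l).eventually (eventually_lt_nhds hur) |>.filter_mono nhdsWithin_le_nhds
    obtain ⟨x, hx1, hx2⟩ := (this.and (Ioo_mem_nhdsGT hlN)).exists
    exact ⟨x, ⟨hl.1.trans hx2.1.le, hx2.2.le, r, hr, hx1⟩, hx2.1⟩
  have hbdd : BddAbove S := ⟨N, fun l hl => hl.2.1⟩
  set L := sSup S with hL
  have hLpos : 0 < L := by
    obtain ⟨l', hl', h⟩ := hop 0 h0S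
    exact h.trans_le (le_csSup hbdd hl')
  have hLN : L ≤ N := csSup_le ⟨0, h0S⟩ fun l hl => hl.2.1
  have hLS : L ∉ S := fun h => by
    obtain ⟨l', hl', h⟩ := hop L h
    exact absurd (le_csSup hbdd hl') (not_le.2 h)
  have hsol := sol L hLpos.le hLN
  have hnn : ∀ r, 0 ≤ r → 0 ≤ u r L := by
    intro r hr
    by_contra! hc
    exact hLS ⟨hLpos.le, hLN, r, hr, hc⟩
  have hpos : ∀ r, 0 ≤ r → 0 < u r L := hsol.strict hN.le hLpos.le hnn
  refine ⟨L, hLpos, _, _, hsol, hpos, ?_⟩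
  -- eventually nonincreasing
  set R := Real.sqrt (2 * N / L) with hR
  have hV : ∀ r, R ≤ r → N / (1 + r ^ 2) ^ 2 ≤ L / 2 := by
    intro r hr
    have h1 : 2 * N / L ≤ r ^ 2 := by
      have h2 : R ^ 2 = 2 * N / L := Real.sq_sqrt (by positivity)
      rw [← h2]
      exact pow_le_pow_left₀ (Real.sqrt_nonneg _) hr 2
    rw [div_le_iff₀ (by positivity)]
    rw [div_le_iff₀ hLpos] at h1
    nlinarith [sq_nonneg (r^2), sq_nonneg r]
  have hR0 : 0 < R := Real.sqrt_pos.2 (by positivity)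
  have hdec : ∀ r, R ≤ r → g r L ≤ 0 := by
    intro r hr
    by_contra! hc
    have hr0 : 0 < r := hR0.trans_le hr
    have e1 : ∀ᶠ l in 𝓝 L, 0 < g r l := ((hgl r).tendsto L).eventually (eventually_gt_nhds hc)
    have e2 : ∀ᶠ l in 𝓝 L, ∀ x ∈ Icc 0 r, 0 < u x l := by
      refine isCompact_Icc.eventually_forall_of_forall_eventually fun x hx => ?_
      have : Tendsto (fun z : ℝ × ℝ => u z.2 z.1) (𝓝 (L, x)) (𝓝 (u x L)) :=
        (huc.comp (f := fun z : ℝ × ℝ => (z.2, z.1)) (by fun_prop)).tendsto (L, x)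
      exact this.eventually (eventually_gt_nhds (hpos x hx.1))
    have e3 : ∀ᶠ l in 𝓝 L, L / 2 < l := eventually_gt_nhds (by linarith)
    obtain ⟨a, b, hab, hsub⟩ := (mem_nhds_iff_exists_Ioo_subset.1 (e1.and (e2.and e3)))
    obtain ⟨l, hlS, hal⟩ := exists_lt_of_lt_csSup ⟨0, h0S⟩ hab.1
    obtain ⟨k1, k2, k3⟩ := hsub (show l ∈ Ioo a b from ⟨hal, (le_csSup hbdd hlS).trans_lt hab.2⟩)
    obtain ⟨h0, h1, x, hx, hux⟩ := hlS
    rcases le_total x r with hxr | hxr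
    · exact absurd (k2 x ⟨hx, hxr⟩) (not_lt.2 hux.le)
    · have := (sol l h0 h1).pos hn (r₁ := r) hr0.le (k2 r ⟨hr0.le, le_rfl⟩)
        (mul_nonneg (pow_nonneg hr0.le _) k1.le)
        (fun y hy => by have := hV y (hr.trans hy); linarith) x hxr
      linarith
  have hanti : AntitoneOn (fun r => u r L) (Ici R) := by
    refine antitoneOn_of_hasDerivWithinAt_nonpos (f' := fun r => r * g r L)
      (convex_Ici _) hsol.uc.continuousOn (fun x _ => (hsol.du x).hasDerivWithinAt) ?_
    intro x hx
    rw [interior_Ici] at hx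
    exact mul_nonpos_of_nonneg_of_nonpos (hR0.le.trans (le_of_lt hx)) (hdec x (le_of_lt hx))
  obtain ⟨C, hC⟩ := (isCompact_Icc (a := (0:ℝ)) (b := R)).bddAbove_image hsol.uc.continuousOn
  refine ⟨C, fun r hr => ?_⟩
  rcases le_total r R with h | h
  · exact hC (mem_image_of_mem _ ⟨hr, h⟩)
  · exact (hanti self_mem_Ici h h).trans (hC (mem_image_of_mem _ ⟨hR0.le, le_rfl⟩))

/-- `w` has (strong enough) Laplacian `L` at `y`. -/
def HL {n : ℕ} (w : EuclideanSpace ℝ (Fin n) → ℝ) (y : EuclideanSpace ℝ (Fin n)) (L : ℝ) : Prop :=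
  ∃ (Dw : EuclideanSpace ℝ (Fin n) → EuclideanSpace ℝ (Fin n) →L[ℝ] ℝ)
    (D : Fin n → EuclideanSpace ℝ (Fin n) →L[ℝ] ℝ),
    (∀ᶠ z in 𝓝 y, HasFDerivAt w (Dw z) z) ∧
    (∀ i, HasFDerivAt (fun z => Dw z (EuclideanSpace.single i 1)) (D i) y) ∧
    ∑ i, D i (EuclideanSpace.single i 1) = L

section HLsec
variable {n : ℕ} {w v : EuclideanSpace ℝ (Fin n) → ℝ} {y : EuclideanSpace ℝ (Fin n)} {L M : ℝ}

lemma HL.lap_eq (h : HL w y L) : lap w y = L := by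
  obtain ⟨Dw, D, h1, h2, rfl⟩ := h
  unfold lap
  refine Finset.sum_congr rfl fun i _ => ?_
  have : (fun z => fderiv ℝ w z (EuclideanSpace.single i 1)) =ᶠ[𝓝 y]
      fun z => Dw z (EuclideanSpace.single i 1) := by
    filter_upwards [h1] with z hz
    rw [hz.fderiv]
  rw [((h2 i).congr_of_eventuallyEq this).fderiv]

lemma HL.add (h : HL w y L) (k : HL v y M) : HL (fun z => w z + v z) y (L + M) := by
  obtain ⟨Dw, D, h1, h2, rfl⟩ := h
  obtain ⟨Dv, F, k1, k2, rfl⟩ := k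
  refine ⟨fun z => Dw z + Dv z, fun i => D i + F i, ?_, fun i => ?_, ?_⟩
  · filter_upwards [h1, k1] with z a b using a.add b
  · exact (h2 i).add (k2 i)
  · simp [Finset.sum_add_distrib]

lemma HL.const_mul (c : ℝ) (h : HL w y L) : HL (fun z => c * w z) y (c * L) := by
  obtain ⟨Dw, D, h1, h2, rfl⟩ := h
  refine ⟨fun z => c • Dw z, fun i => c • D i, ?_, fun i => ?_, ?_⟩
  · filter_upwards [h1] with z a using a.const_mul c
  · simpa using (h2 i).const_mul c
  · simp [Finset.mul_sum]

lemma HL.neg (h : HL w y L) : HL (fun z => - w z) y (-L) := by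
  simpa using h.const_mul (-1)

lemma HL.sub (h : HL w y L) (k : HL v y M) : HL (fun z => w z - v z) y (L - M) := by
  simpa [sub_eq_add_neg] using h.add k.neg

lemma HL.congr (h : HL w y L) (e : v =ᶠ[𝓝 y] w) : HL v y L := by
  obtain ⟨Dw, D, h1, h2, rfl⟩ := h
  refine ⟨Dw, D, ?_, h2, rfl⟩
  filter_upwards [h1, e.eventuallyEq_nhds] with z a b using a.congr_of_eventuallyEq b

lemma HL.of_eq (h : HL w y L) (e : L = M) : HL w y M := e ▸ h

lemma HL.const (c : ℝ) : HL (fun _ : EuclideanSpace ℝ (Fin n) => c) y 0 :=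
  ⟨fun _ => 0, fun _ => 0, Eventually.of_forall fun z => hasFDerivAt_const c z,
    fun i => by simpa using hasFDerivAt_const (0:ℝ) y, by simp⟩

lemma HL.of_contDiff (h : ContDiff ℝ 2 w) : HL w y (lap w y) := by
  refine ⟨fderiv ℝ w, _, Eventually.of_forall fun z =>
    (h.differentiable (by norm_num) z).hasFDerivAt, fun i => ?_, rfl⟩
  have h1 : ContDiff ℝ 1 (fderiv ℝ w) := h.fderiv_right (by norm_num)
  have h2 : Differentiable ℝ (fun z => fderiv ℝ w z (EuclideanSpace.single i (1:ℝ))) :=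
    (h1.clm_apply contDiff_const).differentiable (by norm_num)
  exact (h2 y).hasFDerivAt

lemma HL.nonpos (h : HL w y L) (hm : IsLocalMax w y) : L ≤ 0 := by
  obtain ⟨Dw, D, h1, h2, rfl⟩ := h
  refine Finset.sum_nonpos fun i _ => ?_
  by_contra! hc
  set e : EuclideanSpace ℝ (Fin n) := EuclideanSpace.single i 1 with he
  set G : ℝ → EuclideanSpace ℝ (Fin n) := fun s => y + s • e with hG
  have hGd : ∀ s, HasDerivAt G e s := fun s => by
    have := ((hasDerivAt_id s).smul_const e).const_add y
    rw [one_smul] at this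
    exact this
  have hG0 : G 0 = y := by simp [hG]
  have hGt : Tendsto G (𝓝 0) (𝓝 y) := by
    have := (hGd 0).continuousAt.tendsto; rwa [hG0] at this
  have d1 : ∀ᶠ s in 𝓝 (0:ℝ), HasDerivAt (fun s => w (G s)) (Dw (G s) e) s := by
    filter_upwards [hGt.eventually h1] with s hs
    exact hs.comp_hasDerivAt s (hGd s)
  have d2 : HasDerivAt (fun s => Dw (G s) e) (D i e) 0 := by
    have := h2 i
    rw [← hG0] at this
    exact this.comp_hasDerivAt 0 (hGd 0)
  have dd : deriv (fun s => w (G s)) =ᶠ[𝓝 0] fun s => Dw (G s) e := by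
    filter_upwards [d1] with s hs using hs.deriv
  have hmax : IsLocalMax (fun s => w (G s)) 0 := by
    have := hGt.eventually hm
    filter_upwards [this] with s hs
    simpa [hG0] using hs
  have hd2 : deriv (deriv (fun s => w (G s))) 0 = D i e := by
    rw [dd.deriv_eq, d2.deriv]
  have hmin := isLocalMin_of_deriv_deriv_pos (f := fun s => w (G s)) (x₀ := 0) (by rw [hd2]; exact hc)
    hmax.deriv_eq_zero d1.self_of_nhds.continuousAt
  have hcst : (fun s => w (G s)) =ᶠ[𝓝 0] fun _ => w (G 0) := by
    filter_upwards [hmax, hmin] with s a b using le_antisymm a b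
  have : deriv (deriv (fun s => w (G s))) 0 = 0 := by
    have h3 := hcst.deriv
    rw [h3.deriv_eq]
    simp
  linarith [hd2 ▸ this]

/-- Laplacian of `a(⟪e,y⟫) f(‖y‖²)`. -/
lemma HL.prod (e : EuclideanSpace ℝ (Fin n)) {a a1 f f1 : ℝ → ℝ} {a2 f2 : ℝ}
    (ha : ∀ᶠ t in 𝓝 (inner ℝ e y), HasDerivAt a (a1 t) t)
    (ha1 : HasDerivAt a1 a2 (inner ℝ e y))
    (hf : ∀ᶠ t in 𝓝 (‖y‖ ^ 2), HasDerivAt f (f1 t) t)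
    (hf1 : HasDerivAt f1 f2 (‖y‖ ^ 2)) :
    HL (fun z => a (inner ℝ e z) * f (‖z‖ ^ 2)) y
      (‖e‖ ^ 2 * a2 * f (‖y‖ ^ 2) + 4 * a1 (inner ℝ e y) * f1 (‖y‖ ^ 2) * inner ℝ e y
        + a (inner ℝ e y) * (4 * ‖y‖ ^ 2 * f2 + 2 * n * f1 (‖y‖ ^ 2))) := by
  have hl : ∀ z : EuclideanSpace ℝ (Fin n), HasFDerivAt (fun z => inner ℝ e z) (innerSL ℝ e) z :=
    fun z => (innerSL ℝ e).hasFDerivAt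
  have hs : ∀ z : EuclideanSpace ℝ (Fin n), HasFDerivAt (fun z => ‖z‖ ^ 2) (2 • innerSL ℝ z) z :=
    fun z => (hasStrictFDerivAt_norm_sq z).hasFDerivAt
  have tl : Tendsto (fun z => inner ℝ e z) (𝓝 y) (𝓝 (inner ℝ e y)) := (hl y).continuousAt
  have ts : Tendsto (fun z : EuclideanSpace ℝ (Fin n) => ‖z‖ ^ 2) (𝓝 y) (𝓝 (‖y‖ ^ 2)) :=
    (hs y).continuousAt
  have hyi : ∀ i, HasFDerivAt (fun z : EuclideanSpace ℝ (Fin n) => z i)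
      (EuclideanSpace.proj i : EuclideanSpace ℝ (Fin n) →L[ℝ] ℝ) y := fun i =>
    (EuclideanSpace.proj i : EuclideanSpace ℝ (Fin n) →L[ℝ] ℝ).hasFDerivAt
  refine ⟨fun z => a (inner ℝ e z) • (f1 (‖z‖ ^ 2) • (2 • innerSL ℝ z)) +
    f (‖z‖ ^ 2) • (a1 (inner ℝ e z) • innerSL ℝ e), fun i =>
      (a (inner ℝ e y) • (f1 (‖y‖ ^ 2) • ((2:ℝ) • (EuclideanSpace.proj i : EuclideanSpace ℝ (Fin n) →L[ℝ] ℝ))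
         + (2 * y i) • (f2 • (2 • innerSL ℝ y))) +
        (f1 (‖y‖ ^ 2) * (2 * y i)) • (a1 (inner ℝ e y) • innerSL ℝ e)) +
      (f (‖y‖ ^ 2) • (e i • (a2 • innerSL ℝ e)) +
        (a1 (inner ℝ e y) * e i) • (f1 (‖y‖ ^ 2) • (2 • innerSL ℝ y))), ?_, ?_, ?_⟩
  · filter_upwards [tl.eventually ha, ts.eventually hf] with z h1 h2
    exact (h1.comp_hasFDerivAt z (hl z)).mul (h2.comp_hasFDerivAt z (hs z))
  · intro i
    have A := ha.self_of_nhds.comp_hasFDerivAt y (hl y)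
    have A1 := ha1.comp_hasFDerivAt y (hl y)
    have Fd := hf.self_of_nhds.comp_hasFDerivAt y (hs y)
    have F1 := hf1.comp_hasFDerivAt y (hs y)
    have key := (A.mul (F1.mul ((hyi i).const_mul (2:ℝ)))).add (Fd.mul (A1.mul_const (e i)))
    have efun : (fun z => (a (inner ℝ e z) • (f1 (‖z‖ ^ 2) • (2 • innerSL ℝ z)) +
      f (‖z‖ ^ 2) • (a1 (inner ℝ e z) • innerSL ℝ e)) (EuclideanSpace.single i (1:ℝ))) =
      fun z : EuclideanSpace ℝ (Fin n) => a (inner ℝ e z) * (f1 (‖z‖ ^ 2) * (2 * z i)) + f (‖z‖ ^ 2) * (a1 (inner ℝ e z) * e i) := by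
      funext z
      simp [EuclideanSpace.inner_single_right]
    rw [efun]
    exact key
  · have hsum1 : ∑ i, y i * y i = ‖y‖ ^ 2 := by
      rw [EuclideanSpace.norm_sq_eq]; simp [sq]
    have hsum2 : ∑ i, e i * e i = ‖e‖ ^ 2 := by
      rw [EuclideanSpace.norm_sq_eq]; simp [sq]
    have hsum3 : ∑ i, e i * y i = inner ℝ e y := by
      simp [PiLp.inner_apply, mul_comm]
    have ht : ∀ i : Fin n, ((a (inner ℝ e y) • (f1 (‖y‖ ^ 2) • ((2:ℝ) • (EuclideanSpace.proj i : EuclideanSpace ℝ (Fin n) →L[ℝ] ℝ))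
         + (2 * y i) • (f2 • (2 • innerSL ℝ y))) +
        (f1 (‖y‖ ^ 2) * (2 * y i)) • (a1 (inner ℝ e y) • innerSL ℝ e)) +
      (f (‖y‖ ^ 2) • (e i • (a2 • innerSL ℝ e)) +
        (a1 (inner ℝ e y) * e i) • (f1 (‖y‖ ^ 2) • (2 • innerSL ℝ y)))) (EuclideanSpace.single i (1:ℝ))
        = a (inner ℝ e y) * f1 (‖y‖ ^ 2) * 2 + (4 * a (inner ℝ e y) * f2) * (y i * y i)
          + (4 * f1 (‖y‖ ^ 2) * a1 (inner ℝ e y)) * (e i * y i)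
          + (f (‖y‖ ^ 2) * a2) * (e i * e i) := by
      intro i
      simp [EuclideanSpace.inner_single_right]
      ring
    rw [Finset.sum_congr rfl fun i _ => ht i]
    simp only [Finset.sum_add_distrib, ← Finset.mul_sum, hsum1, hsum2, hsum3]
    simp
    ring

lemma HL.radial {f f1 : ℝ → ℝ} {f2 : ℝ}
    (hf : ∀ᶠ t in 𝓝 (‖y‖ ^ 2), HasDerivAt f (f1 t) t)
    (hf1 : HasDerivAt f1 f2 (‖y‖ ^ 2)) :
    HL (fun z => f (‖z‖ ^ 2)) y (4 * ‖y‖ ^ 2 * f2 + 2 * n * f1 (‖y‖ ^ 2)) := by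
  have := HL.prod (y := y) 0 (a := fun _ => 1) (a1 := fun _ => 0) (a2 := 0)
    (Eventually.of_forall fun t => hasDerivAt_const t 1) (hasDerivAt_const _ 0) hf hf1
  simpa using this

lemma HL.radial_norm (hy : y ≠ 0) {F F1 : ℝ → ℝ} {F2 : ℝ}
    (hf : ∀ᶠ r in 𝓝 ‖y‖, HasDerivAt F (F1 r) r)
    (hf1 : HasDerivAt F1 F2 ‖y‖) :
    HL (fun z => F ‖z‖) y (F2 + (n - 1) / ‖y‖ * F1 ‖y‖) := by
  have hr : 0 < ‖y‖ := norm_pos_iff.2 hy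
  have hr2 : 0 < ‖y‖ ^ 2 := by positivity
  have hsq : Real.sqrt (‖y‖ ^ 2) = ‖y‖ := Real.sqrt_sq hr.le
  have hds : ∀ t, 0 < t → HasDerivAt Real.sqrt (1 / (2 * Real.sqrt t)) t := fun t ht =>
    Real.hasDerivAt_sqrt ht.ne'
  have ts : Tendsto Real.sqrt (𝓝 (‖y‖ ^ 2)) (𝓝 ‖y‖) := by
    have := (Real.continuous_sqrt).tendsto (‖y‖ ^ 2); rwa [hsq] at this
  have h1 : ∀ᶠ t in 𝓝 (‖y‖ ^ 2), HasDerivAt (fun t => F (Real.sqrt t))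
      (F1 (Real.sqrt t) * (1 / (2 * Real.sqrt t))) t := by
    filter_upwards [ts.eventually hf, eventually_gt_nhds hr2] with t a b
    exact a.comp t (hds t b)
  have hd1 := hds _ hr2
  have hf1' : HasDerivAt F1 F2 (Real.sqrt (‖y‖ ^ 2)) := by rwa [hsq]
  have h2 := (hf1'.comp _ hd1).mul (((hd1.const_mul 2)).inv (by rw [hsq]; positivity))
  have := HL.radial (f := fun t => F (Real.sqrt t))
    (f1 := fun t => F1 (Real.sqrt t) * (1 / (2 * Real.sqrt t))) (f2 := _) h1
    (by simp only [one_div] at h2 ⊢; exact h2)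
  have e : (fun z : EuclideanSpace ℝ (Fin n) => F (Real.sqrt (‖z‖ ^ 2))) = fun z => F ‖z‖ := by
    funext z; rw [Real.sqrt_sq (norm_nonneg z)]
  simp only [e] at this
  refine this.of_eq ?_
  simp only [hsq, Pi.inv_apply, Function.comp]
  field_simp
  ring

lemma lap_eq_lap (h : ContDiff ℝ 2 w) : lap w y = Laplacian.laplacian w y := by
  rw [InnerProductSpace.laplacian_eq_iteratedFDeriv_orthonormalBasis w
    (EuclideanSpace.basisFun (Fin n) ℝ)]
  unfold lap
  refine Finset.sum_congr rfl fun i _ => ?_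
  have h1 : ContDiff ℝ 1 (fderiv ℝ w) := h.fderiv_right (by norm_num)
  have h2 : DifferentiableAt ℝ (fderiv ℝ w) y := h1.differentiable (by norm_num) y
  rw [iteratedFDeriv_two_apply, fderiv_clm_apply h2 (differentiableAt_const _)]
  simp

lemma HL.comp_isometry (h : ContDiff ℝ 2 w)
    (R : EuclideanSpace ℝ (Fin n) ≃ₗᵢ[ℝ] EuclideanSpace ℝ (Fin n)) :
    HL (fun z => w (R z)) y (lap w (R y)) := by
  have hc : ContDiff ℝ 2 (fun z => w (R z)) := h.comp R.contDiff
  refine (HL.of_contDiff hc).of_eq ?_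
  rw [lap_eq_lap hc, lap_eq_lap h,
    InnerProductSpace.laplacian_eq_iteratedFDeriv_orthonormalBasis _
    (EuclideanSpace.basisFun (Fin n) ℝ),
    InnerProductSpace.laplacian_eq_iteratedFDeriv_orthonormalBasis w
    ((EuclideanSpace.basisFun (Fin n) ℝ).map R)]
  refine Finset.sum_congr rfl fun i _ => ?_
  have := ContinuousLinearMap.iteratedFDeriv_comp_right (i := 2)
    (R.toContinuousLinearEquiv : EuclideanSpace ℝ (Fin n) →L[ℝ] EuclideanSpace ℝ (Fin n)) h y le_rfl
  change iteratedFDeriv ℝ 2 (w ∘ _) y _ = _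
  have e2 : (fun z => w (R z)) = w ∘ (R.toContinuousLinearEquiv : EuclideanSpace ℝ (Fin n) →L[ℝ] EuclideanSpace ℝ (Fin n)) := rfl
  erw [this]
  simp [iteratedFDeriv_two_apply]

end HLsec

/-- The potential. -/
def Vn (n : ℕ) (y : EuclideanSpace ℝ (Fin n)) : ℝ := (n:ℝ) * (n + 2) / (1 + ‖y‖ ^ 2) ^ 2

/-- Bounded subsolutions on `Ω`, nonpositive on `K \ Ω`. -/
structure IsSub (n : ℕ) (lam : ℝ) (Ω K : Set (EuclideanSpace ℝ (Fin n)))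
    (w : EuclideanSpace ℝ (Fin n) → ℝ) : Prop where
  eqn : ∀ y ∈ Ω, ∃ L, HL w y L ∧ 0 ≤ L + (Vn n y - lam) * w y
  cont : ContinuousOn w K
  bdry : ∀ y ∈ K \ Ω, w y ≤ 0
  bdd : ∃ C, ∀ y ∈ Ω, w y ≤ C

section cmp
variable {n : ℕ}

lemma comparison {lam : ℝ} {Ω K : Set (EuclideanSpace ℝ (Fin n))} (hΩ : IsOpen Ω)
    (hK : IsClosed K) (hsub : Ω ⊆ K) {w G : EuclideanSpace ℝ (Fin n) → ℝ}
    (hw : IsSub n lam Ω K w)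
    (hG : ∀ y ∈ Ω, ∃ L, HL G y L ∧ L + (Vn n y - lam) * G y < 0)
    (Gc : ContinuousOn G K) (Gpos : ∀ y ∈ K, 0 < G y) {ε : ℝ} (hε : 0 < ε)
    (hgrow : ∀ y ∈ K, ε * ‖y‖ ^ 2 ≤ G y) : ∀ y ∈ Ω, w y ≤ 0 := by
  by_contra! hcon
  obtain ⟨y₀, hy₀, hwy₀⟩ := hcon
  obtain ⟨C, hC⟩ := hw.bdd
  have hG0 := Gpos y₀ (hsub hy₀)
  set m₀ := w y₀ / G y₀ with hm₀
  have hm₀p : 0 < m₀ := div_pos hwy₀ hG0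
  have hCp : 0 < C := hwy₀.trans_le (hC y₀ hy₀)
  set R := max ‖y₀‖ (Real.sqrt (C / (m₀ * ε))) with hR
  have hfar : ∀ y ∈ Ω, R < ‖y‖ → w y ≤ m₀ * G y := by
    intro y hy hyR
    have h1 : C / (m₀ * ε) ≤ ‖y‖ ^ 2 := by
      have h2 : Real.sqrt (C / (m₀ * ε)) ^ 2 = C / (m₀ * ε) := Real.sq_sqrt (by positivity)
      rw [← h2]
      exact pow_le_pow_left₀ (Real.sqrt_nonneg _) ((le_max_right _ _).trans hyR.le) 2
    rw [div_le_iff₀ (by positivity)] at h1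
    calc w y ≤ C := hC y hy
      _ ≤ m₀ * (ε * ‖y‖ ^ 2) := by linarith
      _ ≤ m₀ * G y := by gcongr; exact hgrow y (hsub hy)
  have hcomp : IsCompact (K ∩ closedBall 0 R) := (isCompact_closedBall 0 R).inter_left hK
  have hy₀m : y₀ ∈ K ∩ closedBall 0 R := ⟨hsub hy₀, by simp [hR]⟩
  obtain ⟨y₁, hy₁, hmax⟩ := hcomp.exists_isMaxOn ⟨y₀, hy₀m⟩
    ((hw.cont.div Gc fun y hy => (Gpos y hy).ne').mono inter_subset_left)
  set m := w y₁ / G y₁ with hm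
  have hm01 : m₀ ≤ m := hmax hy₀m
  have hmp : 0 < m := hm₀p.trans_le hm01
  have hG1 := Gpos y₁ hy₁.1
  have hw1 : w y₁ = m * G y₁ := by rw [hm]; field_simp
  have hw1p : 0 < w y₁ := by rw [hw1]; positivity
  have hy₁Ω : y₁ ∈ Ω := by
    by_contra hc
    exact absurd (hw.bdry y₁ ⟨hy₁.1, hc⟩) (not_le.2 hw1p)
  have hle : ∀ y ∈ Ω, w y ≤ m * G y := by
    intro y hy
    have hGy := Gpos y (hsub hy)
    rcases le_or_gt ‖y‖ R with h | h
    · have : w y / G y ≤ m := hmax (show y ∈ K ∩ closedBall 0 R from ⟨hsub hy, by simpa using h⟩)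
      rwa [div_le_iff₀ hGy] at this
    · exact (hfar y hy h).trans (by gcongr)
  obtain ⟨L, hL, hL'⟩ := hw.eqn y₁ hy₁Ω
  obtain ⟨M, hM, hM'⟩ := hG y₁ hy₁Ω
  have hloc : IsLocalMax (fun y => w y - m * G y) y₁ := by
    filter_upwards [hΩ.mem_nhds hy₁Ω] with y hy
    have := hle y hy
    rw [hw1]; linarith
  have := (hL.sub (hM.const_mul m)).nonpos hloc
  rw [hw1] at hL'
  have h3 := mul_neg_of_pos_of_neg hmp hM'
  nlinarith

lemma HL.normsq (y : EuclideanSpace ℝ (Fin n)) : HL (fun z => ‖z‖ ^ 2) y (2 * n) := by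
  have := HL.radial (n := n) (y := y) (f := fun t => t) (f1 := fun _ => 1) (f2 := 0)
    (Eventually.of_forall fun t => hasDerivAt_id t) (hasDerivAt_const _ _)
  simpa using this

lemma Vn_nonneg (y : EuclideanSpace ℝ (Fin n)) : 0 ≤ Vn n y := by unfold Vn; positivity

lemma barrier {lam μ : ℝ} (hlam : 0 < lam) (hμ : 0 < μ)
    {Ω K : Set (EuclideanSpace ℝ (Fin n))} (hΩ : IsOpen Ω)
    (hK : IsClosed K) (hsub : Ω ⊆ K) {w G e : EuclideanSpace ℝ (Fin n) → ℝ}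
    (hw : IsSub n lam Ω K w)
    (hG : ∀ y ∈ Ω, ∃ L, HL G y L ∧ L + (Vn n y - lam) * G y ≤ -μ * G y)
    (Gc : ContinuousOn G K) (G0 : ∀ y ∈ K, 0 ≤ G y)
    {Le : EuclideanSpace ℝ (Fin n) → ℝ}
    (he : ∀ y ∈ Ω, HL e y (Le y)) (hLe : ∀ y ∈ Ω, 0 ≤ Le y)
    (ec : ContinuousOn e K) (e0 : ∀ y ∈ K, 0 ≤ e y ∧ e y ≤ 1)
    (layer : ∀ R : ℝ, ∃ c > 0, ∀ y ∈ Ω, ‖y‖ ≤ R →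
      2 * n + 2 * ((n:ℝ) * (n + 2)) < Le y ∨ c ≤ G y) : ∀ y ∈ Ω, w y ≤ 0 := by
  set B : ℝ := 2 * n + 2 * ((n:ℝ) * (n + 2)) with hB
  have hB0 : 0 ≤ B := by positivity
  obtain ⟨c, hc, hlay⟩ := layer (Real.sqrt (B / lam))
  set ε := μ * c / (B + 1) with hεd
  have hε : 0 < ε := by positivity
  have hεB : ε * B ≤ μ * c := by
    rw [hεd, div_mul_eq_mul_div, div_le_iff₀ (by positivity)]
    have : 0 < μ * c := by positivity
    nlinarith
  refine comparison hΩ hK hsub hw (G := fun y => G y + ε * (2 - e y + ‖y‖ ^ 2)) ?_ ?_ ?_ hε ?_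
  · intro y hy
    obtain ⟨L, hL, hL'⟩ := hG y hy
    refine ⟨_, hL.add (((((HL.const 2).sub (he y hy)).add (HL.normsq y))).const_mul ε), ?_⟩
    have hey := e0 y (hsub hy)
    have hGy := G0 y (hsub hy)
    set h := 2 - e y + ‖y‖ ^ 2 with hh
    have hh1 : 1 + ‖y‖ ^ 2 ≤ h := by linarith
    have hh2 : h ≤ 2 * (1 + ‖y‖ ^ 2) := by nlinarith [sq_nonneg ‖y‖]
    have hVh : Vn n y * h ≤ 2 * ((n:ℝ) * (n + 2)) := by
      unfold Vn
      rw [div_mul_eq_mul_div, div_le_iff₀ (by positivity)]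
      have h5 : 0 ≤ (n:ℝ) * (n + 2) := by positivity
      have h6 : h ≤ 2 * (1 + ‖y‖ ^ 2) ^ 2 := by nlinarith [sq_nonneg ‖y‖, sq_nonneg (‖y‖^2)]
      nlinarith
    have hhp : 0 < lam * h := by have := sq_nonneg ‖y‖; apply mul_pos hlam; linarith
    have hLey := hLe y hy
    suffices hs : -μ * G y + ε * (-Le y + B - lam * h) < 0 by
      have : ε * (0 - Le y + 2 * n + (Vn n y - lam) * h) ≤ ε * (-Le y + B - lam * h) := by
        gcongr
        rw [hB]; nlinarith
      nlinarith
    rcases le_or_gt ‖y‖ (Real.sqrt (B / lam)) with hr | hr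
    · rcases hlay y hy hr with h1 | h1
      · have : ε * (-Le y + B - lam * h) < 0 := mul_neg_of_pos_of_neg hε (by linarith)
        nlinarith
      · have h2 : ε * (-Le y + B - lam * h) < ε * B := by
          apply mul_lt_mul_of_pos_left _ hε; linarith
        nlinarith
    · have h1 : B / lam < ‖y‖ ^ 2 := by
        rw [← Real.sqrt_lt' (lt_of_le_of_lt (Real.sqrt_nonneg _) hr)]; exact hr
      rw [div_lt_iff₀ hlam] at h1
      have h3 : lam * (1 + ‖y‖ ^ 2) ≤ lam * h := by gcongr
      have : ε * (-Le y + B - lam * h) < 0 := mul_neg_of_pos_of_neg hε (by nlinarith)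
      nlinarith
  · fun_prop
  · intro y hy
    have := e0 y hy
    have := G0 y hy
    have : 0 < ε * (2 - e y + ‖y‖ ^ 2) := mul_pos hε (by have := sq_nonneg ‖y‖; linarith)
    linarith
  · intro y hy
    have := e0 y hy
    have := G0 y hy
    have : ε * ‖y‖ ^ 2 ≤ ε * (2 - e y + ‖y‖ ^ 2) := by gcongr; linarith
    linarith

/-- Whole space. -/
lemma cmp_univ {lam μ : ℝ} (hlam : 0 < lam) (hμ : 0 < μ) {w G : EuclideanSpace ℝ (Fin n) → ℝ}
    (hw : IsSub n lam univ univ w)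
    (hG : ∀ y, ∃ L, HL G y L ∧ L + (Vn n y - lam) * G y ≤ -μ * G y)
    (Gc : Continuous G) (Gpos : ∀ y, 0 < G y) : ∀ y, w y ≤ 0 := by
  have := barrier hlam hμ isOpen_univ isClosed_univ (subset_refl _) hw (fun y _ => hG y)
    Gc.continuousOn (fun y _ => (Gpos y).le) (e := fun _ => 0) (Le := fun _ => 0)
    (fun y _ => HL.const 0) (fun _ _ => le_rfl) continuousOn_const (fun _ _ => by simp) (by
      intro R
      rcases (closedBall (0 : EuclideanSpace ℝ (Fin n)) R).eq_empty_or_nonempty with h | h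
      · refine ⟨1, one_pos, fun y _ hy => ?_⟩
        have : y ∈ closedBall (0 : EuclideanSpace ℝ (Fin n)) R := by simpa using hy
        rw [h] at this; exact absurd this (notMem_empty _)
      · obtain ⟨x, hx, hmin⟩ := (isCompact_closedBall (0 : EuclideanSpace ℝ (Fin n)) R).exists_isMinOn h
          Gc.continuousOn
        exact ⟨G x, Gpos x, fun y _ hy => Or.inr (hmin (by simpa using hy))⟩)
  exact fun y => this y (mem_univ y)

/-- Exterior domain. -/
lemma cmp_ext {lam R : ℝ} (hlam : 0 < lam) {w : EuclideanSpace ℝ (Fin n) → ℝ}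
    (hw : IsSub n lam {y | R < ‖y‖} {y | R ≤ ‖y‖} w)
    (hV : ∀ y : EuclideanSpace ℝ (Fin n), R < ‖y‖ → Vn n y ≤ lam / 2) : ∀ y, R < ‖y‖ → w y ≤ 0 :=
  barrier hlam (half_pos hlam) (isOpen_lt continuous_const continuous_norm)
    (isClosed_le continuous_const continuous_norm) (fun y hy => by simp only [mem_ofPred_eq] at hy ⊢; exact hy.le) hw (G := fun _ => 1)
    (fun y hy => ⟨0, HL.const 1, by have := hV y hy; linarith⟩)
    continuousOn_const (fun y _ => zero_le_one) (e := fun _ => 0) (Le := fun _ => 0)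
    (fun y _ => HL.const 0) (fun _ _ => le_rfl) continuousOn_const (fun _ _ => by simp)
    (fun _ => ⟨1, one_pos, fun _ _ _ => Or.inr le_rfl⟩)

lemma hasDerivAt_rho (p t : ℝ) (ht : 0 < 1 + t) :
    HasDerivAt (fun t : ℝ => (1 + t) ^ p) (p * (1 + t) ^ (p - 1)) t := by
  have := ((hasDerivAt_id t).const_add 1).rpow_const (p := p) (Or.inl ht.ne')
  refine this.congr_deriv ?_
  simp

lemma exp_neg_one_gt : (1:ℝ) / 3 < Real.exp (-1) := by
  rw [Real.exp_neg, one_div]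
  exact inv_strictAnti₀ (Real.exp_pos 1) Real.exp_one_lt_three

/-- Half space. -/
lemma cmp_half {lam : ℝ} (hlam : 0 < lam) {w : EuclideanSpace ℝ (Fin n) → ℝ}
    {a : EuclideanSpace ℝ (Fin n)} (ha : ‖a‖ = 1)
    (hw : IsSub n lam {y | 0 < inner ℝ a y} {y | 0 ≤ inner ℝ a y} w) :
    ∀ y, 0 < inner ℝ a y → w y ≤ 0 := by
  have hic : Continuous (fun y : EuclideanSpace ℝ (Fin n) => inner ℝ a y) := by fun_prop
  have hb : ∀ y : EuclideanSpace ℝ (Fin n), 0 < 1 + ‖y‖ ^ 2 := fun y => by positivity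
  set p : ℝ := -(n:ℝ) / 2 with hp
  set A : ℝ := 2 * n + 2 * ((n:ℝ) * (n + 2)) + 3 with hA
  have hA3 : 3 ≤ A := by rw [hA]; have : (0:ℝ) ≤ 2 * n + 2 * ((n:ℝ) * (n + 2)) := by positivity
                         linarith
  refine barrier hlam hlam (isOpen_lt continuous_const hic)
    (isClosed_le continuous_const hic) (fun y hy => by simp only [mem_ofPred_eq] at hy ⊢; exact hy.le) hw
    (G := fun y => inner ℝ a y * (1 + ‖y‖ ^ 2) ^ p)
    (e := fun y => Real.exp (-A * inner ℝ a y) * 1)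
    (Le := fun y => A ^ 2 * Real.exp (-A * inner ℝ a y)) ?_ ?_ ?_ ?_ ?_ ?_ ?_ ?_
  · intro y hy
    have hpos : ∀ᶠ t in 𝓝 (‖y‖ ^ 2), 0 < 1 + t := by
      have := hb y
      filter_upwards [eventually_gt_nhds (show -1 < ‖y‖ ^ 2 by linarith)] with t ht
      linarith
    refine ⟨_, HL.prod a (a := fun t => t) (a1 := fun _ => 1) (a2 := 0)
      (f := fun t => (1 + t) ^ p) (f1 := fun t => p * (1 + t) ^ (p - 1))
      (f2 := p * ((p - 1) * (1 + ‖y‖ ^ 2) ^ (p - 1 - 1)))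
      (Eventually.of_forall fun t => hasDerivAt_id t) (hasDerivAt_const _ _)
      (hpos.mono fun t ht => hasDerivAt_rho p t ht)
      ((hasDerivAt_rho (p - 1) _ (hb y)).const_mul p), ?_⟩
    have e1 : (1 + ‖y‖ ^ 2) ^ (p - 1) = (1 + ‖y‖ ^ 2) ^ (p - 1 - 1) * (1 + ‖y‖ ^ 2) := by
      nth_rewrite 3 [← Real.rpow_one (1 + ‖y‖ ^ 2)]
      rw [← Real.rpow_add (hb y)]; congr 1; ring
    have e2 : (1 + ‖y‖ ^ 2) ^ p = (1 + ‖y‖ ^ 2) ^ (p - 1 - 1) * (1 + ‖y‖ ^ 2) ^ 2 := by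
      rw [← Real.rpow_natCast (1 + ‖y‖ ^ 2) 2, ← Real.rpow_add (hb y)]; congr 1; push_cast; ring
    apply le_of_eq
    rw [e1, e2]
    generalize (1 + ‖y‖ ^ 2) ^ (p - 1 - 1) = X
    have := (hb y).ne'
    unfold Vn
    rw [hp]
    field_simp
    ring
  · refine Continuous.continuousOn (hic.mul ?_)
    exact Continuous.rpow_const (by fun_prop) fun y => Or.inl (hb y).ne'
  · intro y hy
    exact mul_nonneg hy (Real.rpow_nonneg (hb y).le _)
  · intro y hy
    have d : ∀ t : ℝ, HasDerivAt (fun t => Real.exp (-A * t)) (-A * Real.exp (-A * t)) t := fun t => by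
      have := ((hasDerivAt_id t).const_mul (-A)).exp
      refine this.congr_deriv ?_
      simp; ring
    refine (HL.prod (y := y) a (a := fun t => Real.exp (-A * t)) (a1 := fun t => -A * Real.exp (-A * t))
      (a2 := -A * (-A * Real.exp (-A * inner ℝ a y)))
      (f := fun t => 1) (f1 := fun t => 0) (f2 := 0) (Eventually.of_forall fun t => d t)
      ((d _).const_mul (-A)) (Eventually.of_forall fun t => hasDerivAt_const _ _)
      (hasDerivAt_const _ _)).of_eq ?_
    rw [ha]; ring
  · intro y hy; positivity
  · exact Continuous.continuousOn (by fun_prop)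
  · intro y hy
    refine ⟨by positivity, ?_⟩
    rw [mul_one, Real.exp_le_one_iff]
    have := mul_nonneg (show 0 ≤ A by linarith) (show 0 ≤ inner ℝ a y from hy)
    linarith
  · intro R
    refine ⟨A⁻¹ * (1 + R ^ 2) ^ p, by positivity, fun y hy hyR => ?_⟩
    rcases lt_or_ge (inner ℝ a y) A⁻¹ with h | h
    · left
      have h1 : Real.exp (-1) ≤ Real.exp (-A * inner ℝ a y) := by
        apply Real.exp_le_exp.2
        have : A * inner ℝ a y ≤ A * A⁻¹ := by gcongr
        rw [mul_inv_cancel₀ (by linarith)] at this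
        linarith
      have h2 := exp_neg_one_gt
      have h3 : A ^ 2 * (1 / 3) ≤ A ^ 2 * Real.exp (-A * inner ℝ a y) := by gcongr; linarith
      nlinarith
    · right
      have h1 : (1 + R ^ 2) ^ p ≤ (1 + ‖y‖ ^ 2) ^ p := by
        apply Real.rpow_le_rpow_of_nonpos (hb y)
        · gcongr
        · rw [hp]; have : (0:ℝ) ≤ n := by positivity
          linarith
      have : 0 ≤ A⁻¹ := by positivity
      gcongr
      exact le_trans this h

/-- Unit ball and its exterior. -/
lemma cmp_ball {lam s : ℝ} (hlam : 0 < lam) (hs : s = 1 ∨ s = -1) {w : EuclideanSpace ℝ (Fin n) → ℝ}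
    (hw : IsSub n lam {y | 0 < s * (1 - ‖y‖ ^ 2)} {y | 0 ≤ s * (1 - ‖y‖ ^ 2)} w) :
    ∀ y, 0 < s * (1 - ‖y‖ ^ 2) → w y ≤ 0 := by
  have hic : Continuous (fun y : EuclideanSpace ℝ (Fin n) => s * (1 - ‖y‖ ^ 2)) := by fun_prop
  have hb : ∀ y : EuclideanSpace ℝ (Fin n), 0 < 1 + ‖y‖ ^ 2 := fun y => by positivity
  set p : ℝ := -(n:ℝ) / 2 with hp
  set A : ℝ := 2 * n + 2 * ((n:ℝ) * (n + 2)) + 3 with hA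
  have hn0 : (0:ℝ) ≤ n := by positivity
  have hA3 : 3 ≤ A := by
    rw [hA]; have : (0:ℝ) ≤ 2 * n + 2 * ((n:ℝ) * (n + 2)) := by positivity
    linarith
  have hAn : 2 * n ≤ A := by
    rw [hA]; have : (0:ℝ) ≤ 2 * ((n:ℝ) * (n + 2)) := by positivity
    linarith
  have hs1 : -1 ≤ s ∧ s ≤ 1 := by rcases hs with rfl | rfl <;> norm_num
  have hs2 : s ^ 2 = 1 := by rcases hs with rfl | rfl <;> norm_num
  refine barrier hlam hlam (isOpen_lt continuous_const hic)
    (isClosed_le continuous_const hic) (fun y hy => by simp only [mem_ofPred_eq] at hy ⊢; exact hy.le) hw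
    (G := fun y => s * (1 - ‖y‖ ^ 2) * (1 + ‖y‖ ^ 2) ^ p)
    (e := fun y => Real.exp (-A * (s * (1 - ‖y‖ ^ 2))))
    (Le := fun y => (4 * A ^ 2 * ‖y‖ ^ 2 + 2 * n * A * s) * Real.exp (-A * (s * (1 - ‖y‖ ^ 2))))
    ?_ ?_ ?_ ?_ ?_ ?_ ?_ ?_
  · intro y hy
    have hpos : ∀ᶠ t in 𝓝 (‖y‖ ^ 2), 0 < 1 + t := by
      have := hb y
      filter_upwards [eventually_gt_nhds (show -1 < ‖y‖ ^ 2 by linarith)] with t ht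
      linarith
    have d0 : ∀ t : ℝ, HasDerivAt (fun t => s * (1 - t)) (-s) t := fun t => by
      have := ((hasDerivAt_id t).const_sub 1).const_mul s
      refine this.congr_deriv ?_
      simp
    refine ⟨_, HL.radial
      (f := fun t => s * (1 - t) * (1 + t) ^ p)
      (f1 := fun t => -s * (1 + t) ^ p + s * (1 - t) * (p * (1 + t) ^ (p - 1)))
      (f2 := _)
      (hpos.mono fun t ht => (d0 t).mul (hasDerivAt_rho p t ht))
      (((hasDerivAt_rho p _ (hb y)).const_mul (-s)).add
        ((d0 _).mul ((hasDerivAt_rho (p - 1) _ (hb y)).const_mul p))), ?_⟩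
    have e1 : (1 + ‖y‖ ^ 2) ^ (p - 1) = (1 + ‖y‖ ^ 2) ^ (p - 1 - 1) * (1 + ‖y‖ ^ 2) := by
      nth_rewrite 3 [← Real.rpow_one (1 + ‖y‖ ^ 2)]
      rw [← Real.rpow_add (hb y)]; congr 1; ring
    have e2 : (1 + ‖y‖ ^ 2) ^ p = (1 + ‖y‖ ^ 2) ^ (p - 1 - 1) * (1 + ‖y‖ ^ 2) ^ 2 := by
      rw [← Real.rpow_natCast (1 + ‖y‖ ^ 2) 2, ← Real.rpow_add (hb y)]; congr 1; push_cast; ring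
    apply le_of_eq
    rw [e1, e2]
    generalize (1 + ‖y‖ ^ 2) ^ (p - 1 - 1) = X
    have := (hb y).ne'
    unfold Vn
    rw [hp]
    field_simp
    ring
  · refine Continuous.continuousOn (hic.mul ?_)
    exact Continuous.rpow_const (by fun_prop) fun y => Or.inl (hb y).ne'
  · intro y hy
    exact mul_nonneg hy (Real.rpow_nonneg (hb y).le _)
  · intro y hy
    have d : ∀ t : ℝ, HasDerivAt (fun t => Real.exp (-A * (s * (1 - t))))
        (A * s * Real.exp (-A * (s * (1 - t)))) t := fun t => by
      have := ((((hasDerivAt_id t).const_sub 1).const_mul s).const_mul (-A)).exp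
      refine this.congr_deriv ?_
      simp; ring
    refine (HL.radial (y := y) (f := fun t => Real.exp (-A * (s * (1 - t))))
      (f1 := fun t => A * s * Real.exp (-A * (s * (1 - t))))
      (Eventually.of_forall fun t => d t)
      ((d _).const_mul (A * s))).of_eq ?_
    linear_combination (4 * ‖y‖ ^ 2 * A ^ 2 * Real.exp (-A * (s * (1 - ‖y‖ ^ 2)))) * hs2
  · intro y hy
    refine mul_nonneg ?_ (Real.exp_pos _).le
    rcases hs with rfl | rfl
    · positivity
    · have h1 : 1 ≤ ‖y‖ ^ 2 := by
        have : 0 < -1 * (1 - ‖y‖ ^ 2) := hy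
        linarith
      nlinarith
  · exact Continuous.continuousOn (by fun_prop)
  · intro y hy
    refine ⟨by positivity, ?_⟩
    rw [Real.exp_le_one_iff]
    have := mul_nonneg (show 0 ≤ A by linarith) (show 0 ≤ s * (1 - ‖y‖ ^ 2) from hy)
    linarith
  · intro R
    refine ⟨A⁻¹ * (1 + R ^ 2) ^ p, by positivity, fun y hy hyR => ?_⟩
    rcases lt_or_ge (s * (1 - ‖y‖ ^ 2)) A⁻¹ with h | h
    · left
      have h1 : Real.exp (-1) ≤ Real.exp (-A * (s * (1 - ‖y‖ ^ 2))) := by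
        apply Real.exp_le_exp.2
        have : A * (s * (1 - ‖y‖ ^ 2)) ≤ A * A⁻¹ := by gcongr
        rw [mul_inv_cancel₀ (by linarith)] at this
        linarith
      have h2 := exp_neg_one_gt
      have hinv : A⁻¹ ≤ 1 / 2 := by
        rw [one_div]; exact inv_anti₀ (by norm_num) (by linarith)
      have hr : 1 / 2 ≤ ‖y‖ ^ 2 := by
        have hy' : 0 < s * (1 - ‖y‖ ^ 2) := hy
        rcases hs with rfl | rfl <;> linarith
      have h4 : A ^ 2 ≤ 4 * A ^ 2 * ‖y‖ ^ 2 + 2 * n * A * s := by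
        have : -(A * A) ≤ 2 * n * A * s := by
          have : -(2 * n * A) ≤ 2 * n * A * s := by
            have : 0 ≤ 2 * (n:ℝ) * A := by positivity
            nlinarith
          nlinarith
        nlinarith
      have h3 : A ^ 2 * (1 / 3) ≤ (4 * A ^ 2 * ‖y‖ ^ 2 + 2 * n * A * s) * Real.exp (-A * (s * (1 - ‖y‖ ^ 2))) := by
        apply mul_le_mul h4 (by linarith) (by norm_num)
        nlinarith
      nlinarith
    · right
      have h1 : (1 + R ^ 2) ^ p ≤ (1 + ‖y‖ ^ 2) ^ p := by
        apply Real.rpow_le_rpow_of_nonpos (hb y)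
        · gcongr
        · rw [hp]; linarith
      have : 0 ≤ A⁻¹ := by positivity
      gcongr
      exact le_trans this h

end cmp

lemma pot_eq (n : ℕ) (hn : 3 ≤ n) (y : EuclideanSpace ℝ (Fin n)) :
    (((n : ℝ) + 2) / ((n : ℝ) - 2)) *
      stdBubble n y ^ ((((n : ℝ) + 2) / ((n : ℝ) - 2)) - 1) = Vn n y := by
  have h3 : (3:ℝ) ≤ n := by exact_mod_cast hn
  have h2 : 0 < (n:ℝ) - 2 := by linarith
  have hb : 0 < 1 + ‖y‖ ^ 2 := by positivity
  have hm : 0 < (n:ℝ) * ((n:ℝ) - 2) := by positivity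
  have e : ((n : ℝ) + 2) / ((n : ℝ) - 2) - 1 = 4 / ((n:ℝ) - 2) := by field_simp; ring
  unfold stdBubble Vn
  rw [e, Real.mul_rpow (by positivity) (by positivity), ← Real.rpow_mul hm.le, ← Real.rpow_mul hb.le]
  have e1 : ((n:ℝ) - 2) / 4 * (4 / ((n:ℝ) - 2)) = 1 := by field_simp
  have e2 : -(((n:ℝ) - 2) / 2) * (4 / ((n:ℝ) - 2)) = -(2:ℕ) := by push_cast; field_simp; norm_num
  rw [e1, e2, Real.rpow_one, Real.rpow_neg hb.le, Real.rpow_natCast]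
  field_simp

section Zsec
variable {n : ℕ}

lemma RadSol.HL_pos {N l : ℝ} {u g : ℝ → ℝ} (h : RadSol n N l u g)
    {y : EuclideanSpace ℝ (Fin n)} (hy : y ≠ 0) :
    HL (fun z => u ‖z‖) y ((l - N / (1 + ‖y‖ ^ 2) ^ 2) * u ‖y‖) := by
  have hr : 0 < ‖y‖ := norm_pos_iff.2 hy
  have := HL.radial_norm (n := n) hy (F := u) (F1 := fun r => r * g r)
    (Eventually.of_forall fun r => h.du r) ((hasDerivAt_id ‖y‖).mul (h.dg _ hr))
  refine this.of_eq ?_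
  simp only [id]
  field_simp
  ring

lemma RadSol.HL_zero {N l : ℝ} {u g : ℝ → ℝ} (h : RadSol n N l u g) :
    HL (fun z : EuclideanSpace ℝ (Fin n) => u ‖z‖) 0 (l - N) := by
  refine ⟨fun z => g ‖z‖ • innerSL ℝ z, fun i => g 0 • EuclideanSpace.proj i,
    Eventually.of_forall fun z => ?_, fun i => ?_, ?_⟩
  · by_cases hz : z = 0
    · subst hz
      have h0 := h.du 0
      have h1 : HasFDerivAt (fun z : EuclideanSpace ℝ (Fin n) => u ‖z‖) (0 : EuclideanSpace ℝ (Fin n) →L[ℝ] ℝ) 0 := by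
        rw [hasFDerivAt_iff_isLittleO_nhds_zero]
        rw [hasDerivAt_iff_isLittleO_nhds_zero] at h0
        have t : Tendsto (fun z : EuclideanSpace ℝ (Fin n) => ‖z‖) (𝓝 0) (𝓝 0) := by
          simpa using (continuous_norm (E := EuclideanSpace ℝ (Fin n))).tendsto 0
        have := (h0.comp_tendsto t)
        refine Asymptotics.IsLittleO.of_norm_right ?_
        simpa [Function.comp_def] using this
      refine h1.congr_fderiv ?_
      simp
    · have hr : 0 < ‖z‖ := norm_pos_iff.2 hz
      have h1 : HasFDerivAt (fun z : EuclideanSpace ℝ (Fin n) => ‖z‖) ((‖z‖⁻¹) • innerSL ℝ z) z := by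
        have a := (hasStrictFDerivAt_norm_sq z).hasFDerivAt
        have b := a.sqrt (by positivity)
        have c : (fun z : EuclideanSpace ℝ (Fin n) => √(‖z‖ ^ 2)) = fun z => ‖z‖ := by
          funext z; exact Real.sqrt_sq (norm_nonneg _)
        rw [c, Real.sqrt_sq hr.le] at b
        refine b.congr_fderiv ?_
        ext v
        simp
        field_simp
      have := (h.du ‖z‖).comp_hasFDerivAt z h1
      refine this.congr_fderiv ?_
      rw [smul_smul]
      congr 1
      field_simp
  · have h1 : HasFDerivAt (fun z : EuclideanSpace ℝ (Fin n) => g ‖z‖ * z i)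
        (g 0 • (EuclideanSpace.proj i : EuclideanSpace ℝ (Fin n) →L[ℝ] ℝ)) (0 : EuclideanSpace ℝ (Fin n)) := by
      rw [hasFDerivAt_iff_isLittleO_nhds_zero]
      have t : Tendsto (fun z : EuclideanSpace ℝ (Fin n) => g ‖z‖ - g 0) (𝓝 0) (𝓝 0) := by
        have : Continuous (fun z : EuclideanSpace ℝ (Fin n) => g ‖z‖ - g 0) :=
          (h.gc.comp continuous_norm).sub continuous_const
        simpa using this.tendsto 0
      have a := (Asymptotics.isLittleO_one_iff ℝ).2 t
      have b : (fun z : EuclideanSpace ℝ (Fin n) => z i) =O[𝓝 0] (fun z => z) :=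
        Asymptotics.IsBigO.of_bound 1 (Eventually.of_forall fun z => by
          simpa using PiLp.norm_apply_le z i)
      have c := a.mul_isBigO b.norm_right
      refine Asymptotics.IsLittleO.of_norm_right ?_
      refine c.congr (fun z => ?_) (fun z => ?_)
      · simp; ring
      · simp
    convert h1 using 1
    funext z
    simp [EuclideanSpace.inner_single_right]
  · simp [h.g0]

lemma RadSol.HL {l : ℝ} {u g : ℝ → ℝ} (h : RadSol n ((n:ℝ) * (n + 2)) l u g)
    (y : EuclideanSpace ℝ (Fin n)) :
    HL (fun z => u ‖z‖) y ((l - Vn n y) * u ‖y‖) := by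
  by_cases hy : y = 0
  · subst hy
    refine h.HL_zero.of_eq ?_
    simp [Vn, h.u0]
  · exact h.HL_pos hy

end Zsec

/-- decay profile -/
def Ef (b k r : ℝ) : ℝ := r ^ (-b) * Real.exp (-k * r)

lemma Ef_pos {b k r : ℝ} (hr : 0 < r) : 0 < Ef b k r := by
  unfold Ef; positivity

lemma Ef_cont (b k : ℝ) : ContinuousOn (Ef b k) (Ioi 0) := by
  unfold Ef
  apply ContinuousOn.mul
  · exact continuousOn_id.rpow_const fun x hx => Or.inl (ne_of_gt hx)
  · fun_prop

lemma Ef_deriv (b k : ℝ) {r : ℝ} (hr : 0 < r) :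
    HasDerivAt (Ef b k) (Ef b k r * (-b / r - k)) r := by
  have h1 : HasDerivAt (fun r : ℝ => r ^ (-b)) (-b * r ^ (-b - 1)) r :=
    Real.hasDerivAt_rpow_const (Or.inl hr.ne')
  have h2 : HasDerivAt (fun r : ℝ => Real.exp (-k * r)) (Real.exp (-k * r) * (-k)) r := by
    simpa using ((hasDerivAt_id r).const_mul (-k)).exp
  refine (h1.mul h2).congr_deriv ?_
  rw [Real.rpow_sub hr, Real.rpow_one]
  unfold Ef
  field_simp
  ring

def Fa (b k a r : ℝ) : ℝ := Ef b k r * (1 + a / r)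
def Fa1 (b k a r : ℝ) : ℝ := Ef b k r * ((-b / r - k) * (1 + a / r) - a / r ^ 2)
def Fa2 (b k a r : ℝ) : ℝ := Ef b k r * ((-b / r - k) * ((-b / r - k) * (1 + a / r) - a / r ^ 2)
  + (b / r ^ 2 * (1 + a / r) + (-b / r - k) * (-a / r ^ 2) + 2 * a / r ^ 3))

lemma hda {a r : ℝ} (hr : 0 < r) : HasDerivAt (fun r : ℝ => 1 + a / r) (-a / r ^ 2) r := by
  have := ((hasDerivAt_inv hr.ne').const_mul a).const_add 1
  simp only [← div_eq_mul_inv] at this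
  refine this.congr_deriv ?_
  field_simp

lemma Fa_deriv (b k a : ℝ) {r : ℝ} (hr : 0 < r) : HasDerivAt (Fa b k a) (Fa1 b k a r) r := by
  refine ((Ef_deriv b k hr).mul (hda (a := a) hr)).congr_deriv ?_
  unfold Fa1
  field_simp
  ring

lemma Fa1_deriv (b k a : ℝ) {r : ℝ} (hr : 0 < r) : HasDerivAt (Fa1 b k a) (Fa2 b k a r) r := by
  have h1 : HasDerivAt (fun r : ℝ => -b / r - k) (b / r ^ 2) r := by
    have := ((hda (a := -b) hr).sub_const (1 + k))
    refine (this.congr_deriv (by ring)).congr_of_eventuallyEq (Eventually.of_forall fun x => ?_)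
    simp
  have h2 : HasDerivAt (fun r : ℝ => a / r ^ 2) (-2 * a / r ^ 3) r := by
    have := ((hasDerivAt_pow 2 r).inv (by positivity)).const_mul a
    refine (this.congr_deriv ?_).congr_of_eventuallyEq (Eventually.of_forall fun x => ?_)
    · simp
      field_simp
    · simp [div_eq_mul_inv]
  refine ((Ef_deriv b k hr).mul ((h1.mul (hda (a := a) hr)).sub h2)).congr_deriv ?_
  unfold Fa2
  simp only [Pi.mul_apply, Pi.sub_apply]
  field_simp
  ring

lemma Fa_cont (b k a : ℝ) : ContinuousOn (Fa b k a) (Ioi 0) :=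
  fun _ hr => (Fa_deriv b k a hr).continuousAt.continuousWithinAt

section decay
variable {n : ℕ}

lemma Fa_HL {b : ℝ} (hb : 2 * b = n - 1) (k a : ℝ) {y : EuclideanSpace ℝ (Fin n)} (hy : 0 < ‖y‖) :
    HL (fun z => Fa b k a ‖z‖) y (k ^ 2 * Fa b k a ‖y‖ + Ef b k ‖y‖ *
      (2 * k * a / ‖y‖ ^ 2 + 2 * a / ‖y‖ ^ 3 - (b * (b - 1)) / ‖y‖ ^ 2 * (1 + a / ‖y‖))) := by
  have := HL.radial_norm (n := n) (norm_pos_iff.1 hy) (F := Fa b k a) (F1 := Fa1 b k a)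
    ((lt_mem_nhds hy).mono fun r hr => Fa_deriv b k a hr) (Fa1_deriv b k a hy)
  refine this.of_eq ?_
  rw [← hb]
  unfold Fa2 Fa1 Fa
  field_simp
  ring

lemma Vn_le {y : EuclideanSpace ℝ (Fin n)} (hy : 1 ≤ ‖y‖) :
    Vn n y ≤ (n:ℝ) * (n + 2) / ‖y‖ ^ 2 := by
  unfold Vn
  gcongr
  nlinarith [sq_nonneg ‖y‖]

theorem decay (hn : 3 ≤ n) {lam : ℝ} (hlam : 0 < lam) {u : ℝ → ℝ} (uc : Continuous u)
    (upos : ∀ r, 0 ≤ r → 0 < u r) {C : ℝ} (uC : ∀ r, 0 ≤ r → u r ≤ C)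
    (hu : ∀ y : EuclideanSpace ℝ (Fin n), HL (fun z => u ‖z‖) y ((lam - Vn n y) * u ‖y‖)) :
    ∃ c₁ c₂ : ℝ, 0 < c₁ ∧ 0 < c₂ ∧
        ∀ y : EuclideanSpace ℝ (Fin n), 1 ≤ ‖y‖ →
          c₁ * Ef (((n : ℝ) - 1) / 2) (Real.sqrt lam) ‖y‖ ≤ u ‖y‖ ∧
          u ‖y‖ ≤ c₂ * Ef (((n : ℝ) - 1) / 2) (Real.sqrt lam) ‖y‖ := by
  have h3 : (3:ℝ) ≤ n := by exact_mod_cast hn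
  set b : ℝ := ((n : ℝ) - 1) / 2 with hb
  have hb2 : 2 * b = n - 1 := by rw [hb]; ring
  have hb1 : 1 ≤ b := by rw [hb]; linarith
  set k := Real.sqrt lam with hk
  have hk0 : 0 < k := Real.sqrt_pos.2 hlam
  have hk2 : k ^ 2 = lam := Real.sq_sqrt hlam.le
  set N : ℝ := (n:ℝ) * (n + 2) with hN
  have hN0 : 0 < N := by positivity
  set c : ℝ := b * (b - 1) with hc
  have hc0 : 0 ≤ c := mul_nonneg (by linarith) (by linarith)
  obtain ⟨A, hA0, hAc, hAN⟩ : ∃ A : ℝ, 0 < A ∧ c ≤ k * A ∧ N ≤ 2 * (k * A) := by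
    refine ⟨(c + N) / k, by positivity, ?_, ?_⟩
    · rw [mul_div_cancel₀ _ hk0.ne']; linarith
    · rw [mul_div_cancel₀ _ hk0.ne']; linarith
  obtain ⟨R, hR1, hRA, hRN⟩ : ∃ R : ℝ, 1 ≤ R ∧ 2 * A ≤ R ∧ 2 * N / lam ≤ R := by
    have : 0 < 2 * N / lam := by positivity
    exact ⟨1 + 2 * A + 2 * N / lam, by linarith, by linarith, by linarith⟩
  have hR0 : 0 < R := by linarith
  have hV : ∀ y : EuclideanSpace ℝ (Fin n), R < ‖y‖ → Vn n y ≤ lam / 2 := by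
    intro y hy
    refine (Vn_le (by linarith)).trans ?_
    have h0 : 0 < ‖y‖ := by linarith
    rw [div_le_iff₀ (by positivity)]
    rw [div_le_iff₀ hlam] at hRN
    have : R ≤ ‖y‖ ^ 2 := by nlinarith
    nlinarith
  have hAr : ∀ r, R ≤ r → 0 ≤ A / r ∧ A / r ≤ 1 / 2 := fun r hr => by
    have h0 : 0 < r := by linarith
    refine ⟨by positivity, ?_⟩
    rw [div_le_iff₀ h0]; linarith
  have ucont : Continuous (fun y : EuclideanSpace ℝ (Fin n) => u ‖y‖) := uc.comp continuous_norm
  have fcont : ∀ a, ContinuousOn (fun y : EuclideanSpace ℝ (Fin n) => Fa b k a ‖y‖) {y | R ≤ ‖y‖} :=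
    fun a => (Fa_cont b k a).comp continuous_norm.continuousOn (fun y hy => hR0.trans_le hy)
  have key : ∀ y : EuclideanSpace ℝ (Fin n), y ∈ {y : EuclideanSpace ℝ (Fin n) | R ≤ ‖y‖} \ {y | R < ‖y‖} → ‖y‖ = R :=
    fun y hy => le_antisymm (not_lt.1 hy.2) hy.1
  have FRp : ∀ a, (a = A ∨ a = -A) → ∀ r, R ≤ r → 0 < Fa b k a r := by
    intro a ha r hr
    have h0 : 0 < r := by linarith
    obtain ⟨h1, h2⟩ := hAr r hr
    unfold Fa
    refine mul_pos (Ef_pos h0) ?_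
    rcases ha with rfl | rfl
    · linarith
    · rw [neg_div]; linarith
  -- upper bound
  have up : ∃ M, 0 < M ∧ ∀ y : EuclideanSpace ℝ (Fin n), R ≤ ‖y‖ → u ‖y‖ ≤ M * Ef b k ‖y‖ := by
    have hF := FRp (-A) (Or.inr rfl)
    set M := u R / Fa b k (-A) R with hM
    have hM0 : 0 < M := div_pos (upos R hR0.le) (hF R le_rfl)
    have hMR : u R = M * Fa b k (-A) R := by
      rw [hM, div_mul_cancel₀ _ (hF R le_rfl).ne']
    have := cmp_ext (n := n) (R := R) hlam (w := fun y => u ‖y‖ - M * Fa b k (-A) ‖y‖) ?_ hV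
    · refine ⟨M, hM0, fun y hy => ?_⟩
      have h1 : u ‖y‖ ≤ M * Fa b k (-A) ‖y‖ := by
        rcases hy.eq_or_lt with h | h
        · rw [← h]; exact hMR.le
        · have := this y h; linarith
      refine h1.trans ?_
      gcongr
      unfold Fa
      have h2 := Ef_pos (b := b) (k := k) (hR0.trans_le hy)
      have h4 := (hAr _ hy).1
      rw [neg_div]
      nlinarith
    · refine ⟨fun y hy => ?_, ?_, ?_, ?_⟩
      · have hr : R < ‖y‖ := hy
        have h0 : 0 < ‖y‖ := by linarith
        refine ⟨_, (hu y).sub ((Fa_HL hb2 k (-A) h0).const_mul M), ?_⟩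
        have hE := Ef_pos (b := b) (k := k) h0
        obtain ⟨h1, h2⟩ := hAr _ hr.le
        have hVy := Vn_le (n := n) (y := y) (by linarith)
        have hV0 := Vn_nonneg (n := n) y
        have e : (lam - Vn n y) * u ‖y‖ - M * (k ^ 2 * Fa b k (-A) ‖y‖ + Ef b k ‖y‖ *
            (2 * k * -A / ‖y‖ ^ 2 + 2 * -A / ‖y‖ ^ 3 - b * (b - 1) / ‖y‖ ^ 2 * (1 + -A / ‖y‖))) +
            (Vn n y - lam) * (u ‖y‖ - M * Fa b k (-A) ‖y‖) =
            M * Ef b k ‖y‖ * (2 * (k * A) / ‖y‖ ^ 2 + 2 * A / ‖y‖ ^ 3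
              + (c / ‖y‖ ^ 2) * (1 - A / ‖y‖) - Vn n y * (1 - A / ‖y‖)) := by
          rw [hk2, hc]; unfold Fa; ring
        rw [e]
        apply mul_nonneg (by positivity)
        have g1 : 0 ≤ 2 * A / ‖y‖ ^ 3 := by positivity
        have g2 : 0 ≤ (c / ‖y‖ ^ 2) * (1 - A / ‖y‖) := mul_nonneg (by positivity) (by linarith)
        have g3 : Vn n y * (1 - A / ‖y‖) ≤ Vn n y := by nlinarith
        have g4 : N / ‖y‖ ^ 2 ≤ 2 * (k * A) / ‖y‖ ^ 2 := by gcongr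
        linarith
      · exact ucont.continuousOn.sub (continuousOn_const.mul (fcont _))
      · intro y hy
        simp only [key y hy, ← hMR, sub_self, le_refl]
      · refine ⟨C, fun y hy => ?_⟩
        have h1 := uC ‖y‖ (norm_nonneg _)
        have h2 := mul_pos hM0 (hF ‖y‖ (le_of_lt hy))
        linarith
  have low : ∃ M, 0 < M ∧ ∀ y : EuclideanSpace ℝ (Fin n), R ≤ ‖y‖ → M * Ef b k ‖y‖ ≤ u ‖y‖ := by
    have hF := FRp A (Or.inl rfl)
    set M := u R / Fa b k A R with hM
    have hM0 : 0 < M := div_pos (upos R hR0.le) (hF R le_rfl)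
    have hMR : u R = M * Fa b k A R := by
      rw [hM, div_mul_cancel₀ _ (hF R le_rfl).ne']
    have := cmp_ext (n := n) (R := R) hlam (w := fun y => M * Fa b k A ‖y‖ - u ‖y‖) ?_ hV
    · refine ⟨M, hM0, fun y hy => ?_⟩
      have h1 : M * Fa b k A ‖y‖ ≤ u ‖y‖ := by
        rcases hy.eq_or_lt with h | h
        · rw [← h]; exact hMR.ge
        · have := this y h; linarith
      refine le_trans ?_ h1
      gcongr
      unfold Fa
      have h2 := Ef_pos (b := b) (k := k) (hR0.trans_le hy)
      have h4 := (hAr _ hy).1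
      nlinarith
    · refine ⟨fun y hy => ?_, ?_, ?_, ?_⟩
      · have hr : R < ‖y‖ := hy
        have h0 : 0 < ‖y‖ := by linarith
        refine ⟨_, ((Fa_HL hb2 k A h0).const_mul M).sub (hu y), ?_⟩
        have hE := Ef_pos (b := b) (k := k) h0
        obtain ⟨h1, h2⟩ := hAr _ hr.le
        have hV0 := Vn_nonneg (n := n) y
        have e : M * (k ^ 2 * Fa b k A ‖y‖ + Ef b k ‖y‖ *
            (2 * k * A / ‖y‖ ^ 2 + 2 * A / ‖y‖ ^ 3 - b * (b - 1) / ‖y‖ ^ 2 * (1 + A / ‖y‖)))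
            - (lam - Vn n y) * u ‖y‖ +
            (Vn n y - lam) * (M * Fa b k A ‖y‖ - u ‖y‖) =
            M * Ef b k ‖y‖ * (2 * (k * A) / ‖y‖ ^ 2 + 2 * A / ‖y‖ ^ 3
              - (c / ‖y‖ ^ 2) * (1 + A / ‖y‖) + Vn n y * (1 + A / ‖y‖)) := by
          rw [hk2, hc]; unfold Fa; ring
        rw [e]
        apply mul_nonneg (by positivity)
        have g1 : 0 ≤ 2 * A / ‖y‖ ^ 3 := by positivity
        have g2 : (c / ‖y‖ ^ 2) * (1 + A / ‖y‖) ≤ (k * A / ‖y‖ ^ 2) * 2 := by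
          gcongr; linarith
        have g3 : 0 ≤ Vn n y * (1 + A / ‖y‖) := by positivity
        have g4 : 2 * (k * A) / ‖y‖ ^ 2 = (k * A / ‖y‖ ^ 2) * 2 := by ring
        linarith
      · exact (continuousOn_const.mul (fcont _)).sub ucont.continuousOn
      · intro y hy
        simp only [key y hy, ← hMR, sub_self, le_refl]
      · refine ⟨M * 2, fun y hy => ?_⟩
        have hr : R < ‖y‖ := hy
        have h0 : 0 < ‖y‖ := by linarith
        have h1 := upos ‖y‖ (norm_nonneg _)
        have h2 : Fa b k A ‖y‖ ≤ 2 := by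
          unfold Fa Ef
          have q1 : ‖y‖ ^ (-b) ≤ 1 := Real.rpow_le_one_of_one_le_of_nonpos (by linarith) (by linarith)
          have q2 : Real.exp (-k * ‖y‖) ≤ 1 := Real.exp_le_one_iff.2 (by nlinarith)
          have q3 : ‖y‖ ^ (-b) * Real.exp (-k * ‖y‖) ≤ 1 := mul_le_one₀ q1 (by positivity) q2
          obtain ⟨h1, h2⟩ := hAr _ hr.le
          calc _ ≤ 1 * (1 + A / ‖y‖) := by gcongr
            _ ≤ 2 := by linarith
        have := mul_le_mul_of_nonneg_left h2 hM0.le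
        linarith
  have qc : ContinuousOn (fun r => u r / Ef b k r) (Icc 1 R) :=
    uc.continuousOn.div ((Ef_cont b k).mono fun r hr => lt_of_lt_of_le one_pos hr.1)
      fun r hr => (Ef_pos (lt_of_lt_of_le one_pos hr.1)).ne'
  obtain ⟨r1, hr1, hmin⟩ := isCompact_Icc.exists_isMinOn ⟨1, ⟨le_rfl, hR1⟩⟩ qc
  obtain ⟨r2, hr2, hmax⟩ := isCompact_Icc.exists_isMaxOn ⟨1, ⟨le_rfl, hR1⟩⟩ qc
  obtain ⟨M, hM, hup⟩ := up
  obtain ⟨m, hm, hlow⟩ := low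
  have p1 : 0 < u r1 / Ef b k r1 :=
    div_pos (upos _ (by linarith [hr1.1])) (Ef_pos (by linarith [hr1.1]))
  refine ⟨min m (u r1 / Ef b k r1), max M (u r2 / Ef b k r2), lt_min hm p1, lt_max_of_lt_left hM,
    fun y hy => ?_⟩
  have hE : 0 < Ef b k ‖y‖ := Ef_pos (by linarith)
  rcases le_total R ‖y‖ with h | h
  · exact ⟨le_trans (by gcongr; exact min_le_left _ _) (hlow y h),
      le_trans (hup y h) (by gcongr; exact le_max_left _ _)⟩
  · have a1 : u r1 / Ef b k r1 ≤ u ‖y‖ / Ef b k ‖y‖ := hmin ⟨hy, h⟩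
    have a2 : u ‖y‖ / Ef b k ‖y‖ ≤ u r2 / Ef b k r2 := hmax ⟨hy, h⟩
    rw [le_div_iff₀ hE] at a1
    rw [div_le_iff₀ hE] at a2
    exact ⟨le_trans (by gcongr; exact min_le_right _ _) a1,
      le_trans a2 (by gcongr; exact le_max_right _ _)⟩

end decay

section uniq
variable {n : ℕ}

/-- Bounded entire (strong) solutions. -/
structure Ent (n : ℕ) (lam : ℝ) (φ : EuclideanSpace ℝ (Fin n) → ℝ) : Prop where
  eqn : ∀ y, HL φ y ((lam - Vn n y) * φ y)
  cont : Continuous φ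
  bdd : ∃ C, ∀ y, |φ y| ≤ C

lemma Ent.neg {lam : ℝ} {φ : EuclideanSpace ℝ (Fin n) → ℝ} (h : Ent n lam φ) :
    Ent n lam (fun y => - φ y) :=
  ⟨fun y => (h.eqn y).neg.of_eq (by ring), h.cont.neg, by simpa using h.bdd⟩

/-- subsolutions from entire functions -/
lemma mkSub {lam : ℝ} {Ω K : Set (EuclideanSpace ℝ (Fin n))} {w : EuclideanSpace ℝ (Fin n) → ℝ}
    (heq : ∀ y, ∃ L, HL w y L ∧ 0 ≤ L + (Vn n y - lam) * w y) (hc : Continuous w)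
    (hb : ∃ C, ∀ y, |w y| ≤ C) (hbd : ∀ y ∈ K \ Ω, w y ≤ 0) : IsSub n lam Ω K w :=
  ⟨fun y _ => heq y, hc.continuousOn, hbd, by
    obtain ⟨C, hC⟩ := hb
    exact ⟨C, fun y _ => (le_abs_self _).trans (hC y)⟩⟩

lemma Ent.sub_eqn {lam : ℝ} {φ : EuclideanSpace ℝ (Fin n) → ℝ} (h : Ent n lam φ) (y) :
    ∃ L, HL φ y L ∧ 0 ≤ L + (Vn n y - lam) * φ y :=
  ⟨_, h.eqn y, le_of_eq (by ring)⟩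

lemma bdd_sub {f g : EuclideanSpace ℝ (Fin n) → ℝ} (hf : ∃ C, ∀ y, |f y| ≤ C)
    (hg : ∃ C, ∀ y, |g y| ≤ C) : ∃ C, ∀ y, |f y - g y| ≤ C := by
  obtain ⟨C, hC⟩ := hf
  obtain ⟨D, hD⟩ := hg
  exact ⟨C + D, fun y => (abs_sub _ _).trans (add_le_add (hC y) (hD y))⟩

lemma bdd_mul {f : EuclideanSpace ℝ (Fin n) → ℝ} (c : ℝ) (hf : ∃ C, ∀ y, |f y| ≤ C) :
    ∃ C, ∀ y, |c * f y| ≤ C := by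
  obtain ⟨C, hC⟩ := hf
  exact ⟨|c| * C, fun y => by rw [abs_mul]; gcongr; exact hC y⟩

/-- Subsolutions that are nonpositive on the unit sphere are nonpositive. -/
lemma sphere_cmp {lam : ℝ} (hlam : 0 < lam) {w : EuclideanSpace ℝ (Fin n) → ℝ}
    (heq : ∀ y, ∃ L, HL w y L ∧ 0 ≤ L + (Vn n y - lam) * w y) (hc : Continuous w)
    (hb : ∃ C, ∀ y, |w y| ≤ C) (h1 : ∀ y, ‖y‖ = 1 → w y ≤ 0) : ∀ y, w y ≤ 0 := by
  have key : ∀ s : ℝ, (s = 1 ∨ s = -1) → ∀ y, 0 < s * (1 - ‖y‖ ^ 2) → w y ≤ 0 := by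
    intro s hs
    refine cmp_ball hlam hs (mkSub heq hc hb fun y hy => h1 y ?_)
    have a : 0 ≤ s * (1 - ‖y‖ ^ 2) := hy.1
    have b : ¬ 0 < s * (1 - ‖y‖ ^ 2) := hy.2
    have e : ‖y‖ ^ 2 = 1 := by rcases hs with rfl | rfl <;> linarith
    rw [← Real.sqrt_sq (norm_nonneg y), e, Real.sqrt_one]
  intro y
  rcases lt_trichotomy ‖y‖ 1 with h | h | h
  · exact key 1 (Or.inl rfl) y (by nlinarith [norm_nonneg y])
  · exact h1 y h
  · exact key (-1) (Or.inr rfl) y (by nlinarith [norm_nonneg y])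

lemma radial_le {lam : ℝ} (hlam : 0 < lam) {φ : EuclideanSpace ℝ (Fin n) → ℝ}
    (hφ : ContDiff ℝ 2 φ) (h : Ent n lam φ) (y z : EuclideanSpace ℝ (Fin n)) (hyz : ‖y‖ = ‖z‖) :
    φ y ≤ φ z := by
  by_cases hne : y = z
  · rw [hne]
  have hd : 0 < ‖y - z‖ := norm_pos_iff.2 (sub_ne_zero.2 hne)
  set a : EuclideanSpace ℝ (Fin n) := (‖y - z‖)⁻¹ • (y - z) with ha
  have ha1 : ‖a‖ = 1 := by rw [ha, norm_smul, norm_inv, norm_norm, inv_mul_cancel₀ hd.ne']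
  have hin : ∀ x, inner ℝ a x = (‖y - z‖)⁻¹ * inner ℝ (y - z) x := fun x => by
    rw [ha, real_inner_smul_left]
  set R : EuclideanSpace ℝ (Fin n) ≃ₗᵢ[ℝ] EuclideanSpace ℝ (Fin n) := (ℝ ∙ (y - z))ᗮ.reflection with hR
  have hRy : R y = z := Submodule.reflection_sub hyz
  have := cmp_half hlam ha1 (w := fun x => φ x - φ (R x)) ?_ y ?_
  · rw [hRy] at this; linarith
  · refine mkSub (fun x => ?_) (h.cont.sub (h.cont.comp R.continuous)) (bdd_sub h.bdd ?_) ?_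
    · refine ⟨_, (h.eqn x).sub ((HL.comp_isometry hφ R (y := x)).of_eq (h.eqn (R x)).lap_eq), ?_⟩
      have : Vn n (R x) = Vn n x := by unfold Vn; rw [R.norm_map]
      rw [this]
      exact le_of_eq (by ring)
    · obtain ⟨C, hC⟩ := h.bdd
      exact ⟨C, fun y => hC _⟩
    · intro x hx
      have h1 : 0 ≤ inner ℝ a x := hx.1
      have h2 : ¬ 0 < inner ℝ a x := hx.2
      have h3 : inner ℝ a x = 0 := le_antisymm (not_lt.1 h2) h1
      rw [hin] at h3
      have h4 : inner ℝ (y - z) x = 0 := by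
        rcases mul_eq_zero.1 h3 with h | h
        · exact absurd h (inv_pos.2 hd).ne'
        · exact h
      have : R x = x := Submodule.reflection_mem_subspace_eq_self
        (Submodule.mem_orthogonal_singleton_iff_inner_right.2 h4)
      simp [this]
  · rw [hin]
    refine mul_pos (inv_pos.2 hd) ?_
    have e := norm_sub_sq_real y z
    have : inner ℝ (y - z) y = ‖y - z‖ ^ 2 / 2 := by
      rw [inner_sub_left, real_inner_self_eq_norm_sq, real_inner_comm, e, ← hyz]; ring
    rw [this]; positivity

lemma ent_zero {lam : ℝ} (hlam : 0 < lam) {φ : EuclideanSpace ℝ (Fin n) → ℝ} (h : Ent n lam φ)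
    (h1 : ∀ y, ‖y‖ = 1 → φ y = 0) (y) : φ y = 0 := by
  refine le_antisymm (sphere_cmp hlam h.sub_eqn h.cont h.bdd (fun y hy => (h1 y hy).le) y) ?_
  have := sphere_cmp hlam h.neg.sub_eqn h.neg.cont h.neg.bdd (fun y hy => by rw [h1 y hy]; simp) y
  linarith

lemma no_pos {lam lam0 : ℝ} (hlam : 0 < lam) (hlt : lam < lam0)
    {φ Z : EuclideanSpace ℝ (Fin n) → ℝ} (h : Ent n lam φ) (hZ : Ent n lam0 Z)
    (Zpos : ∀ y, 0 < Z y) {c : ℝ} (hc : 0 < c) (h1 : ∀ y, ‖y‖ = 1 → φ y = c * Z y) : False := by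
  have hge : ∀ y, c * Z y - φ y ≤ 0 := by
    refine sphere_cmp hlam (fun y => ⟨_, ((hZ.eqn y).const_mul c).sub (h.eqn y), ?_⟩)
      ((continuous_const.mul hZ.cont).sub h.cont) (bdd_sub (bdd_mul c hZ.bdd) h.bdd)
      (fun y hy => by rw [h1 y hy]; simp)
    have e : c * ((lam0 - Vn n y) * Z y) - (lam - Vn n y) * φ y + (Vn n y - lam) * (c * Z y - φ y)
      = c * ((lam0 - lam) * Z y) := by ring
    rw [e]
    exact mul_nonneg hc.le (mul_nonneg (by linarith) (Zpos y).le)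
  have φpos : ∀ y, 0 < φ y := fun y => by
    have := hge y
    have := mul_pos hc (Zpos y)
    linarith
  have := cmp_univ (n := n) (lam := lam0) (μ := lam0 - lam) (by linarith) (by linarith) (w := Z)
    (G := φ) (mkSub hZ.sub_eqn hZ.cont hZ.bdd (by simp))
    (fun y => ⟨_, h.eqn y, le_of_eq (by ring)⟩) h.cont φpos 0
  exact absurd (Zpos 0) (not_lt.2 this)

theorem uniq_main (hn : 1 ≤ n) {lam lam0 : ℝ} (hlam : 0 < lam) (hlam0 : 0 < lam0)
    {φ Z : EuclideanSpace ℝ (Fin n) → ℝ} (hφ : ContDiff ℝ 2 φ) (h : Ent n lam φ)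
    (hZ : Ent n lam0 Z) (Zpos : ∀ y, 0 < Z y) (Zrad : ∀ y z, ‖y‖ = ‖z‖ → Z y = Z z) :
    (∀ y, φ y = 0) ∨ (lam = lam0 ∧ ∃ c : ℝ, ∀ y, φ y = c * Z y) := by
  have hrad : ∀ y z, ‖y‖ = ‖z‖ → φ y = φ z := fun y z hyz =>
    le_antisymm (radial_le hlam hφ h y z hyz) (radial_le hlam hφ h z y hyz.symm)
  set e : EuclideanSpace ℝ (Fin n) := EuclideanSpace.single ⟨0, hn⟩ 1 with he
  have he1 : ‖e‖ = 1 := by rw [he]; simp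
  set c : ℝ := φ e / Z e with hcdef
  have hc : ∀ y, ‖y‖ = 1 → φ y = c * Z y := fun y hy => by
    rw [hrad y e (by rw [hy, he1]), Zrad y e (by rw [hy, he1]), hcdef, div_mul_cancel₀ _ (Zpos e).ne']
  rcases lt_trichotomy lam lam0 with hlt | heq | hgt
  · left
    rcases lt_trichotomy c 0 with h0 | h0 | h0
    · exact (no_pos hlam hlt h.neg hZ Zpos (neg_pos.2 h0) fun y hy => by rw [hc y hy]; ring).elim
    · exact ent_zero hlam h fun y hy => by rw [hc y hy, h0, zero_mul]
    · exact (no_pos hlam hlt h hZ Zpos h0 hc).elim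
  · right
    refine ⟨heq, c, fun y => ?_⟩
    subst heq
    have hd : Ent n lam (fun y => φ y - c * Z y) :=
      ⟨fun y => ((h.eqn y).sub ((hZ.eqn y).const_mul c)).of_eq (by ring),
        h.cont.sub (continuous_const.mul hZ.cont), bdd_sub h.bdd (bdd_mul c hZ.bdd)⟩
    have := ent_zero hlam hd (fun y hy => by rw [hc y hy, sub_self]) y
    linarith
  · left
    have key : ∀ ψ, Ent n lam ψ → ∀ y, ψ y ≤ 0 := fun ψ hψ =>
      cmp_univ (n := n) (lam := lam) (μ := lam - lam0) hlam (by linarith) (w := ψ)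
        (G := Z) (mkSub hψ.sub_eqn hψ.cont hψ.bdd (by simp))
        (fun y => ⟨_, hZ.eqn y, le_of_eq (by ring)⟩) hZ.cont Zpos
    intro y
    have a := key φ h y
    have b := key _ h.neg y
    linarith

end uniq

/-- for `n ≥ 3`, `p = (n+2)/(n-2)`, there is a positive eigenvalue `λ₀ > 0`
of `L₀[φ] = Δφ + pU^{p-1}φ` in `L^∞(ℝⁿ)` with a bounded positive radially symmetric
eigenfunction `Z₀` having the decay `Z₀(y) ≍ |y|^{-(n-1)/2} e^{-√λ₀ |y|}` for `|y| ≥ 1`;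
moreover `λ₀` is the only positive eigenvalue and it is simple. -/
theorem statement5 (n : ℕ) (hn : 3 ≤ n) :
    ∃ (lam0 : ℝ) (Z0 : EuclideanSpace ℝ (Fin n) → ℝ),
      0 < lam0 ∧
      (∃ C : ℝ, ∀ y, |Z0 y| ≤ C) ∧
      (∀ y, 0 < Z0 y) ∧
      (∀ y z, ‖y‖ = ‖z‖ → Z0 y = Z0 z) ∧
      (∀ y : EuclideanSpace ℝ (Fin n),
        lap Z0 y +
          (((n : ℝ) + 2) / ((n : ℝ) - 2)) *
            stdBubble n y ^ ((((n : ℝ) + 2) / ((n : ℝ) - 2)) - 1) * Z0 y = lam0 * Z0 y) ∧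
      (∃ c₁ c₂ : ℝ, 0 < c₁ ∧ 0 < c₂ ∧
        ∀ y : EuclideanSpace ℝ (Fin n), 1 ≤ ‖y‖ →
          c₁ * ‖y‖ ^ (-(((n : ℝ) - 1) / 2)) * Real.exp (-Real.sqrt lam0 * ‖y‖) ≤ Z0 y ∧
          Z0 y ≤ c₂ * ‖y‖ ^ (-(((n : ℝ) - 1) / 2)) * Real.exp (-Real.sqrt lam0 * ‖y‖)) ∧
      (∀ (lam : ℝ) (φ : EuclideanSpace ℝ (Fin n) → ℝ), 0 < lam →
        ContDiff ℝ 2 φ → (∃ C : ℝ, ∀ y, |φ y| ≤ C) →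
        (∀ y, lap φ y +
            (((n : ℝ) + 2) / ((n : ℝ) - 2)) *
              stdBubble n y ^ ((((n : ℝ) + 2) / ((n : ℝ) - 2)) - 1) * φ y = lam * φ y) →
        ((∀ y, φ y = 0) ∨ (lam = lam0 ∧ ∃ c : ℝ, ∀ y, φ y = c * Z0 y))) := by
  obtain ⟨lam0, hl0, u, g, hu, upos, C, hC⟩ := shoot n (by omega)
  have hZ : ∀ y : EuclideanSpace ℝ (Fin n), HL (fun z => u ‖z‖) y ((lam0 - Vn n y) * u ‖y‖) :=
    fun y => hu.HL y
  have Zb : ∃ C : ℝ, ∀ y : EuclideanSpace ℝ (Fin n), |u ‖y‖| ≤ C :=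
    ⟨C, fun y => by rw [abs_of_pos (upos _ (norm_nonneg _))]; exact hC _ (norm_nonneg _)⟩
  have Zpos : ∀ y : EuclideanSpace ℝ (Fin n), 0 < u ‖y‖ := fun y => upos _ (norm_nonneg _)
  have Zrad : ∀ y z : EuclideanSpace ℝ (Fin n), ‖y‖ = ‖z‖ → u ‖y‖ = u ‖z‖ := fun y z h => by rw [h]
  refine ⟨lam0, fun y => u ‖y‖, hl0, Zb, Zpos, Zrad, fun y => ?_, ?_, ?_⟩
  · rw [(hZ y).lap_eq, pot_eq n hn y]; ring
  · obtain ⟨c₁, c₂, h1, h2, h⟩ := decay hn hl0 hu.uc upos hC hZ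
    refine ⟨c₁, c₂, h1, h2, fun y hy => ?_⟩
    have := h y hy
    unfold Ef at this
    simpa only [mul_assoc] using this
  · intro lam φ hlam hφ hb heq
    have hE : Ent n lam φ := by
      refine ⟨fun y => (HL.of_contDiff hφ).of_eq ?_, hφ.continuous, hb⟩
      have := heq y
      rw [pot_eq n hn y] at this
      linarith
    exact uniq_main (by omega) hlam hl0 hφ hE ⟨hZ, hu.uc.comp continuous_norm, Zb⟩ Zpos Zrad
end
end
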